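/- For every integer h ≥ 2 there exists s₀ = s₀(h) such that for every integer s ≥ s₀ the following holds: every finite graph G with average degree d(G) ≥ s^{500h²} either contains the complete bipartite graph K_{s,s} as a (not necessarily induced) subgraph, or contains an induced proper balanced subdivision of K_h, i.e. there exist an integer ℓ ≥ 2 and an induced subgraph of G isomorphic to the graph obtained from K_h by replacing every edge by a path with exactly ℓ edges, all internal vertices of these paths being new and pairwise distinct. -/

import Mathlib

open Finset

/-- The average degree `2|E|/|V|` of a finite simple graph. -/
noncomputable def avgDeg {V : Type*} [Fintype V] (G : SimpleGraph V) : ℝ :=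
  2 * G.edgeSet.ncard / Fintype.card V

/-- The degree of a vertex. -/
noncomputable def deg {V : Type*} (G : SimpleGraph V) (v : V) : ℕ :=
  (G.neighborSet v).ncard

/-- `G` contains `K_{s,s}` as a (not necessarily induced) subgraph. -/
def HasKssSubgraph {V : Type*} (G : SimpleGraph V) (s : ℕ) : Prop :=
  ∃ f : completeBipartiteGraph (Fin s) (Fin s) →g G, Function.Injective f

/-- `G` contains no cycle of length 4, even as a non-induced subgraph. -/
def C4Free {V : Type*} (G : SimpleGraph V) : Prop :=
  ¬ ∃ a b c d : V, a ≠ b ∧ a ≠ c ∧ a ≠ d ∧ b ≠ c ∧ b ≠ d ∧ c ≠ d ∧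
      G.Adj a b ∧ G.Adj b c ∧ G.Adj c d ∧ G.Adj d a

/-- The balanced subdivision of `K_h` in which every edge of `K_h` is replaced by a
path with exactly `ℓ` edges (intended for `ℓ ≥ 2`): branch vertices are `Fin h`,
and each pair `a < b` gets a path of `ℓ - 1` new internal vertices. -/
def balancedSubdivision (h ℓ : ℕ) :
    SimpleGraph (Fin h ⊕ ({p : Fin h × Fin h // p.1 < p.2} × Fin (ℓ - 1))) :=
  SimpleGraph.fromRel (fun x y =>
    match x, y with
    | Sum.inl u, Sum.inr ⟨⟨⟨a, b⟩, _⟩, i⟩ => (u = a ∧ (i : ℕ) = 0) ∨ (u = b ∧ (i : ℕ) = ℓ - 2)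
    | Sum.inr ⟨e, i⟩, Sum.inr ⟨e', j⟩ => e = e' ∧ (j : ℕ) = (i : ℕ) + 1
    | _, _ => False)

/-- `G` contains an induced proper balanced subdivision of `K_h`. -/
def HasInducedBalancedSubdivision {V : Type*} (G : SimpleGraph V) (h : ℕ) : Prop :=
  ∃ ℓ : ℕ, 2 ≤ ℓ ∧ Nonempty (balancedSubdivision h ℓ ↪g G)

/-- The number of edges of `G` with one endpoint in `A` and the other in `B`
(for disjoint `A`, `B`). -/
noncomputable def crossEdges {V : Type*} (G : SimpleGraph V) (A B : Set V) : ℕ :=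
  Set.ncard {p : V × V | p.1 ∈ A ∧ p.2 ∈ B ∧ G.Adj p.1 p.2}

/-- `G` is `d`-degenerate: every (induced) subgraph has a vertex of degree at most `d`. -/
def Degenerate {V : Type*} (G : SimpleGraph V) (d : ℕ) : Prop :=
  ∀ s : Finset V, s.Nonempty → ∃ v ∈ s, ((s : Set V) ∩ G.neighborSet v).ncard ≤ d

/-- The 1-subdivision of the multihypergraph with hyperedges `edges e`, `e : E`,
on vertex set `V`. -/
def oneSubdivision {E V : Type*} (edges : E → Finset V) : SimpleGraph (E ⊕ V) :=
  SimpleGraph.fromRel (fun x y =>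
    match x, y with
    | Sum.inl a, Sum.inr b => b ∈ edges a
    | _, _ => False)

/-- The 1-subdivision of a simple graph `G`. -/
def graphOneSubdivision {W : Type*} (G : SimpleGraph W) : SimpleGraph (G.edgeSet ⊕ W) :=
  SimpleGraph.fromRel (fun x y =>
    match x, y with
    | Sum.inl e, Sum.inr w => w ∈ (e : Sym2 W)
    | _, _ => False)

/-- `I` is an independent set of `G`. -/
def IndepSet {V : Type*} (G : SimpleGraph V) (I : Set V) : Prop :=
  I.Pairwise fun u v => ¬ G.Adj u v

/-- `G` has a clique on `k` vertices. -/
def HasClique {V : Type*} (G : SimpleGraph V) (k : ℕ) : Prop :=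
  ∃ t : Finset V, G.IsNClique k t

section Topological
variable {V W : Type}

/-- `G` contains a (not necessarily induced) subdivision of `K_h` all of whose paths have exactly
`ℓ` edges. -/
def BalTK (G : SimpleGraph V) (h ℓ : ℕ) : Prop :=
  ∃ (b : Fin h → V) (P : ∀ i j : Fin h, i < j → G.Walk (b i) (b j)),
    Function.Injective b ∧
    (∀ i j (hij : i < j), (P i j hij).IsPath ∧ (P i j hij).length = ℓ) ∧
    (∀ i j (hij : i < j) k, b k ∈ (P i j hij).support → k = i ∨ k = j) ∧
    (∀ i j (hij : i < j) i' j' (hij' : i' < j'), (i, j) ≠ (i', j') →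
      ∀ x ∈ (P i j hij).support, x ∈ (P i' j' hij').support → ∃ k, x = b k)

theorem BalTK.map {G : SimpleGraph V} {G' : SimpleGraph W} {h ℓ : ℕ} (φ : G' →g G)
    (hφ : Function.Injective φ) (H : BalTK G' h ℓ) : BalTK G h ℓ := by
  obtain ⟨b, P, hb, h1, h2, h3⟩ := H
  refine ⟨fun i => φ (b i), fun i j hij => (P i j hij).map φ, hφ.comp hb, ?_, ?_, ?_⟩
  · intro i j hij
    exact ⟨SimpleGraph.Walk.IsPath.map hφ (h1 i j hij).1, by
      simpa using (h1 i j hij).2⟩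
  · intro i j hij k hk
    simp only [SimpleGraph.Walk.support_map, List.mem_map] at hk
    obtain ⟨y, hy, hyk⟩ := hk
    exact h2 i j hij k (hφ hyk ▸ hy)
  · intro i j hij i' j' hij' hne x hx hx'
    simp only [SimpleGraph.Walk.support_map, List.mem_map] at hx hx'
    obtain ⟨y, hy, rfl⟩ := hx
    obtain ⟨z, hz, hzy⟩ := hx'
    obtain ⟨k, hk⟩ := h3 i j hij i' j' hij' hne y hy (hφ hzy ▸ hz)
    exact ⟨k, by rw [hk]⟩

theorem BalTK.of_clique {G : SimpleGraph V} {h : ℕ} (b : Fin h → V) (hb : Function.Injective b)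
    (hadj : ∀ i j, i < j → G.Adj (b i) (b j)) : BalTK G h 1 := by
  refine ⟨b, fun i j hij => (hadj i j hij).toWalk, hb, ?_, ?_, ?_⟩
  · intro i j hij
    refine ⟨?_, by simp⟩
    simp [SimpleGraph.Walk.isPath_def, (hadj i j hij).ne]
  · intro i j hij k hk
    simpa [hb.eq_iff] using hk
  · intro i j hij i' j' hij' hne x hx _
    simp only [SimpleGraph.Adj.toWalk, SimpleGraph.Walk.support_cons,
      SimpleGraph.Walk.support_nil, List.mem_cons, List.not_mem_nil, or_false] at hx
    rcases hx with rfl | rfl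
    exacts [⟨i, rfl⟩, ⟨j, rfl⟩]

/-- The walk obtained by replacing each edge `e` of a walk by a path of length two
through `μ e`. -/
def subdivWalk {Γ : SimpleGraph W} {G : SimpleGraph V} (φ : W → V) (μ : Sym2 W → V)
    (hadj : ∀ x y, Γ.Adj x y → G.Adj (φ x) (μ s(x, y))) :
    ∀ {x y : W}, Γ.Walk x y → G.Walk (φ x) (φ y)
  | _, _, .nil => .nil
  | x, _, .cons (v := v) hxv p =>
    .cons (hadj x v hxv) (.cons (by have := hadj v x hxv.symm; rw [Sym2.eq_swap]; exact this.symm)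
      (subdivWalk φ μ hadj p))

section
variable {Γ : SimpleGraph W} {G : SimpleGraph V} (φ : W → V) (μ : Sym2 W → V)
    (hadj : ∀ x y, Γ.Adj x y → G.Adj (φ x) (μ s(x, y)))

theorem length_subdivWalk {x y : W} (p : Γ.Walk x y) :
    (subdivWalk φ μ hadj p).length = 2 * p.length := by
  induction p with
  | nil => rfl
  | cons h p ih => simp [subdivWalk, ih]; ring

theorem mem_support_subdivWalk {x y : W} (p : Γ.Walk x y) (z : V) :
    z ∈ (subdivWalk φ μ hadj p).support ↔
      (∃ w ∈ p.support, z = φ w) ∨ ∃ e ∈ p.edges, z = μ e := by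
  induction p with
  | nil => simp [subdivWalk]
  | cons h p ih =>
    simp only [subdivWalk, SimpleGraph.Walk.support_cons, List.mem_cons, ih,
      SimpleGraph.Walk.edges_cons, exists_eq_or_imp]
    grind

theorem isPath_subdivWalk (hφ : Function.Injective φ) (hμ : Set.InjOn μ Γ.edgeSet)
    (hμφ : ∀ e ∈ Γ.edgeSet, ∀ x, μ e ≠ φ x) {x y : W} (p : Γ.Walk x y) (hp : p.IsPath) :
    (subdivWalk φ μ hadj p).IsPath := by
  induction p with
  | nil => simp [subdivWalk]
  | @cons u v w h p ih =>
    rw [SimpleGraph.Walk.cons_isPath_iff] at hp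
    simp only [subdivWalk, SimpleGraph.Walk.cons_isPath_iff, SimpleGraph.Walk.support_cons,
      List.mem_cons, mem_support_subdivWalk]
    refine ⟨⟨ih hp.1, ?_⟩, ?_⟩
    · rintro (⟨z, hz, he⟩ | ⟨e, he, hee⟩)
      · exact hμφ _ (by simpa using h) _ he
      · have := hμ (by simpa using h) (p.edges_subset_edgeSet he) hee
        subst this
        exact hp.2 (p.fst_mem_support_of_mem_edges he)
    · rintro (he | ⟨z, hz, he⟩ | ⟨e, he, hee⟩)
      · exact hμφ _ (by simpa using h) _ he.symm
      · exact hp.2 (hφ he ▸ hz)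
      · exact hμφ _ (p.edges_subset_edgeSet he) _ hee.symm
end

theorem BalTK.of_subdiv {Γ : SimpleGraph W} {G : SimpleGraph V} (φ : W → V) (μ : Sym2 W → V)
    (hadj : ∀ x y, Γ.Adj x y → G.Adj (φ x) (μ s(x, y))) (hφ : Function.Injective φ)
    (hμ : Set.InjOn μ Γ.edgeSet) (hμφ : ∀ e ∈ Γ.edgeSet, ∀ x, μ e ≠ φ x) {h ℓ : ℕ} (H : BalTK Γ h ℓ) :
    BalTK G h (2 * ℓ) := by
  obtain ⟨b, P, hb, h1, h2, h3⟩ := H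
  refine ⟨fun i => φ (b i), fun i j hij => subdivWalk φ μ hadj (P i j hij), hφ.comp hb, ?_, ?_, ?_⟩
  · intro i j hij
    refine ⟨isPath_subdivWalk φ μ hadj hφ hμ hμφ _ (h1 i j hij).1, ?_⟩
    rw [length_subdivWalk, (h1 i j hij).2]
  · intro i j hij k hk
    rw [mem_support_subdivWalk] at hk
    rcases hk with ⟨w, hw, he⟩ | ⟨e, he, hee⟩
    · exact h2 i j hij k (hφ he ▸ hw)
    · exact absurd hee.symm (hμφ _ (SimpleGraph.Walk.edges_subset_edgeSet _ he) _)
  · intro i j hij i' j' hij' hne x hx hx'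
    rw [mem_support_subdivWalk] at hx hx'
    rcases hx with ⟨w, hw, rfl⟩ | ⟨e, he, rfl⟩
    · rcases hx' with ⟨w', hw', he⟩ | ⟨e, he, hee⟩
      · obtain ⟨k, hk⟩ := h3 i j hij i' j' hij' hne w hw (hφ he ▸ hw')
        exact ⟨k, by rw [hk]⟩
      · exact absurd hee.symm (hμφ _ (SimpleGraph.Walk.edges_subset_edgeSet _ he) _)
    · exfalso
      rcases hx' with ⟨w', hw', hee⟩ | ⟨e', he', hee⟩
      · exact hμφ _ (SimpleGraph.Walk.edges_subset_edgeSet _ he) _ hee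
      · have := hμ (SimpleGraph.Walk.edges_subset_edgeSet _ he)
          (SimpleGraph.Walk.edges_subset_edgeSet _ he') hee
        subst this
        induction e using Sym2.ind with
        | _ u v =>
          have huv : u ≠ v := ((P i j hij).adj_of_mem_edges he).ne
          have a1 := (P i j hij).fst_mem_support_of_mem_edges he
          have a2 := (P i j hij).snd_mem_support_of_mem_edges he
          have a3 := (P i' j' hij').fst_mem_support_of_mem_edges he'
          have a4 := (P i' j' hij').snd_mem_support_of_mem_edges he'
          obtain ⟨k, rfl⟩ := h3 i j hij i' j' hij' hne u a1 a3
          obtain ⟨l, rfl⟩ := h3 i j hij i' j' hij' hne v a2 a4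
          have hkl : k ≠ l := fun h => huv (by rw [h])
          have b1 := h2 _ _ _ _ a1
          have b2 := h2 _ _ _ _ a2
          have b3 := h2 _ _ _ _ a3
          have b4 := h2 _ _ _ _ a4
          apply hne
          simp only [Prod.mk.injEq]
          omega
end Topological

section Growth
open scoped Classical
variable {V : Type} [Fintype V]

/-- The external neighbourhood of a set of vertices. -/
noncomputable def nbh (G : SimpleGraph V) (X : Finset V) : Finset V :=
  univ.filter fun y => y ∉ X ∧ ∃ x ∈ X, G.Adj x y

/-- Vertices reachable from `w` by a walk of length at most `k` avoiding `F` (except at `w`). -/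
noncomputable def ball (G : SimpleGraph V) (F : Finset V) (w : V) : ℕ → Finset V
  | 0 => {w}
  | k + 1 => ball G F w k ∪ (nbh G (ball G F w k) \ F)

/-- The number of ordered adjacent pairs inside `S`. -/
noncomputable def adjPairs (G : SimpleGraph V) (S : Finset V) : ℕ :=
  ((S ×ˢ S).filter fun p => G.Adj p.1 p.2).card

theorem mem_nbh {G : SimpleGraph V} {X : Finset V} {y : V} :
    y ∈ nbh G X ↔ y ∉ X ∧ ∃ x ∈ X, G.Adj x y := by simp [nbh]

variable {G : SimpleGraph V} {F : Finset V} {w : V}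

theorem ball_subset_succ (k : ℕ) : ball G F w k ⊆ ball G F w (k + 1) := subset_union_left

theorem ball_mono {k l : ℕ} (h : k ≤ l) : ball G F w k ⊆ ball G F w l :=
  monotone_nat_of_le_succ (f := ball G F w) ball_subset_succ h

theorem mem_ball_self (k : ℕ) : w ∈ ball G F w k := ball_mono (Nat.zero_le k) (by simp [ball])

theorem mem_ball_iff {x : V} {k : ℕ} :
    x ∈ ball G F w k ↔
      ∃ p : G.Walk w x, p.length ≤ k ∧ ∀ y ∈ p.support, y = w ∨ y ∉ F := by
  constructor
  · induction k generalizing x with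
    | zero =>
      intro h
      simp only [ball, mem_singleton] at h
      subst h
      exact ⟨.nil, by simp, by simp⟩
    | succ k ih =>
      intro h
      simp only [ball, mem_union, mem_sdiff, mem_nbh] at h
      rcases h with h | ⟨⟨-, z, hz, hzx⟩, hF⟩
      · obtain ⟨p, hp, hpF⟩ := ih h
        exact ⟨p, by omega, hpF⟩
      · obtain ⟨p, hp, hpF⟩ := ih hz
        refine ⟨p.concat hzx, by simpa using hp, ?_⟩
        intro y hy
        rw [SimpleGraph.Walk.support_concat] at hy
        simp only [List.mem_append, List.mem_singleton] at hy
        rcases hy with hy | rfl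
        exacts [hpF y hy, Or.inr hF]
  · rintro ⟨p, hp, hpF⟩
    have key : ∀ t, t ≤ p.length → p.getVert t ∈ ball G F w t := by
      intro t
      induction t with
      | zero => intro _; simp [ball]
      | succ t ih =>
        intro ht
        have h1 := ih (by omega)
        have h2 := p.adj_getVert_succ (i := t) (by omega)
        rcases hpF _ (p.getVert_mem_support (t + 1)) with h | h
        · rw [h]; exact mem_ball_self _
        · simp only [ball, mem_union, mem_sdiff, mem_nbh]
          by_cases h3 : p.getVert (t + 1) ∈ ball G F w t
          · exact Or.inl h3
          · exact Or.inr ⟨⟨h3, _, h1, h2⟩, h⟩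
    have := key p.length le_rfl
    rw [p.getVert_length] at this
    exact ball_mono hp this

theorem ball_anti {F' : Finset V} (h : F ⊆ F') (k : ℕ) : ball G F' w k ⊆ ball G F w k := by
  intro x hx
  rw [mem_ball_iff] at hx ⊢
  obtain ⟨p, hp, hF⟩ := hx
  exact ⟨p, hp, fun y hy => (hF y hy).imp_right fun h' h'' => h' (h h'')⟩

theorem nbh_ball_subset (k : ℕ) : nbh G (ball G F w k) ⊆ ball G ∅ w (k + 1) := by
  intro x hx
  obtain ⟨-, z, hz, hzx⟩ := mem_nbh.1 hx
  have hz' := ball_anti (empty_subset F) k hz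
  by_cases h : x ∈ ball G ∅ w k
  · exact ball_subset_succ k h
  · simp only [ball, mem_union, mem_sdiff, mem_nbh]
    exact Or.inr ⟨⟨h, z, hz', hzx⟩, by simp⟩

theorem card_ball_le (Δ : ℕ) (hΔ : ∀ v, (univ.filter fun y => G.Adj v y).card ≤ Δ) (k : ℕ) :
    (ball G F w k).card ≤ (Δ + 1) ^ k := by
  induction k with
  | zero => simp [ball]
  | succ k ih =>
    have h1 : (nbh G (ball G F w k)).card ≤ (ball G F w k).card * Δ := by
      calc (nbh G (ball G F w k)).card
          ≤ ((ball G F w k).biUnion fun v => univ.filter fun y => G.Adj v y).card := by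
            apply card_le_card
            intro y hy
            obtain ⟨-, x, hx, hxy⟩ := mem_nbh.1 hy
            simp only [mem_biUnion, mem_filter, mem_univ, true_and]
            exact ⟨x, hx, hxy⟩
        _ ≤ _ := card_biUnion_le_card_mul _ _ _ fun v _ => hΔ v
    calc (ball G F w (k + 1)).card
        ≤ (ball G F w k).card + (nbh G (ball G F w k) \ F).card := card_union_le _ _
      _ ≤ (ball G F w k).card + (ball G F w k).card * Δ := by
          gcongr
          exact (card_le_card sdiff_subset).trans h1
      _ = (ball G F w k).card * (Δ + 1) := by ring
      _ ≤ (Δ + 1) ^ k * (Δ + 1) := by gcongr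
      _ = _ := by ring

/-- A slowly growing function. -/
noncomputable def ell (x : ℝ) : ℝ := 2 + Real.log x

/-- `G` is a sublinear expander. -/
def SublinearExpander (G : SimpleGraph V) : Prop :=
  ∀ X : Finset V, X.Nonempty → 2 * X.card ≤ Fintype.card V →
    (X.card : ℝ) ≤ 10 * ell X.card ^ 2 * (nbh G X).card

theorem ell_cube_growth {b c : ℝ} (hb : 1 ≤ b) (hc : b + b / (20 * ell b ^ 2) ≤ c) :
    ell b ^ 3 + 3 / 40 ≤ ell c ^ 3 := by
  have hl : 2 ≤ ell b := by unfold ell; linarith [Real.log_nonneg hb]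
  set e := ell b with he
  set u := 1 / (20 * e ^ 2) with hu
  have hu0 : 0 < u := by positivity
  have hu1 : u ≤ 1 := by
    rw [hu, div_le_one (by positivity)]; nlinarith
  have h1 : b * (1 + u) ≤ c := by
    calc b * (1 + u) = b + b / (20 * e ^ 2) := by rw [hu]; ring
      _ ≤ c := hc
  have h2 : Real.log b + Real.log (1 + u) ≤ Real.log c := by
    rw [← Real.log_mul (by positivity) (by positivity)]
    exact Real.log_le_log (by positivity) h1
  have h3 : u / 2 ≤ Real.log (1 + u) := by
    have := Real.one_sub_inv_le_log_of_pos (x := 1 + u) (by positivity)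
    have h4 : u / 2 ≤ 1 - (1 + u)⁻¹ := by
      rw [le_sub_iff_add_le, ← le_sub_iff_add_le', inv_eq_one_div, div_le_iff₀ (by positivity)]
      nlinarith
    linarith
  have h5 : e + u / 2 ≤ ell c := by
    rw [he]; unfold ell; linarith
  have h6 : (e + u / 2) ^ 3 ≤ ell c ^ 3 := by gcongr
  have h7 : e ^ 2 * u = 1 / 20 := by rw [hu]; field_simp
  nlinarith [sq_nonneg (u / 2), mul_pos hu0 hu0, pow_pos hu0 3]

theorem half_lt_card_ball (hG : SublinearExpander G) (L : ℕ → ℝ) (δ : ℝ) (m : ℕ) (hm : 1 ≤ m)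
    (hδ : 2 ≤ δ)
    (hdeg : δ ≤ (univ.filter fun y => G.Adj w y).card)
    (hloss : ∀ k < m, ((F ∩ nbh G (ball G F w k)).card : ℝ) ≤ L k)
    (hL0 : L 0 ≤ δ / 2)
    (hNC : ∀ k : ℕ, 1 ≤ k → ∀ x : ℝ, δ / 2 ≤ x → 3 * ((k : ℝ) - 1) / 40 ≤ ell x ^ 3 →
      20 * ell x ^ 2 * L k ≤ x)
    (hfin : ell (Fintype.card V) ^ 3 < 3 * ((m : ℝ) - 1) / 40) :
    Fintype.card V < 2 * (ball G F w m).card := by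
  by_contra hcon
  push Not at hcon
  have hsucc : ∀ k, ((ball G F w (k + 1)).card : ℝ) =
      (ball G F w k).card + (nbh G (ball G F w k)).card - (F ∩ nbh G (ball G F w k)).card := by
    intro k
    have h1 : (ball G F w (k + 1)).card =
        (ball G F w k).card + (nbh G (ball G F w k) \ F).card := by
      rw [ball, card_union_of_disjoint]
      rw [disjoint_left]
      intro x hx hx'
      exact (mem_nbh.1 (mem_sdiff.1 hx').1).1 hx
    have h2 := card_sdiff_add_card_inter (nbh G (ball G F w k)) F
    rw [inter_comm] at h2
    rw [h1, ← h2]; push_cast; ring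
  have key : ∀ k, 1 ≤ k → k ≤ m → δ / 2 ≤ ((ball G F w k).card : ℝ) ∧
      3 * ((k : ℝ) - 1) / 40 ≤ ell (ball G F w k).card ^ 3 := by
    intro k hk
    induction k, hk using Nat.le_induction with
    | base =>
      intro _
      have h0 := hsucc 0
      have h1 : (univ.filter fun y => G.Adj w y).card ≤ (nbh G (ball G F w 0)).card := by
        apply card_le_card
        intro y hy
        simp only [mem_filter, mem_univ, true_and] at hy
        exact mem_nbh.2 ⟨by simpa [ball] using hy.ne', w, by simp [ball], hy⟩
      have h2 := hloss 0 (by omega)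
      have h3 : ((univ.filter fun y => G.Adj w y).card : ℝ) ≤ (nbh G (ball G F w 0)).card := by
        exact_mod_cast h1
      have h4 : δ / 2 ≤ ((ball G F w 1).card : ℝ) := by
        rw [zero_add] at h0
        rw [h0]
        have : (0 : ℝ) ≤ (ball G F w 0).card := by positivity
        linarith
      refine ⟨h4, ?_⟩
      have : 0 ≤ Real.log (ball G F w 1).card := Real.log_nonneg (by linarith)
      have : 0 ≤ ell (ball G F w 1).card := by unfold ell; linarith
      norm_num
      positivity
    | succ k hk ih =>
      intro hkm
      obtain ⟨h1, h2⟩ := ih (by omega)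
      have h3 := hNC k hk _ h1 h2
      have hb1 : (1 : ℝ) ≤ (ball G F w k).card := by linarith
      have h4 := hG (ball G F w k) ⟨w, mem_ball_self k⟩
        ((Nat.mul_le_mul_left 2 (card_le_card (ball_mono (by omega)))).trans hcon)
      have h5 := hloss k (by omega)
      have hl : 2 ≤ ell (ball G F w k).card := by unfold ell; linarith [Real.log_nonneg hb1]
      have h6 : ((ball G F w k).card : ℝ) + (ball G F w k).card / (20 * ell (ball G F w k).card ^ 2)
          ≤ (ball G F w (k + 1)).card := by
        rw [hsucc k]
        set e := ell (ball G F w k).card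
        have : ((ball G F w k).card : ℝ) / (20 * e ^ 2) ≤
            (nbh G (ball G F w k)).card - (F ∩ nbh G (ball G F w k)).card := by
          rw [div_le_iff₀ (by positivity)]
          have : 20 * e ^ 2 * ((F ∩ nbh G (ball G F w k)).card : ℝ) ≤ 20 * e ^ 2 * L k := by
            gcongr
          nlinarith
        linarith
      have h7 := ell_cube_growth hb1 h6
      refine ⟨h1.trans (Nat.cast_le.2 (card_le_card (ball_subset_succ k))), ?_⟩
      push_cast
      linarith
  obtain ⟨h1, h2⟩ := key m hm le_rfl
  have hb1 : (1 : ℝ) ≤ (ball G F w m).card := by linarith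
  have h3 : ell (ball G F w m).card ≤ ell (Fintype.card V) := by
    unfold ell
    gcongr
    exact_mod_cast card_le_univ _
  have hl : 0 ≤ ell (ball G F w m).card := by unfold ell; linarith [Real.log_nonneg hb1]
  have h4 : ell (ball G F w m).card ^ 3 ≤ ell (Fintype.card V) ^ 3 := by gcongr
  linarith

theorem exists_walk_of_balls {F₀ F₁ F₂ : Finset V} {w₁ w₂ : V} {m : ℕ} (h₁ : F₀ ⊆ F₁)
    (h₂ : F₀ ⊆ F₂) (hb₁ : Fintype.card V < 2 * (ball G F₁ w₁ m).card)
    (hb₂ : Fintype.card V < 2 * (ball G F₂ w₂ m).card) :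
    ∃ p : G.Walk w₁ w₂, p.length ≤ 2 * m ∧ ∀ y ∈ p.support, y = w₁ ∨ y = w₂ ∨ y ∉ F₀ := by
  have : (ball G F₁ w₁ m ∩ ball G F₂ w₂ m).Nonempty := by
    rw [← card_pos]
    have h1 := card_union_add_card_inter (ball G F₁ w₁ m) (ball G F₂ w₂ m)
    have h2 := card_le_univ (ball G F₁ w₁ m ∪ ball G F₂ w₂ m)
    omega
  obtain ⟨x, hx⟩ := this
  rw [mem_inter, mem_ball_iff, mem_ball_iff] at hx
  obtain ⟨⟨p, hp, hpF⟩, q, hq, hqF⟩ := hx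
  refine ⟨p.append q.reverse, by simp; omega, ?_⟩
  intro y hy
  rw [SimpleGraph.Walk.mem_support_append_iff] at hy
  rcases hy with hy | hy
  · rcases hpF y hy with h | h
    exacts [Or.inl h, Or.inr (Or.inr fun h' => h (h₁ h'))]
  · rw [SimpleGraph.Walk.support_reverse, List.mem_reverse] at hy
    rcases hqF y hy with h | h
    exacts [Or.inr (Or.inl h), Or.inr (Or.inr fun h' => h (h₂ h'))]

end Growth

section ExpanderExistence
set_option linter.unusedSectionVars false
open scoped Classical
variable {V : Type} [Fintype V]

/-- The weight used to select a sublinear expander. -/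
noncomputable def expWeight (x : ℝ) : ℝ := 2 - 1 / (1 + Real.log x)

theorem expWeight_mono {x y : ℝ} (hx : 1 ≤ x) (hxy : x ≤ y) : expWeight x ≤ expWeight y := by
  unfold expWeight
  have h1 := Real.log_nonneg hx
  have h2 : Real.log x ≤ Real.log y := Real.log_le_log (by linarith) hxy
  gcongr

theorem one_le_expWeight {x : ℝ} (hx : 1 ≤ x) : 1 ≤ expWeight x := by
  have := expWeight_mono le_rfl hx
  simpa [expWeight, show (2 : ℝ) - 1 = 1 by norm_num] using this

theorem expWeight_le_two {x : ℝ} (hx : 1 ≤ x) : expWeight x ≤ 2 := by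
  unfold expWeight
  have h1 := Real.log_nonneg hx
  have : 0 ≤ 1 / (1 + Real.log x) := by positivity
  linarith

theorem le_of_expWeight_ineq {n x y : ℝ} (hx : 1 ≤ x) (hy : 0 ≤ y) (hn : 2 * x ≤ n)
    (h : n * expWeight n ≤ (x + y) * expWeight (x + y) + (n - x) * expWeight (n - x)) :
    x ≤ 10 * ell x ^ 2 * y := by
  have hlx := Real.log_nonneg hx
  have hl : 2 ≤ ell x := by unfold ell; linarith
  rcases le_or_gt x y with hxy | hxy
  · nlinarith [mul_nonneg hy (sq_nonneg (ell x)), mul_self_nonneg (ell x - 2)]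
  have h1 : expWeight (n - x) ≤ expWeight n := expWeight_mono (by linarith) (by linarith)
  have h2 : expWeight (2 * x) ≤ expWeight n := expWeight_mono (by linarith) hn
  have h3 : x * expWeight (2 * x) ≤ (x + y) * expWeight (x + y) := by
    have : (n - x) * expWeight (n - x) ≤ (n - x) * expWeight n := by
      gcongr; linarith
    have : x * expWeight (2 * x) ≤ x * expWeight n := by gcongr
    nlinarith
  have h4 : expWeight (x + y) ≤ 2 := expWeight_le_two (by linarith)
  have h5 : x * (expWeight (2 * x) - expWeight (x + y)) ≤ 2 * y := by nlinarith
  have ha : 0 ≤ Real.log (x + y) := Real.log_nonneg (by linarith)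
  have hb : Real.log (x + y) ≤ Real.log (2 * x) := Real.log_le_log (by linarith) (by linarith)
  have hc : 1 + Real.log (2 * x) ≤ ell x := by
    unfold ell
    rw [Real.log_mul (by norm_num) (by linarith)]
    have := Real.log_two_lt_d9
    linarith
  have h6 : Real.log (2 * x) - Real.log (x + y) ≤
      ell x ^ 2 * (expWeight (2 * x) - expWeight (x + y)) := by
    have : expWeight (2 * x) - expWeight (x + y) =
        (Real.log (2 * x) - Real.log (x + y)) /
          ((1 + Real.log (x + y)) * (1 + Real.log (2 * x))) := by
      unfold expWeight
      have : 1 + Real.log (x + y) ≠ 0 := by positivity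
      have : 1 + Real.log (2 * x) ≠ 0 := by
        have : 0 ≤ Real.log (2 * x) := ha.trans hb
        positivity
      field_simp
      ring
    rw [this, mul_div_assoc', le_div_iff₀ (by
      have : 0 ≤ Real.log (2 * x) := ha.trans hb
      positivity), mul_comm]
    gcongr
    calc (1 + Real.log (x + y)) * (1 + Real.log (2 * x)) ≤ ell x * ell x :=
          mul_le_mul (by linarith) hc (by linarith) (by linarith)
      _ = _ := by ring
  have h7 : (x - y) / (2 * x) ≤ Real.log (2 * x) - Real.log (x + y) := by
    rw [← Real.log_div (by positivity) (by positivity)]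
    have := Real.one_sub_inv_le_log_of_pos (x := 2 * x / (x + y)) (by positivity)
    rw [inv_div] at this
    have h8 : (x - y) / (2 * x) = 1 - (x + y) / (2 * x) := by field_simp; ring
    rw [h8]; exact this
  have h8 : (x - y) / 2 ≤ ell x ^ 2 * (2 * y) := by
    calc (x - y) / 2 = x * ((x - y) / (2 * x)) := by field_simp
      _ ≤ x * (ell x ^ 2 * (expWeight (2 * x) - expWeight (x + y))) := by
          gcongr; exact h7.trans h6
      _ = ell x ^ 2 * (x * (expWeight (2 * x) - expWeight (x + y))) := by ring
      _ ≤ _ := by gcongr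
  nlinarith [mul_nonneg hy (sq_nonneg (ell x)), mul_self_nonneg (ell x - 2)]

theorem adjPairs_eq_sum (G : SimpleGraph V) (S : Finset V) :
    adjPairs G S = ∑ v ∈ S, (S.filter fun y => G.Adj v y).card := by
  unfold adjPairs
  rw [card_filter, sum_product]
  exact sum_congr rfl fun v _ => (card_filter _ _).symm

theorem adjPairs_le_erase (G : SimpleGraph V) {S : Finset V} {v : V} (_hv : v ∈ S) :
    adjPairs G S ≤ adjPairs G (S.erase v) + 2 * (S.filter fun y => G.Adj v y).card := by
  unfold adjPairs
  have : ((S ×ˢ S).filter fun p => G.Adj p.1 p.2) ⊆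
      (((S.erase v ×ˢ S.erase v).filter fun p => G.Adj p.1 p.2) ∪
        (S.filter fun y => G.Adj v y).image fun y => (v, y)) ∪
        (S.filter fun y => G.Adj v y).image fun y => (y, v) := by
    rintro ⟨a, b⟩ hab
    simp only [mem_filter, mem_product, mem_union, mem_erase, mem_image, Prod.mk.injEq] at hab ⊢
    by_cases ha : a = v
    · subst ha
      exact Or.inl (Or.inr ⟨b, ⟨hab.1.2, hab.2⟩, rfl, rfl⟩)
    · by_cases hb : b = v
      · subst hb
        exact Or.inr ⟨a, ⟨hab.1.1, hab.2.symm⟩, rfl, rfl⟩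
      · exact Or.inl (Or.inl ⟨⟨⟨ha, hab.1.1⟩, hb, hab.1.2⟩, hab.2⟩)
  calc _ ≤ _ := card_le_card this
    _ ≤ _ := card_union_le _ _
    _ ≤ _ := Nat.add_le_add (card_union_le _ _) le_rfl
    _ ≤ _ := by
      have h1 := card_image_le (s := S.filter fun y => G.Adj v y) (f := fun y => (v, y))
      have h2 := card_image_le (s := S.filter fun y => G.Adj v y) (f := fun y => (y, v))
      omega

theorem exists_expander_finset [Nonempty V] (G : SimpleGraph V) (d : ℝ) (hd : 0 < d)
    (hG : d * Fintype.card V ≤ adjPairs G univ) :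
    ∃ S : Finset V, S.Nonempty ∧
      (∀ v ∈ S, d / 4 ≤ ((S.filter fun y => G.Adj v y).card : ℝ)) ∧
      ∀ X ⊆ S, X.Nonempty → 2 * X.card ≤ S.card →
        (X.card : ℝ) ≤ 10 * ell X.card ^ 2 *
          (S.filter fun y => y ∉ X ∧ ∃ x ∈ X, G.Adj x y).card := by
  let g : Finset V → ℝ := fun S => (adjPairs G S : ℝ) / (S.card * expWeight S.card)
  obtain ⟨S, hS, hmax⟩ := exists_max_image (univ.filter fun S : Finset V => S.Nonempty) g
    ⟨univ, by simp⟩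
  simp only [mem_filter, mem_univ, true_and] at hS hmax
  set ρ := g S with hρ
  have hcard : ∀ T : Finset V, T.Nonempty → (1 : ℝ) ≤ T.card := fun T hT => by
    exact_mod_cast hT.card_pos
  have hle : ∀ T : Finset V, (adjPairs G T : ℝ) ≤ ρ * (T.card * expWeight T.card) := by
    intro T
    rcases T.eq_empty_or_nonempty with rfl | hT
    · simp [adjPairs]
    · have := hmax T hT
      have h1 := hcard T hT
      have h2 := one_le_expWeight h1
      exact (div_le_iff₀ (by positivity)).1 this
  have hS1 := hcard S hS
  have hSw := one_le_expWeight hS1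
  have hSeq : (adjPairs G S : ℝ) = ρ * (S.card * expWeight S.card) := by
    rw [hρ]; simp only [g]; field_simp
  have hρd : d / 2 ≤ ρ := by
    have h1 := hcard univ univ_nonempty
    rw [card_univ] at h1
    refine le_trans ?_ (hmax univ univ_nonempty)
    simp only [g, card_univ]
    rw [le_div_iff₀ (by have := one_le_expWeight h1; positivity)]
    have := expWeight_le_two h1
    have h3 : d / 2 * (Fintype.card V * expWeight (Fintype.card V)) ≤
      d / 2 * (Fintype.card V * 2) := by gcongr
    linarith
  have hρ0 : 0 < ρ := by linarith
  refine ⟨S, hS, ?_, ?_⟩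
  · intro v hv
    have h1 : (adjPairs G S : ℝ) ≤ adjPairs G (S.erase v) +
        2 * ((S.filter fun y => G.Adj v y).card : ℝ) := by
      exact_mod_cast adjPairs_le_erase G hv
    have h2 := hle (S.erase v)
    have h3 : ((S.erase v).card : ℝ) = S.card - 1 := by
      rw [card_erase_of_mem hv, Nat.cast_sub hS.card_pos]; simp
    have h4 : ((S.erase v).card : ℝ) * expWeight (S.erase v).card ≤
        (S.card - 1) * expWeight S.card := by
      rcases (S.erase v).eq_empty_or_nonempty with he | he
      · rw [he] at h3 ⊢
        simp only [card_empty, Nat.cast_zero] at h3 ⊢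
        rw [← h3]; simp
      · rw [← h3]
        refine mul_le_mul_of_nonneg_left ?_ (Nat.cast_nonneg _)
        apply expWeight_mono (hcard _ he)
        linarith
    have h5 : ρ * (((S.erase v).card : ℝ) * expWeight (S.erase v).card) ≤
      ρ * ((S.card - 1) * expWeight S.card) := mul_le_mul_of_nonneg_left h4 hρ0.le
    nlinarith
  · intro X hXS hX h2X
    set N := S.filter fun y => y ∉ X ∧ ∃ x ∈ X, G.Adj x y with hN
    have hdisj : Disjoint X N := by
      rw [disjoint_left]; intro x hx hx'
      simp only [hN, mem_filter] at hx'
      exact hx'.2.1 hx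
    have h1 : (adjPairs G S : ℝ) ≤ adjPairs G (X ∪ N) + adjPairs G (S \ X) := by
      norm_cast
      unfold adjPairs
      refine le_trans (card_le_card ?_) (card_union_le _ _)
      rintro ⟨a, b⟩ hab
      simp only [mem_filter, mem_product, mem_union, mem_sdiff, hN] at hab ⊢
      obtain ⟨⟨ha, hb⟩, hadj⟩ := hab
      by_cases haX : a ∈ X
      · left
        refine ⟨⟨Or.inl haX, ?_⟩, hadj⟩
        by_cases hbX : b ∈ X
        exacts [Or.inl hbX, Or.inr ⟨hb, hbX, a, haX, hadj⟩]
      · by_cases hbX : b ∈ X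
        · left
          exact ⟨⟨Or.inr ⟨ha, haX, b, hbX, hadj.symm⟩, Or.inl hbX⟩, hadj⟩
        · right
          exact ⟨⟨⟨ha, haX⟩, hb, hbX⟩, hadj⟩
    have h2 := hle (X ∪ N)
    have h3 := hle (S \ X)
    rw [card_union_of_disjoint hdisj] at h2
    have h4 : ((S \ X).card : ℝ) = S.card - X.card := by
      rw [card_sdiff_of_subset hXS, Nat.cast_sub (card_le_card hXS)]
    rw [h4] at h3
    push_cast at h2
    apply le_of_expWeight_ineq (n := S.card) (hcard X hX) (Nat.cast_nonneg _)
      (by exact_mod_cast h2X)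
    rw [hSeq] at h1
    have : ρ * (S.card * expWeight S.card) ≤ ρ * ((X.card + N.card) * expWeight (X.card + N.card) +
        (S.card - X.card) * expWeight (S.card - X.card)) := by linarith
    exact le_of_mul_le_mul_left this hρ0

theorem card_filter_subtype (S : Finset V) (p : V → Prop) [DecidablePred p] :
    (univ.filter fun y : {x // x ∈ S} => p y).card = (S.filter p).card := by
  rw [← card_map (Function.Embedding.subtype _)]
  congr 1
  ext x
  simp only [mem_map, mem_filter, mem_univ, true_and, Function.Embedding.subtype_apply,
    Subtype.exists, exists_and_left, exists_prop, exists_eq_right_right]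
  tauto

/-- A graph of average degree at least `d` has an induced subgraph that is a sublinear expander of
minimum degree at least `d / 4`. -/
theorem exists_expander [Nonempty V] (G : SimpleGraph V) (d : ℝ) (hd : 0 < d)
    (hG : d * Fintype.card V ≤ adjPairs G univ) :
    ∃ S : Finset V, S.Nonempty ∧
      (∀ v : {x // x ∈ S}, d / 4 ≤ ((univ.filter fun y : {x // x ∈ S} =>
        (G.comap (Subtype.val : {x // x ∈ S} → V)).Adj v y).card : ℝ)) ∧
      SublinearExpander (G.comap (Subtype.val : {x // x ∈ S} → V)) := by
  obtain ⟨S, hS, hdeg, hexp⟩ := exists_expander_finset G d hd hG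
  refine ⟨S, hS, ?_, ?_⟩
  · rintro ⟨v, hv⟩
    have := hdeg v hv
    rw [← card_filter_subtype] at this
    simpa using this
  · intro X hX h2X
    have := hexp (X.map (Function.Embedding.subtype _)) (by
        intro x hx
        simp only [mem_map, Function.Embedding.subtype_apply] at hx
        obtain ⟨a, _, rfl⟩ := hx
        exact a.2) (by simpa using hX) (by simpa using h2X)
    rw [card_map, ← card_filter_subtype] at this
    convert this using 4
    ext y
    simp [nbh]

end ExpanderExistence

section Cores
open scoped Classical
set_option linter.unusedSectionVars false
variable {V : Type} [Fintype V] {G : SimpleGraph V}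

theorem exists_shortest_path (A : V → Prop) {u v : V} (p : G.Walk u v)
    (hp : ∀ y ∈ p.support, A y) :
    ∃ Q : G.Walk u v, Q.IsPath ∧ Q.length ≤ p.length ∧ (∀ y ∈ Q.support, A y) ∧
      ∀ Q' : G.Walk u v, (∀ y ∈ Q'.support, A y) → Q.length ≤ Q'.length := by
  have hex : ∃ k, ∃ Q : G.Walk u v, (∀ y ∈ Q.support, A y) ∧ Q.length = k := ⟨_, p, hp, rfl⟩
  obtain ⟨Q, hQ, hk⟩ := Nat.find_spec hex
  have hmin : ∀ Q' : G.Walk u v, (∀ y ∈ Q'.support, A y) → Q.length ≤ Q'.length := by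
    intro Q' hQ'
    rw [hk]
    exact Nat.find_min' hex ⟨Q', hQ', rfl⟩
  have hle := Q.length_bypass_le_length
  exact ⟨Q.bypass, Q.bypass_isPath, hle.trans (hmin p hp),
    fun y hy => hQ y (Q.support_bypass_subset_support hy),
    fun Q' hQ' => hle.trans (hmin Q' hQ')⟩

theorem mem_image_getVert_of_shortest (A : V → Prop) {u v : V} (Q : G.Walk u v)
    (hQ : ∀ y ∈ Q.support, A y)
    (hmin : ∀ Q' : G.Walk u v, (∀ y ∈ Q'.support, A y) → Q.length ≤ Q'.length)
    {z x : V} {k : ℕ} (r : G.Walk u z) (hr : ∀ y ∈ r.support, A y) (hrk : r.length ≤ k)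
    (hzx : G.Adj z x) (hx : x ∈ Q.support) :
    x ∈ (range (k + 2)).image Q.getVert := by
  have h1 := hmin ((r.concat hzx).append (Q.dropUntil x hx)) (by
    intro y hy
    rw [SimpleGraph.Walk.mem_support_append_iff] at hy
    rcases hy with hy | hy
    · rw [SimpleGraph.Walk.support_concat] at hy
      simp only [List.mem_append, List.mem_singleton] at hy
      rcases hy with hy | rfl
      exacts [hr y hy, hQ _ hx]
    · exact hQ y (Q.support_dropUntil_subset_support hx hy))
  have h2 : (Q.takeUntil x hx).length + (Q.dropUntil x hx).length = Q.length := by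
    rw [← SimpleGraph.Walk.length_append, Q.take_spec]
  simp only [SimpleGraph.Walk.length_append, SimpleGraph.Walk.length_concat] at h1
  refine mem_image.2 ⟨(Q.takeUntil x hx).length, mem_range.2 (by omega), ?_⟩
  exact Q.getVert_length_takeUntil hx

/-- Well-separated points in a graph, together with the ability to grow balls around them. -/
structure PointSystem (G : SimpleGraph V) (N q : ℕ) where
  /-- The points: `(i, none)` is a root, and `(i, some a)` are its terminals. -/
  pt : Fin N × Option (Fin q) → V
  /-- Radius of the protected balls. -/
  D₁ : ℕ
  /-- Radius of the separating balls. -/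
  D₂ : ℕ
  m : ℕ
  Φ₁ : ℕ
  Φ₂ : ℕ
  hD : D₁ ≤ D₂
  disj : ∀ p p', p ≠ p' → Disjoint (ball G ∅ (pt p) D₂) (ball G ∅ (pt p') D₂)
  hΦ : Φ₁ + ∑ p, (ball G ∅ (pt p) D₁).card ≤ Φ₂
  grow : ∀ p F, (∀ k < D₁, (F ∩ nbh G (ball G F (pt p) k)).card ≤ q * (k + 2)) →
    (∀ k < D₂, (F ∩ nbh G (ball G F (pt p) k)).card ≤ Φ₁) → F.card ≤ Φ₂ →
    Fintype.card V < 2 * (ball G F (pt p) m).card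

namespace PointSystem
variable {N q : ℕ} (S : PointSystem G N q)

/-- The protected ball around a point. -/
noncomputable def BB (p : Fin N × Option (Fin q)) : Finset V := ball G ∅ (S.pt p) S.D₁

theorem pt_mem_BB (p) : S.pt p ∈ S.BB p := mem_ball_self _

theorem BB_subset (p) : S.BB p ⊆ ball G ∅ (S.pt p) S.D₂ := ball_mono S.hD

theorem not_mem_BB {p p'} (h : p ≠ p') {x : V} (hx : x ∈ S.BB p) : x ∉ S.BB p' := fun hx' =>
  disjoint_left.1 (S.disj p p' h) (S.BB_subset p hx) (S.BB_subset p' hx')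

theorem pt_injective : Function.Injective S.pt := by
  intro p q h
  by_contra hne
  exact S.not_mem_BB hne (S.pt_mem_BB p) (h ▸ S.pt_mem_BB q)

/-- Vertices allowed on a path between the points `p` and `p'`. -/
def Allowed (U : Finset V) (p p' : Fin N × Option (Fin q)) (y : V) : Prop :=
  y = S.pt p ∨ y = S.pt p' ∨ (y ∉ U ∧ ∀ p'', p'' ≠ p → p'' ≠ p' → y ∉ S.BB p'')

theorem allowed_comm {U : Finset V} {p p' y} : S.Allowed U p p' y ↔ S.Allowed U p' p y := by
  unfold Allowed
  constructor <;>
  · rintro (h | h | ⟨h, h'⟩)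
    exacts [Or.inr (Or.inl h), Or.inl h, Or.inr (Or.inr ⟨h, fun p'' a b => h' p'' b a⟩)]

theorem Allowed.not_mem_BB {U : Finset V} {p p' p'' : Fin N × Option (Fin q)} {y : V}
    (h : S.Allowed U p p' y) (h1 : p'' ≠ p) (h2 : p'' ≠ p') : y ∉ S.BB p'' := by
  rcases h with rfl | rfl | h
  · exact S.not_mem_BB h1.symm (S.pt_mem_BB p)
  · exact S.not_mem_BB h2.symm (S.pt_mem_BB p')
  · exact h.2 p'' h1 h2

/-- Few vertices of `U` obstruct the growth of small balls around `p`. -/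
def Tame (U : Finset V) (c : ℕ) (p : Fin N × Option (Fin q)) : Prop :=
  ∀ k < S.D₁, (U ∩ nbh G (ball G U (S.pt p) k)).card ≤ c * (k + 2)

theorem mem_inter_nbh_ball_of_subset {U F : Finset V} (hUF : U ⊆ F) {w x : V} {k : ℕ}
    (hxU : x ∈ U) (hx : x ∈ nbh G (ball G F w k)) : x ∈ U ∩ nbh G (ball G U w k) := by
  obtain ⟨hx1, z, hz, hzx⟩ := mem_nbh.1 hx
  refine mem_inter.2 ⟨hxU, mem_nbh.2 ⟨fun h => ?_, z, ball_anti hUF k hz, hzx⟩⟩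
  obtain ⟨p, -, hp⟩ := mem_ball_iff.1 h
  rcases hp x p.end_mem_support with rfl | h
  exacts [hx1 (mem_ball_self k), h hxU]

theorem exists_walk {U U' : Finset V} {p p'} (hU : S.Tame U q p)
    (hU' : S.Tame U q p') (hd : Disjoint U' (S.BB p)) (hd' : Disjoint U' (S.BB p'))
    (hcard : U.card + U'.card ≤ S.Φ₁) :
    ∃ Q : G.Walk (S.pt p) (S.pt p'), Q.length ≤ 2 * S.m ∧
      ∀ y ∈ Q.support, S.Allowed (U ∪ U') p p' y := by
  set O := (univ.filter fun p'' => p'' ≠ p ∧ p'' ≠ p').biUnion S.BB with hO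
  set F := U ∪ U' ∪ O with hF
  have hFcard : F.card ≤ S.Φ₂ := by
    have h1 : O.card ≤ ∑ p, (S.BB p).card := by
      refine card_biUnion_le.trans ?_
      exact sum_le_sum_of_subset (subset_univ _)
    have h2 := card_union_le (U ∪ U') O
    have h3 := card_union_le U U'
    have h4 := S.hΦ
    unfold BB at h1
    rw [hF]
    omega
  have key : ∀ r, (r = p ∨ r = p') → S.Tame U q r → Disjoint U' (S.BB r) →
      Fintype.card V < 2 * (ball G F (S.pt r) S.m).card := by
    intro r hr htame hdis
    have hOD : ∀ x ∈ ball G ∅ (S.pt r) S.D₂, x ∉ O := by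
      intro x hx hxO
      simp only [hO, mem_biUnion, mem_filter, mem_univ, true_and] at hxO
      obtain ⟨p'', ⟨h1, h2⟩, h3⟩ := hxO
      refine disjoint_left.1 (S.disj r p'' ?_) hx (S.BB_subset _ h3)
      rcases hr with rfl | rfl
      exacts [h1.symm, h2.symm]
    apply S.grow r F _ _ hFcard
    · intro k hk
      refine le_trans (card_le_card ?_) (htame k hk)
      intro x hx
      rw [mem_inter] at hx
      have hxB : x ∈ S.BB r := ball_mono hk (nbh_ball_subset k hx.2)
      have hxU : x ∈ U := by
        have := hx.1
        simp only [hF, mem_union] at this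
        rcases this with (h | h) | h
        · exact h
        · exact absurd hxB (disjoint_left.1 hdis h)
        · exact absurd h (hOD x (S.BB_subset _ hxB))
      exact mem_inter_nbh_ball_of_subset (by intro a ha; simp [hF, ha]) hxU hx.2
    · intro k hk
      refine le_trans (card_le_card ?_) ((card_union_le U U').trans hcard)
      intro x hx
      rw [mem_inter] at hx
      have hxB : x ∈ ball G ∅ (S.pt r) S.D₂ := ball_mono hk (nbh_ball_subset k hx.2)
      have := hx.1
      rw [hF, mem_union] at this
      rcases this with h | h
      exacts [h, absurd h (hOD x hxB)]
  obtain ⟨Q, hQ, hQF⟩ := exists_walk_of_balls (F₀ := F) le_rfl le_rfl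
    (key p (Or.inl rfl) hU hd) (key p' (Or.inr rfl) hU' hd')
  refine ⟨Q, hQ, fun y hy => ?_⟩
  rcases hQF y hy with h | h | h
  · exact Or.inl h
  · exact Or.inr (Or.inl h)
  · refine Or.inr (Or.inr ⟨fun h' => h (by rw [hF, mem_union]; exact Or.inl h'), ?_⟩)
    intro p'' h1 h2 h3
    apply h
    rw [hF, mem_union]
    right
    simp only [hO, mem_biUnion, mem_filter, mem_univ, true_and]
    exact ⟨p'', ⟨h1, h2⟩, h3⟩

/-- The number of cores in `T` with end `p`. -/
noncomputable def coreCount (T : Finset (Fin N × Fin q)) (p : Fin N × Option (Fin q)) : ℕ :=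
  (T.filter fun c => p = (c.1, none) ∨ p = (c.1, some c.2)).card

theorem coreCount_le (T : Finset (Fin N × Fin q)) (p : Fin N × Option (Fin q)) :
    coreCount T p ≤ q := by
  unfold coreCount
  calc _ ≤ (univ : Finset (Fin q)).card := by
        apply card_le_card_of_injOn (fun c => c.2) (by simp)
        rintro ⟨i, a⟩ hc ⟨j, b⟩ hc' (h : a = b)
        subst h
        simp only [coe_filter, Set.mem_ofPred_eq] at hc hc'
        have h1 : p.1 = i := by rcases hc.2 with h | h <;> simp [h]
        have h2 : p.1 = j := by rcases hc'.2 with h | h <;> simp [h]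
        rw [← h1, ← h2]
    _ = q := by simp

/-- The vertices used by the cores in `T`. -/
noncomputable def used (Q : ∀ c : Fin N × Fin q, G.Walk (S.pt (c.1, none)) (S.pt (c.1, some c.2)))
    (T : Finset (Fin N × Fin q)) : Finset V := T.biUnion fun c => (Q c).support.toFinset

theorem card_support_inter_nbh_le {U : Finset V} {p p' : Fin N × Option (Fin q)}
    (Q : G.Walk (S.pt p) (S.pt p'))
    (hQ : ∀ y ∈ Q.support, S.Allowed U p p' y)
    (hmin : ∀ Q' : G.Walk (S.pt p) (S.pt p'), (∀ y ∈ Q'.support, S.Allowed U p p' y) →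
      Q.length ≤ Q'.length) {F : Finset V} (hUF : U ⊆ F) {k : ℕ} (hk : k < S.D₁) :
    (Q.support.toFinset ∩ nbh G (ball G F (S.pt p) k)).card ≤ k + 2 := by
  calc _ ≤ ((range (k + 2)).image Q.getVert).card := by
        apply card_le_card
        intro x hx
        simp only [mem_inter, List.mem_toFinset] at hx
        obtain ⟨-, z, hz, hzx⟩ := mem_nbh.1 hx.2
        obtain ⟨r, hr, hrF⟩ := mem_ball_iff.1 hz
        refine mem_image_getVert_of_shortest _ Q hQ hmin r ?_ hr hzx hx.1
        intro y hy
        by_cases hyp : y = S.pt p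
        · exact Or.inl hyp
        have hy1 : y ∉ F := (hrF y hy).resolve_left hyp
        refine Or.inr (Or.inr ⟨fun h => hy1 (hUF h), fun p'' h1 _ => ?_⟩)
        apply S.not_mem_BB h1.symm
        refine ball_mono hk.le (mem_ball_iff.2 ⟨r.takeUntil y hy, ?_, by simp⟩)
        exact (r.length_takeUntil_le_length hy).trans hr
    _ ≤ (range (k + 2)).card := card_image_le
    _ = k + 2 := card_range _

theorem card_used_le (Q : ∀ c : Fin N × Fin q, G.Walk (S.pt (c.1, none)) (S.pt (c.1, some c.2)))
    (T : Finset (Fin N × Fin q)) (h : ∀ c ∈ T, (Q c).length ≤ 2 * S.m) :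
    (S.used Q T).card ≤ N * q * (2 * S.m + 1) := by
  calc (S.used Q T).card ≤ T.card * (2 * S.m + 1) := by
        refine card_biUnion_le_card_mul _ _ _ fun c hc => ?_
        refine (List.toFinset_card_le _).trans ?_
        rw [SimpleGraph.Walk.length_support]
        have := h c hc
        omega
    _ ≤ N * q * (2 * S.m + 1) := by
        gcongr
        refine (card_le_univ T).trans ?_
        simp

/-- Cores joining each root to its terminals. -/
theorem exists_cores (hΦ₁ : N * q * (2 * S.m + 1) ≤ S.Φ₁) (T : Finset (Fin N × Fin q)) :
    ∃ Q : ∀ c : Fin N × Fin q, G.Walk (S.pt (c.1, none)) (S.pt (c.1, some c.2)),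
      (∀ c ∈ T, (Q c).IsPath ∧ (Q c).length ≤ 2 * S.m) ∧
      (∀ c ∈ T, ∀ x ∈ (Q c).support, ∀ p, p ≠ (c.1, none) → p ≠ (c.1, some c.2) → x ∉ S.BB p) ∧
      (∀ c ∈ T, ∀ c' ∈ T, c ≠ c' → ∀ x ∈ (Q c).support, x ∈ (Q c').support →
        c.1 = c'.1 ∧ x = S.pt (c.1, none)) ∧
      ∀ p, S.Tame (S.used Q T) (coreCount T p) p := by
  induction T using Finset.induction_on with
  | empty =>
    have h : ∀ c : Fin N × Fin q, ∃ Q : G.Walk (S.pt (c.1, none)) (S.pt (c.1, some c.2)), True := by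
      intro c
      obtain ⟨Q, -⟩ := S.exists_walk (U := ∅) (U' := ∅) (p := (c.1, none)) (p' := (c.1, some c.2))
        (by intro k _; simp) (by intro k _; simp) (by simp) (by simp) (by simp)
      exact ⟨Q, trivial⟩
    choose Q _ using h
    refine ⟨Q, by simp, by simp, by simp, ?_⟩
    intro p k _
    simp [used]
  | insert c T hcT ih =>
    obtain ⟨Q, h1, h2, h3, h4⟩ := ih
    set U := S.used Q T with hU
    have hUcard : U.card ≤ S.Φ₁ := (S.card_used_le Q T fun c hc => (h1 c hc).2).trans hΦ₁
    have htame : ∀ p, S.Tame U q p := fun p k hk =>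
      (h4 p k hk).trans (Nat.mul_le_mul_right _ (coreCount_le T p))
    obtain ⟨w, hw, hwA⟩ := S.exists_walk (U := U) (U' := ∅) (p := (c.1, none))
      (p' := (c.1, some c.2)) (htame _) (htame _) (by simp) (by simp) (by simpa using hUcard)
    rw [union_empty] at hwA
    obtain ⟨R, hRp, hRl, hRA, hRmin⟩ := exists_shortest_path _ w hwA
    let Q' : ∀ c : Fin N × Fin q, G.Walk (S.pt (c.1, none)) (S.pt (c.1, some c.2)) :=
      Function.update Q c R
    have hQ'c : Q' c = R := Function.update_self ..
    have hQ'T : ∀ c' ∈ T, Q' c' = Q c' := fun c' hc' =>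
      Function.update_of_ne (fun h : c' = c => hcT (h ▸ hc')) ..
    have hused : S.used Q' (insert c T) = R.support.toFinset ∪ U := by
      unfold used
      rw [biUnion_insert, hQ'c, hU, used]
      congr 1
      exact biUnion_congr rfl fun c' hc' => by rw [hQ'T c' hc']
    have hcross : ∀ c' ∈ T, ∀ x ∈ R.support, x ∈ (Q c').support →
        c.1 = c'.1 ∧ x = S.pt (c.1, none) := by
      intro c' hc' x hx hx'
      have hne : c ≠ c' := fun h => hcT (h ▸ hc')
      have hxU : x ∈ U := by
        simp only [hU, used, mem_biUnion, List.mem_toFinset]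
        exact ⟨c', hc', hx'⟩
      rcases hRA x hx with h | h | h
      · refine ⟨?_, h⟩
        by_contra hcc
        exact h2 c' hc' x hx' (c.1, none) (by simpa using hcc) (by simp) (h ▸ S.pt_mem_BB _)
      · exfalso
        exact h2 c' hc' x hx' (c.1, some c.2) (by simp) (by
          intro h
          simp only [Prod.mk.injEq, Option.some.injEq] at h
          exact hne (Prod.ext h.1 h.2)) (h ▸ S.pt_mem_BB _)
      · exact absurd hxU h.1
    refine ⟨Q', ?_, ?_, ?_, ?_⟩
    · intro c' hc'
      rcases mem_insert.1 hc' with rfl | hc'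
      · rw [hQ'c]; exact ⟨hRp, hRl.trans hw⟩
      · rw [hQ'T c' hc']; exact h1 c' hc'
    · intro c' hc'
      rcases mem_insert.1 hc' with rfl | hc'
      · rw [hQ'c]
        intro x hx p hp1 hp2
        exact (hRA x hx).not_mem_BB S hp1 hp2
      · rw [hQ'T c' hc']; exact h2 c' hc'
    · intro c₁ hc₁ c₂ hc₂ hne x hx hx'
      rcases mem_insert.1 hc₁ with rfl | hm₁
      · rcases mem_insert.1 hc₂ with rfl | hm₂
        · exact absurd rfl hne
        · rw [hQ'c] at hx
          rw [hQ'T _ hm₂] at hx'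
          exact hcross c₂ hm₂ x hx hx'
      · rcases mem_insert.1 hc₂ with rfl | hm₂
        · rw [hQ'c] at hx'
          rw [hQ'T _ hm₁] at hx
          obtain ⟨a, b⟩ := hcross c₁ hm₁ x hx' hx
          exact ⟨a.symm, a ▸ b⟩
        · rw [hQ'T _ hm₁] at hx
          rw [hQ'T _ hm₂] at hx'
          exact h3 c₁ hm₁ c₂ hm₂ hne x hx hx'
    · intro p k hk
      rw [hused]
      set F := R.support.toFinset ∪ U with hF
      have hUF : U ⊆ F := subset_union_right
      have e1 : F ∩ nbh G (ball G F (S.pt p) k) ⊆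
          (R.support.toFinset ∩ nbh G (ball G F (S.pt p) k)) ∪
            (U ∩ nbh G (ball G U (S.pt p) k)) := by
        intro x hx
        rw [mem_inter] at hx
        rcases mem_union.1 hx.1 with h | h
        · exact mem_union_left _ (mem_inter.2 ⟨h, hx.2⟩)
        · exact mem_union_right _ (mem_inter_nbh_ball_of_subset hUF h hx.2)
      have e2 := (card_le_card e1).trans (card_union_le _ _)
      have e3 := h4 p k hk
      have e4 : coreCount (insert c T) p =
          coreCount T p + if p = (c.1, none) ∨ p = (c.1, some c.2) then 1 else 0 := by
        unfold coreCount
        rw [filter_insert]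
        split_ifs with h
        · rw [card_insert_of_notMem (by simp [hcT])]
        · rfl
      have e5 : (R.support.toFinset ∩ nbh G (ball G F (S.pt p) k)).card ≤
          (if p = (c.1, none) ∨ p = (c.1, some c.2) then 1 else 0) * (k + 2) := by
        split_ifs with h
        · rw [one_mul]
          rcases h with rfl | rfl
          · exact S.card_support_inter_nbh_le R hRA hRmin hUF hk
          · have := S.card_support_inter_nbh_le (U := U) (F := F) R.reverse (by
                intro y hy
                rw [SimpleGraph.Walk.support_reverse, List.mem_reverse] at hy
                exact S.allowed_comm.1 (hRA y hy)) (by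
                intro Q'' hQ''
                rw [SimpleGraph.Walk.length_reverse, ← Q''.length_reverse]
                apply hRmin
                intro y hy
                rw [SimpleGraph.Walk.support_reverse, List.mem_reverse] at hy
                exact S.allowed_comm.1 (hQ'' y hy)) hUF hk
            rwa [SimpleGraph.Walk.support_reverse, List.toFinset_reverse] at this
        · push Not at h
          rw [zero_mul, Nat.le_zero, card_eq_zero, ← disjoint_iff_inter_eq_empty, disjoint_left]
          intro x hx hx'
          rw [List.mem_toFinset] at hx
          exact (hRA x hx).not_mem_BB S h.1 h.2 (ball_mono hk (nbh_ball_subset k hx'))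
      rw [e4, add_mul]
      omega

end PointSystem
end Cores

section Links
open scoped Classical
set_option linter.unusedSectionVars false
variable {V : Type} [Fintype V] {G : SimpleGraph V}

theorem isPath_append {u v w : V} {p : G.Walk u v} {q : G.Walk v w} (hp : p.IsPath)
    (hq : q.IsPath) (h : ∀ x ∈ p.support, x ∈ q.support → x = v) : (p.append q).IsPath := by
  rw [SimpleGraph.Walk.isPath_def, SimpleGraph.Walk.support_append, List.nodup_append]
  have hq' := hq.support_nodup
  rw [← SimpleGraph.Walk.cons_tail_support, List.nodup_cons] at hq'
  refine ⟨hp.support_nodup, hq'.2, ?_⟩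
  rintro a ha b hb rfl
  have := h a ha (List.mem_of_mem_tail hb)
  subst this
  exact hq'.1 hb

namespace PointSystem
variable {N q : ℕ}

/-- Internally disjoint cores from each root to its terminals. -/
structure CoreSystem (S : PointSystem G N q) where
  Q : ∀ c : Fin N × Fin q, G.Walk (S.pt (c.1, none)) (S.pt (c.1, some c.2))
  isPath : ∀ c, (Q c).IsPath
  length_le : ∀ c, (Q c).length ≤ 2 * S.m
  avoid : ∀ c, ∀ x ∈ (Q c).support, ∀ p, p ≠ (c.1, none) → p ≠ (c.1, some c.2) → x ∉ S.BB p
  meet : ∀ c c', c ≠ c' → ∀ x ∈ (Q c).support, x ∈ (Q c').support →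
    c.1 = c'.1 ∧ x = S.pt (c.1, none)
  tame : ∀ p, S.Tame (S.used Q univ) q p

theorem exists_coreSystem (S : PointSystem G N q) (hΦ₁ : N * q * (2 * S.m + 1) ≤ S.Φ₁) :
    Nonempty S.CoreSystem := by
  obtain ⟨Q, h1, h2, h3, h4⟩ := S.exists_cores hΦ₁ univ
  exact ⟨⟨Q, fun c => (h1 c (mem_univ c)).1, fun c => (h1 c (mem_univ c)).2,
    fun c => h2 c (mem_univ c), fun c c' => h3 c (mem_univ c) c' (mem_univ c'),
    fun p k hk => (h4 p k hk).trans (Nat.mul_le_mul_right _ (coreCount_le _ p))⟩⟩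

namespace CoreSystem
variable {S : PointSystem G N q} (C : S.CoreSystem)

/-- All vertices on the cores. -/
noncomputable def U : Finset V := S.used C.Q univ

theorem mem_U {x : V} : x ∈ C.U ↔ ∃ c, x ∈ (C.Q c).support := by
  simp [U, used]

/-- Whatever set of at most `u` vertices is forbidden, there remains a path of length `ℓ` between
the terminals of colour `a` at `i` and `j`. -/
def Robust (u : ℕ) (i j : Fin N) (a : Fin q) (ℓ : ℕ) : Prop :=
  ∀ X : Finset V, X.card ≤ u → Disjoint X (S.BB (i, some a)) → Disjoint X (S.BB (j, some a)) →
    ∃ P : G.Walk (S.pt (i, some a)) (S.pt (j, some a)), P.IsPath ∧ P.length = ℓ ∧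
      ∀ y ∈ P.support, S.Allowed (C.U ∪ X) (i, some a) (j, some a) y

theorem Robust.symm {C : S.CoreSystem} {u : ℕ} {i j : Fin N} {a : Fin q} {ℓ : ℕ}
    (h : C.Robust u i j a ℓ) : C.Robust u j i a ℓ := by
  intro X h1 h2 h3
  obtain ⟨P, hP, hl, hA⟩ := h X h1 h3 h2
  refine ⟨P.reverse, hP.reverse, by simpa using hl, ?_⟩
  intro y hy
  rw [SimpleGraph.Walk.support_reverse, List.mem_reverse] at hy
  exact S.allowed_comm.1 (hA y hy)

theorem exists_robust {u : ℕ} (hΦ : N * q * (2 * S.m + 1) + (2 * S.m + 1) * u ≤ S.Φ₁)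
    (i j : Fin N) (a : Fin q) : ∃ ℓ ≤ 2 * S.m, C.Robust u i j a ℓ := by
  by_contra hcon
  push Not at hcon
  have hX : ∀ ℓ, ∃ X : Finset V, X.card ≤ u ∧ Disjoint X (S.BB (i, some a)) ∧
      Disjoint X (S.BB (j, some a)) ∧ (ℓ ≤ 2 * S.m →
      ∀ P : G.Walk (S.pt (i, some a)) (S.pt (j, some a)), P.IsPath → P.length = ℓ →
      ¬ ∀ y ∈ P.support, S.Allowed (C.U ∪ X) (i, some a) (j, some a) y) := by
    intro ℓ
    by_cases hℓ : ℓ ≤ 2 * S.m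
    · have := hcon ℓ hℓ
      unfold Robust at this
      push Not at this
      obtain ⟨X, h1, h2, h3, h4⟩ := this
      refine ⟨X, h1, h2, h3, fun _ P hP hl hall => ?_⟩
      obtain ⟨y, hy, hy'⟩ := h4 P hP hl
      exact hy' (hall y hy)
    · exact ⟨∅, by simp, by simp, by simp, fun h => absurd h hℓ⟩
  choose X h1 h2 h3 h4 using hX
  set Y := (range (2 * S.m + 1)).biUnion X with hY
  have hYcard : Y.card ≤ (2 * S.m + 1) * u := by
    have := card_biUnion_le_card_mul (range (2 * S.m + 1)) X u fun ℓ _ => h1 ℓ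
    rwa [card_range] at this
  have hUcard : C.U.card ≤ N * q * (2 * S.m + 1) :=
    S.card_used_le C.Q univ fun c _ => C.length_le c
  obtain ⟨w, hw, hwA⟩ := S.exists_walk (U := C.U) (U' := Y) (C.tame (i, some a))
    (C.tame (j, some a))
    (by rw [hY, disjoint_biUnion_left]; exact fun ℓ _ => h2 ℓ)
    (by rw [hY, disjoint_biUnion_left]; exact fun ℓ _ => h3 ℓ) (by omega)
  have hl := w.length_bypass_le_length
  refine h4 w.bypass.length (hl.trans hw) w.bypass w.bypass_isPath rfl ?_
  intro y hy
  rcases hwA y (w.support_bypass_subset_support hy) with h | h | ⟨h, h'⟩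
  · exact Or.inl h
  · exact Or.inr (Or.inl h)
  · refine Or.inr (Or.inr ⟨?_, h'⟩)
    intro hmem
    apply h
    rw [mem_union] at hmem ⊢
    rcases hmem with hmem | hmem
    · exact Or.inl hmem
    · right
      rw [hY, mem_biUnion]
      exact ⟨_, mem_range.2 (by omega), hmem⟩

section
variable {ι : Type} [Fintype ι] (L R : ι → Fin N) (col : ι → Fin q) (ℓ : ι → ℕ) {u : ℕ}

theorem exists_connections
    (hLL : ∀ τ τ', τ ≠ τ' → (L τ, col τ) ≠ (L τ', col τ'))
    (hRR : ∀ τ τ', τ ≠ τ' → (R τ, col τ) ≠ (R τ', col τ'))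
    (hLR : ∀ τ τ', (L τ, col τ) ≠ (R τ', col τ'))
    (hrob : ∀ τ, C.Robust u (L τ) (R τ) (col τ) (ℓ τ))
    (hu : Fintype.card ι * (2 * S.m + 1) ≤ u) (hℓ : ∀ τ, ℓ τ ≤ 2 * S.m) (T : Finset ι) :
    ∃ P : ∀ τ, G.Walk (S.pt (L τ, some (col τ))) (S.pt (R τ, some (col τ))),
      (∀ τ ∈ T, (P τ).IsPath ∧ (P τ).length = ℓ τ ∧
        ∀ y ∈ (P τ).support, S.Allowed C.U (L τ, some (col τ)) (R τ, some (col τ)) y) ∧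
      ∀ τ ∈ T, ∀ τ' ∈ T, τ ≠ τ' → ∀ x ∈ (P τ).support, x ∉ (P τ').support := by
  have hpt : ∀ i j : Fin N, ∀ a b : Fin q, (i, a) ≠ (j, b) →
      ((i, some a) : Fin N × Option (Fin q)) ≠ (j, some b) := by
    intro i j a b h h'
    simp only [Prod.mk.injEq, Option.some.injEq] at h'
    exact h (Prod.ext h'.1 h'.2)
  induction T using Finset.induction_on with
  | empty =>
    have h : ∀ τ, ∃ P : G.Walk (S.pt (L τ, some (col τ))) (S.pt (R τ, some (col τ))), True := by
      intro τ
      obtain ⟨P, -⟩ := hrob τ ∅ (by simp) (by simp) (by simp)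
      exact ⟨P, trivial⟩
    choose P _ using h
    exact ⟨P, by simp, by simp⟩
  | insert σ T hσ ih =>
    obtain ⟨P, h1, h2⟩ := ih
    set X := T.biUnion fun τ => (P τ).support.toFinset with hX
    have hXcard : X.card ≤ u := by
      calc X.card ≤ T.card * (2 * S.m + 1) := by
            refine card_biUnion_le_card_mul _ _ _ fun τ hτ => ?_
            refine (List.toFinset_card_le _).trans ?_
            rw [SimpleGraph.Walk.length_support, (h1 τ hτ).2.1]
            exact Nat.succ_le_succ (hℓ τ)
        _ ≤ Fintype.card ι * (2 * S.m + 1) := by gcongr; exact card_le_univ T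
        _ ≤ u := hu
    have hne : ∀ τ ∈ T, σ ≠ τ := fun τ hτ h => hσ (h ▸ hτ)
    have hXd : ∀ i, (∀ τ ∈ T, (i, col σ) ≠ (L τ, col τ)) → (∀ τ ∈ T, (i, col σ) ≠ (R τ, col τ)) →
        Disjoint X (S.BB (i, some (col σ))) := by
      intro i ha hb
      rw [hX, disjoint_biUnion_left]
      intro τ hτ
      rw [disjoint_left]
      intro x hx
      rw [List.mem_toFinset] at hx
      exact ((h1 τ hτ).2.2 x hx).not_mem_BB S (hpt _ _ _ _ (ha τ hτ)) (hpt _ _ _ _ (hb τ hτ))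
    obtain ⟨W, hW1, hW2, hW3⟩ := hrob σ X hXcard
      (hXd _ (fun τ hτ => hLL _ _ (hne τ hτ)) fun τ _ => hLR σ τ)
      (hXd _ (fun τ _ => (hLR τ σ).symm) fun τ hτ => hRR _ _ (hne τ hτ))
    let P' : ∀ τ, G.Walk (S.pt (L τ, some (col τ))) (S.pt (R τ, some (col τ))) :=
      Function.update P σ W
    have hP'σ : P' σ = W := Function.update_self ..
    have hP'T : ∀ τ ∈ T, P' τ = P τ := fun τ hτ =>
      Function.update_of_ne (hne τ hτ).symm ..
    have hcross : ∀ τ ∈ T, ∀ x ∈ W.support, x ∉ (P τ).support := by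
      intro τ hτ x hx hx'
      have hxA := (h1 τ hτ).2.2 x hx'
      rcases hW3 x hx with rfl | rfl | h
      · exact hxA.not_mem_BB S (hpt _ _ _ _ (hLL _ _ (hne τ hτ))) (hpt _ _ _ _ (hLR σ τ))
          (S.pt_mem_BB _)
      · exact hxA.not_mem_BB S (hpt _ _ _ _ (hLR τ σ).symm) (hpt _ _ _ _ (hRR _ _ (hne τ hτ)))
          (S.pt_mem_BB _)
      · apply h.1
        rw [mem_union, hX, mem_biUnion]
        exact Or.inr ⟨τ, hτ, List.mem_toFinset.2 hx'⟩
    refine ⟨P', ?_, ?_⟩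
    · intro τ hτ
      rcases mem_insert.1 hτ with rfl | hτ
      · rw [hP'σ]
        refine ⟨hW1, hW2, fun y hy => ?_⟩
        rcases hW3 y hy with h | h | ⟨h, h'⟩
        · exact Or.inl h
        · exact Or.inr (Or.inl h)
        · exact Or.inr (Or.inr ⟨fun hm => h (mem_union_left _ hm), h'⟩)
      · rw [hP'T τ hτ]; exact h1 τ hτ
    · intro τ hτ τ' hτ' hne' x hx hx'
      rcases mem_insert.1 hτ with rfl | hm
      · rcases mem_insert.1 hτ' with rfl | hm'
        · exact hne' rfl
        · rw [hP'σ] at hx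
          rw [hP'T _ hm'] at hx'
          exact hcross _ hm' x hx hx'
      · rcases mem_insert.1 hτ' with rfl | hm'
        · rw [hP'σ] at hx'
          rw [hP'T _ hm] at hx
          exact hcross _ hm x hx' hx
        · rw [hP'T _ hm] at hx
          rw [hP'T _ hm'] at hx'
          exact h2 _ hm _ hm' hne' x hx hx'

theorem exists_links (hne : ∀ τ, L τ ≠ R τ)
    (hLL : ∀ τ τ', τ ≠ τ' → (L τ, col τ) ≠ (L τ', col τ'))
    (hRR : ∀ τ τ', τ ≠ τ' → (R τ, col τ) ≠ (R τ', col τ'))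
    (hLR : ∀ τ τ', (L τ, col τ) ≠ (R τ', col τ'))
    (hrob : ∀ τ, C.Robust u (L τ) (R τ) (col τ) (ℓ τ))
    (hu : Fintype.card ι * (2 * S.m + 1) ≤ u) (hℓ : ∀ τ, ℓ τ ≤ 2 * S.m) :
    ∃ M : ∀ τ, G.Walk (S.pt (L τ, none)) (S.pt (R τ, none)),
      (∀ τ, (M τ).IsPath ∧ (M τ).length =
        (C.Q (L τ, col τ)).length + ℓ τ + (C.Q (R τ, col τ)).length) ∧
      (∀ τ i, S.pt (i, none) ∈ (M τ).support → i = L τ ∨ i = R τ) ∧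
      ∀ τ τ', τ ≠ τ' → ∀ x ∈ (M τ).support, x ∈ (M τ').support → ∃ i, x = S.pt (i, none) := by
  obtain ⟨P, h1, h2⟩ := C.exists_connections L R col ℓ hLL hRR hLR hrob hu hℓ univ
  have hPQ : ∀ τ c x, x ∈ (P τ).support → x ∈ (C.Q c).support →
      (c = (L τ, col τ) ∧ x = S.pt (L τ, some (col τ))) ∨
      (c = (R τ, col τ) ∧ x = S.pt (R τ, some (col τ))) := by
    intro τ c x hx hx'
    have key : ∀ i, x = S.pt (i, some (col τ)) → c = (i, col τ) := by
      rintro i rfl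
      by_contra hc
      refine C.avoid c _ hx' (i, some (col τ)) (by simp) ?_ (S.pt_mem_BB _)
      intro h
      simp only [Prod.mk.injEq, Option.some.injEq] at h
      exact hc (Prod.ext h.1.symm h.2.symm)
    rcases (h1 τ (mem_univ τ)).2.2 x hx with h | h | h
    · exact Or.inl ⟨key _ h, h⟩
    · exact Or.inr ⟨key _ h, h⟩
    · exact absurd (C.mem_U.2 ⟨c, hx'⟩) h.1
  have hQQ : ∀ i j a b x, i ≠ j → x ∈ (C.Q (i, a)).support → x ∉ (C.Q (j, b)).support := by
    intro i j a b x hij hx hx'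
    exact hij (C.meet (i, a) (j, b) (by simp [hij]) x hx hx').1
  let M : ∀ τ, G.Walk (S.pt (L τ, none)) (S.pt (R τ, none)) := fun τ =>
    (C.Q (L τ, col τ)).append ((P τ).append (C.Q (R τ, col τ)).reverse)
  have hsupp : ∀ τ x, x ∈ (M τ).support ↔ x ∈ (C.Q (L τ, col τ)).support ∨ x ∈ (P τ).support ∨
      x ∈ (C.Q (R τ, col τ)).support := by
    intro τ x
    simp only [M, SimpleGraph.Walk.mem_support_append_iff, SimpleGraph.Walk.support_reverse,
      List.mem_reverse]
  have hneS : ∀ i j a b, i ≠ j → S.pt (i, some a) ≠ S.pt (j, some b) := by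
    intro i j a b hij h
    have := S.pt_injective h
    simp [hij] at this
  refine ⟨M, ?_, ?_, ?_⟩
  · intro τ
    refine ⟨?_, ?_⟩
    · apply isPath_append (C.isPath _)
      · apply isPath_append (h1 τ (mem_univ τ)).1 (C.isPath _).reverse
        intro x hx hx'
        rw [SimpleGraph.Walk.support_reverse, List.mem_reverse] at hx'
        rcases hPQ τ _ x hx hx' with h | h
        · exact absurd (congrArg Prod.fst h.1).symm (hne τ)
        · exact h.2
      · intro x hx hx'
        rw [SimpleGraph.Walk.mem_support_append_iff, SimpleGraph.Walk.support_reverse,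
          List.mem_reverse] at hx'
        rcases hx' with hx' | hx'
        · rcases hPQ τ _ x hx' hx with h | h
          · exact h.2
          · exact absurd (congrArg Prod.fst h.1) (hne τ)
        · exact absurd hx' (hQQ _ _ _ _ x (hne τ) hx)
    · simp only [M, SimpleGraph.Walk.length_append, SimpleGraph.Walk.length_reverse,
        (h1 τ (mem_univ τ)).2.1]
      ring
  · intro τ i hi
    rw [hsupp] at hi
    have key : ∀ j, S.pt (i, none) ∈ (C.Q (j, col τ)).support → i = j := by
      intro j hj
      by_contra hij
      exact C.avoid _ _ hj (i, none) (by simpa using hij) (by simp) (S.pt_mem_BB _)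
    rcases hi with h | h | h
    · exact Or.inl (key _ h)
    · exfalso
      exact ((h1 τ (mem_univ τ)).2.2 _ h).not_mem_BB S (by simp) (by simp) (S.pt_mem_BB _)
    · exact Or.inr (key _ h)
  · intro τ τ' hττ x hx hx'
    rw [hsupp] at hx hx'
    have hqq : ∀ c c', c ≠ c' → x ∈ (C.Q c).support → x ∈ (C.Q c').support →
        ∃ i, x = S.pt (i, none) := fun c c' hcc h h' => ⟨c.1, (C.meet c c' hcc x h h').2⟩
    have hqp : ∀ σ σ', (σ ≠ σ') → x ∈ (C.Q (L σ, col σ)).support ∨ x ∈ (C.Q (R σ, col σ)).support →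
        x ∉ (P σ').support := by
      rintro σ σ' hσ (h | h) h'
      · rcases hPQ σ' _ x h' h with h | h
        exacts [hLL _ _ hσ h.1, hLR _ _ h.1]
      · rcases hPQ σ' _ x h' h with h | h
        exacts [hLR _ _ h.1.symm, hRR _ _ hσ h.1]
    rcases hx with hx | hx | hx
    · rcases hx' with hx' | hx' | hx'
      · exact hqq _ _ (hLL _ _ hττ) hx hx'
      · exact absurd hx' (hqp _ _ hττ (Or.inl hx))
      · exact hqq _ _ (hLR _ _) hx hx'
    · rcases hx' with hx' | hx' | hx'
      · exact absurd hx (hqp _ _ hττ.symm (Or.inl hx'))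
      · exact absurd hx' (h2 τ (mem_univ _) τ' (mem_univ _) hττ x hx)
      · exact absurd hx (hqp _ _ hττ.symm (Or.inr hx'))
    · rcases hx' with hx' | hx' | hx'
      · exact hqq _ _ (hLR _ _).symm hx hx'
      · exact absurd hx' (hqp _ _ hττ (Or.inr hx))
      · exact hqq _ _ (hRR _ _ hττ) hx hx'
end
end CoreSystem
end PointSystem
end Links

section Pattern
open scoped Classical
set_option linter.unusedSectionVars false
variable {V : Type} [Fintype V] {G : SimpleGraph V}

/-- A bipartite pigeonhole principle. -/
theorem exists_monochromatic_biclique {A B K : Type} [Fintype A] [Fintype B] [Fintype K]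
    (c : A → B → K) (R : ℕ) (hR : 1 ≤ R) (hA : R * Fintype.card K ≤ Fintype.card A)
    (hB : R * (Fintype.card K * Fintype.card A ^ R) ≤ Fintype.card B) [Nonempty K] :
    ∃ (γ : K) (ι : Fin R → A) (κ : Fin R → B), Function.Injective ι ∧ Function.Injective κ ∧
      ∀ x y, c (ι x) (κ y) = γ := by
  have h1 : ∀ y : B, ∃ p : K × (Fin R → A), Function.Injective p.2 ∧ ∀ x, c (p.2 x) y = p.1 := by
    intro y
    obtain ⟨γ, hγ⟩ := Fintype.exists_le_card_fiber_of_mul_le_card (fun a => c a y)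
      (n := R) (by rw [mul_comm]; exact hA)
    have : Fintype.card (Fin R) ≤ Fintype.card {a // c a y = γ} := by
      rw [Fintype.card_fin, Fintype.card_subtype]; exact hγ
    obtain ⟨e⟩ := Function.Embedding.nonempty_of_card_le this
    exact ⟨(γ, fun x => (e x).1), fun a b h => e.injective (Subtype.ext h), fun x => (e x).2⟩
  choose F hF1 hF2 using h1
  have hAne : Nonempty A := by
    rw [← Fintype.card_pos_iff]
    exact lt_of_lt_of_le (Nat.mul_pos hR Fintype.card_pos) hA
  obtain ⟨p, hp⟩ := Fintype.exists_le_card_fiber_of_mul_le_card F (n := R) (by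
    rw [Fintype.card_prod, Fintype.card_fun, Fintype.card_fin, mul_comm]; exact hB)
  have : Fintype.card (Fin R) ≤ Fintype.card {b // F b = p} := by
    rw [Fintype.card_fin, Fintype.card_subtype]; exact hp
  obtain ⟨e⟩ := Function.Embedding.nonempty_of_card_le this
  refine ⟨p.1, p.2, fun y => (e y).1, ?_, fun a b h => e.injective (Subtype.ext h), ?_⟩
  · obtain ⟨b, hb⟩ := e ⟨0, hR⟩
    rw [← hb]; exact hF1 b
  · intro x y
    have := hF2 (e y).1 x
    rw [(e y).2] at this
    exact this

/-- Concatenation of consecutive paths that only meet at shared ends. -/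
theorem exists_concat_path (x : ℕ → V) (k : ℕ) (M : ∀ r, r < k → G.Walk (x r) (x (r + 1)))
    (hM : ∀ r hr, (M r hr).IsPath)
    (hmeet : ∀ r hr r' hr', r < r' → ∀ y ∈ (M r hr).support, y ∈ (M r' hr').support →
      r' = r + 1 ∧ y = x r') :
    ∃ W : G.Walk (x 0) (x k), W.IsPath ∧ W.length = ∑ r : Fin k, (M r r.2).length ∧
      ∀ y ∈ W.support, y = x 0 ∨ ∃ r hr, y ∈ (M r hr).support := by
  induction k with
  | zero => exact ⟨.nil, by simp, by simp, by simp⟩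
  | succ k ih =>
    obtain ⟨W, h1, h2, h3⟩ := ih (fun r hr => M r (by omega)) (fun r hr => hM r _)
      (fun r hr r' hr' => hmeet r _ r' _)
    refine ⟨W.append (M k (by omega)), ?_, ?_, ?_⟩
    · apply isPath_append h1 (hM k _)
      intro y hy hy'
      rcases h3 y hy with h | ⟨r, hr, h⟩
      · rcases Nat.eq_zero_or_pos k with rfl | hk
        · exact h
        · exact (hmeet 0 (by omega) k (by omega) hk y (by
            rw [h]; exact SimpleGraph.Walk.start_mem_support _) hy').2
      · exact (hmeet r (by omega) k (by omega) hr y h hy').2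
    · rw [SimpleGraph.Walk.length_append, h2, Fin.sum_univ_castSucc]
      rfl
    · intro y hy
      rw [SimpleGraph.Walk.mem_support_append_iff] at hy
      rcases hy with hy | hy
      · rcases h3 y hy with h | ⟨r, hr, h⟩
        · exact Or.inl h
        · exact Or.inr ⟨r, by omega, h⟩
      · exact Or.inr ⟨k, by omega, hy⟩

section Nodes
variable {h q : ℕ} [NeZero q]

/-- The node at position `r` of the chain from branch vertex `i` to branch vertex `j`. -/
def chainNode (q : ℕ) [NeZero q] (i j : Fin h) (r : ℕ) : Fin h × Fin h × Fin q :=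
  if hr : 0 < r ∧ r < q then (i, j, ⟨r, hr.2⟩) else if r = 0 then (i, i, 0) else (j, j, 0)

theorem chainNode_zero (i j : Fin h) : chainNode q i j 0 = (i, i, 0) := by simp [chainNode]

theorem chainNode_last (i j : Fin h) : chainNode q i j q = (j, j, 0) := by
  simp [chainNode, NeZero.ne q]

theorem chainNode_mid (i j : Fin h) {r : ℕ} (h0 : 0 < r) (hr : r < q) :
    chainNode q i j r = (i, j, ⟨r, hr⟩) := by
  simp [chainNode, h0, hr]

theorem chainNode_pos (i j : Fin h) {r : ℕ} (hr : r < q) :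
    ((chainNode q i j r).2.2 : ℕ) = r := by
  rcases Nat.eq_zero_or_pos r with rfl | h0
  · simp [chainNode_zero]
  · simp [chainNode_mid i j h0 hr]

theorem chainNode_cases (i j : Fin h) {r : ℕ} (hr : r ≤ q) :
    (r = 0 ∧ chainNode q i j r = (i, i, 0)) ∨ (r = q ∧ chainNode q i j r = (j, j, 0)) ∨
      ∃ h1 : 0 < r ∧ r < q, chainNode q i j r = (i, j, ⟨r, h1.2⟩) := by
  rcases Nat.eq_zero_or_pos r with rfl | h0
  · exact Or.inl ⟨rfl, chainNode_zero i j⟩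
  · rcases hr.eq_or_lt with rfl | hr
    · exact Or.inr (Or.inl ⟨rfl, chainNode_last i j⟩)
    · exact Or.inr (Or.inr ⟨⟨h0, hr⟩, chainNode_mid i j h0 hr⟩)

theorem even_chainNode (hq : Even q) (i j : Fin h) {r : ℕ} (hr : r ≤ q) :
    Even ((chainNode q i j r).2.2 : ℕ) ↔ Even r := by
  rcases chainNode_cases (q := q) i j hr with ⟨rfl, h⟩ | ⟨rfl, h⟩ | ⟨h1, h⟩ <;> simp [h, hq]

end Nodes

theorem balTK_of_links {N q h : ℕ} [NeZero q] (hq : q = 2 * (h * h)) (v : Fin N → V)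
    (hv : Function.Injective v)
    (root : Fin h × Fin h × Fin q → Fin N) (hroot : Function.Injective root)
    (col : Fin h × Fin h × Fin q → Fin q)
    (hcol : ∀ i j r, col (i, j, r) = ⟨2 * (finProdFinEquiv (i, j)).val, by
      rw [hq]; have := (finProdFinEquiv (i, j)).2; omega⟩ + r)
    (Λ : Fin q → ℕ)
    (M : ∀ τ : Fin h × Fin h × Fin q, G.Walk (v (root (chainNode q τ.1 τ.2.1 τ.2.2)))
      (v (root (chainNode q τ.1 τ.2.1 (τ.2.2 + 1)))))
    (hM : ∀ τ, (M τ).IsPath ∧ (M τ).length = Λ (col τ))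
    (hMv : ∀ τ i, v i ∈ (M τ).support → i = root (chainNode q τ.1 τ.2.1 τ.2.2) ∨
      i = root (chainNode q τ.1 τ.2.1 (τ.2.2 + 1)))
    (hMM : ∀ τ τ', τ ≠ τ' → ∀ x ∈ (M τ).support, x ∈ (M τ').support → ∃ i, x = v i) :
    BalTK G h (∑ a, Λ a) := by
  have hmem : ∀ τ τ', τ ≠ τ' → ∀ y ∈ (M τ).support, y ∈ (M τ').support →
      ∃ r r' : ℕ, (r = τ.2.2 ∨ r = τ.2.2 + 1) ∧ (r' = τ'.2.2 ∨ r' = τ'.2.2 + 1) ∧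
        y = v (root (chainNode q τ.1 τ.2.1 r)) ∧
        chainNode q τ.1 τ.2.1 r = chainNode q τ'.1 τ'.2.1 r' := by
    intro τ τ' hne y hy hy'
    obtain ⟨k, rfl⟩ := hMM τ τ' hne y hy hy'
    have h1 := hMv τ k hy
    have h2 := hMv τ' k hy'
    rcases h1 with h1 | h1 <;> rcases h2 with h2 | h2
    · exact ⟨_, _, Or.inl rfl, Or.inl rfl, by rw [h1], hroot (h1.symm.trans h2)⟩
    · exact ⟨_, _, Or.inl rfl, Or.inr rfl, by rw [h1], hroot (h1.symm.trans h2)⟩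
    · exact ⟨_, _, Or.inr rfl, Or.inl rfl, by rw [h1], hroot (h1.symm.trans h2)⟩
    · exact ⟨_, _, Or.inr rfl, Or.inr rfl, by rw [h1], hroot (h1.symm.trans h2)⟩
  have hW : ∀ i j : Fin h, i < j → ∃ W : G.Walk (v (root (i, i, 0))) (v (root (j, j, 0))),
      W.IsPath ∧ W.length = ∑ a, Λ a ∧ ∀ y ∈ W.support, ∃ r, y ∈ (M (i, j, r)).support := by
    intro i j hij
    obtain ⟨W, h1, h2, h3⟩ := exists_concat_path (fun r => v (root (chainNode q i j r))) q
      (fun r hr => M (i, j, ⟨r, hr⟩)) (fun r hr => (hM _).1) (by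
        intro r hr r' hr' hrr y hy hy'
        obtain ⟨t, t', ht, ht', hy, he⟩ := hmem (i, j, ⟨r, hr⟩) (i, j, ⟨r', hr'⟩)
          (by simp [hrr.ne]) y hy hy'
        simp only at ht ht' hy he
        have htt : t = r' ∧ r' = r + 1 := by
          rcases chainNode_cases (q := q) i j (r := t) (by omega) with ⟨a, b⟩ | ⟨a, b⟩ | ⟨a, b⟩ <;>
          rcases chainNode_cases (q := q) i j (r := t') (by omega) with
            ⟨a', b'⟩ | ⟨a', b'⟩ | ⟨a', b'⟩ <;>
          rw [b, b'] at he <;>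
          simp only [Prod.mk.injEq, Fin.ext_iff, Fin.val_zero] at he <;> omega
        exact ⟨htt.2, by rw [hy, htt.1]⟩)
    refine ⟨W.copy (by simp [chainNode_zero]) (by simp [chainNode_last]), by simpa using h1, ?_, ?_⟩
    · rw [SimpleGraph.Walk.length_copy, h2]
      simp only [(hM _).2, hcol, Fin.eta]
      exact Equiv.sum_comp (Equiv.addLeft (⟨2 * (finProdFinEquiv (i, j)).val, by
        rw [hq]; have := (finProdFinEquiv (i, j)).2; omega⟩ : Fin q)) Λ
    · intro y hy
      rw [SimpleGraph.Walk.support_copy] at hy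
      rcases h3 y hy with h | ⟨r, hr, h⟩
      · refine ⟨⟨0, Nat.pos_of_ne_zero (NeZero.ne q)⟩, ?_⟩
        rw [h]
        exact SimpleGraph.Walk.start_mem_support _
      · exact ⟨⟨r, hr⟩, h⟩
  choose W hW1 hW2 hW3 using hW
  refine ⟨fun i => v (root (i, i, 0)), fun i j hij => W i j hij, ?_, ?_, ?_, ?_⟩
  · intro i j hij
    have := hroot (hv hij)
    simpa using this
  · exact fun i j hij => ⟨hW1 i j hij, hW2 i j hij⟩
  · intro i j hij k hk
    obtain ⟨r, hr⟩ := hW3 i j hij _ hk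
    have := hMv _ _ hr
    simp only [hroot.eq_iff] at this
    rcases this with h1 | h1
    · rcases chainNode_cases (q := q) i j (r := r) (by omega) with ⟨a, b⟩ | ⟨a, b⟩ | ⟨a, b⟩ <;>
      rw [b] at h1 <;> simp only [Prod.mk.injEq, Fin.ext_iff, Fin.val_zero] at h1 <;> omega
    · rcases chainNode_cases (q := q) i j (r := r + 1) (by omega) with ⟨a, b⟩ | ⟨a, b⟩ | ⟨a, b⟩ <;>
      rw [b] at h1 <;> simp only [Prod.mk.injEq, Fin.ext_iff, Fin.val_zero] at h1 <;> omega
  · intro i j hij i' j' hij' hne y hy hy'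
    obtain ⟨r, hr⟩ := hW3 i j hij _ hy
    obtain ⟨r', hr'⟩ := hW3 i' j' hij' _ hy'
    obtain ⟨t, t', ht, ht', hy, he⟩ := hmem (i, j, r) (i', j', r') (by
      intro h
      simp only [Prod.mk.injEq] at h
      exact hne (Prod.ext h.1 h.2.1)) y hr hr'
    simp only at ht ht' hy he
    rcases chainNode_cases (q := q) i j (r := t) (by omega) with ⟨a, b⟩ | ⟨a, b⟩ | ⟨a, b⟩
    · exact ⟨i, by rw [hy, b]⟩
    · exact ⟨j, by rw [hy, b]⟩
    · exfalso
      rcases chainNode_cases (q := q) i' j' (r := t') (by omega) with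
        ⟨a', b'⟩ | ⟨a', b'⟩ | ⟨a', b'⟩ <;>
      rw [b, b'] at he <;> simp only [Prod.mk.injEq, Fin.ext_iff, Fin.val_zero] at he
      · omega
      · omega
      · exact hne (by simp only [Prod.mk.injEq, Fin.ext_iff]; omega)

end Pattern

section PatternExists
open scoped Classical
set_option linter.unusedSectionVars false
variable {V : Type} [Fintype V] {G : SimpleGraph V}

/-- The colour of the link at position `r` of the chain from `i` to `j`. -/
def chainColor (h : ℕ) {q : ℕ} [NeZero q] (hq : q = 2 * (h * h)) (τ : Fin h × Fin h × Fin q) :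
    Fin q :=
  ⟨2 * (finProdFinEquiv (τ.1, τ.2.1)).val, by
      have := (finProdFinEquiv (τ.1, τ.2.1)).2; omega⟩ + τ.2.2

section
variable {h q : ℕ} [NeZero q] (hq : q = 2 * (h * h))

theorem chainColor_val (τ : Fin h × Fin h × Fin q) : (chainColor h hq τ : ℕ) =
    if 2 * (finProdFinEquiv (τ.1, τ.2.1)).val + τ.2.2 < q then
      2 * (finProdFinEquiv (τ.1, τ.2.1)).val + τ.2.2
    else 2 * (finProdFinEquiv (τ.1, τ.2.1)).val + τ.2.2 - q := by
  have h1 : 2 * (finProdFinEquiv (τ.1, τ.2.1)).val < q := by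
    have := (finProdFinEquiv (τ.1, τ.2.1)).2; omega
  have h2 := τ.2.2.2
  rw [chainColor, Fin.val_add]
  simp only
  split_ifs with h3
  · exact Nat.mod_eq_of_lt h3
  · rw [Nat.mod_eq_sub_mod (by omega), Nat.mod_eq_of_lt (by omega)]

theorem chain_task_eq {τ τ' : Fin h × Fin h × Fin q}
    (h1 : (finProdFinEquiv (τ.1, τ.2.1)).val = (finProdFinEquiv (τ'.1, τ'.2.1)).val)
    (h2 : (τ.2.2 : ℕ) = τ'.2.2) : τ = τ' := by
  have := finProdFinEquiv.injective (Fin.ext h1)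
  simp only [Prod.mk.injEq] at this
  exact Prod.ext this.1 (Prod.ext this.2 (Fin.ext h2))

theorem chain_left_injective {τ τ' : Fin h × Fin h × Fin q}
    (h1 : chainNode q τ.1 τ.2.1 τ.2.2 = chainNode q τ'.1 τ'.2.1 τ'.2.2)
    (h2 : chainColor h hq τ = chainColor h hq τ') : τ = τ' := by
  have h3 : (τ.2.2 : ℕ) = τ'.2.2 := by
    rw [← chainNode_pos τ.1 τ.2.1 τ.2.2.2, h1, chainNode_pos τ'.1 τ'.2.1 τ'.2.2.2]
  have h4 := congrArg Fin.val h2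
  rw [chainColor_val, chainColor_val] at h4
  have h5 := (finProdFinEquiv (τ.1, τ.2.1)).2
  have h6 := (finProdFinEquiv (τ'.1, τ'.2.1)).2
  have := τ.2.2.2
  apply chain_task_eq _ h3
  split_ifs at h4 <;> omega

theorem chain_right_injective {τ τ' : Fin h × Fin h × Fin q}
    (h1 : chainNode q τ.1 τ.2.1 (τ.2.2 + 1) = chainNode q τ'.1 τ'.2.1 (τ'.2.2 + 1))
    (h2 : chainColor h hq τ = chainColor h hq τ') : τ = τ' := by
  have h4 := congrArg Fin.val h2
  rw [chainColor_val, chainColor_val] at h4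
  have h5 := (finProdFinEquiv (τ.1, τ.2.1)).2
  have h6 := (finProdFinEquiv (τ'.1, τ'.2.1)).2
  have h7 := τ.2.2.2
  have h8 := τ'.2.2.2
  have h3 : (τ.2.2 : ℕ) = τ'.2.2 := by
    rcases chainNode_cases (q := q) τ.1 τ.2.1 (r := τ.2.2 + 1) (by omega) with
      ⟨a, b⟩ | ⟨a, b⟩ | ⟨a, b⟩ <;>
    rcases chainNode_cases (q := q) τ'.1 τ'.2.1 (r := τ'.2.2 + 1) (by omega) with
      ⟨a', b'⟩ | ⟨a', b'⟩ | ⟨a', b'⟩ <;>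
    rw [b, b'] at h1 <;>
    simp only [Prod.mk.injEq, Fin.ext_iff, Fin.val_zero] at h1 <;> omega
  apply chain_task_eq _ h3
  split_ifs at h4 <;> omega

theorem chain_left_ne_right (τ τ' : Fin h × Fin h × Fin q)
    (h1 : chainNode q τ.1 τ.2.1 τ.2.2 = chainNode q τ'.1 τ'.2.1 (τ'.2.2 + 1))
    (h2 : chainColor h hq τ = chainColor h hq τ') : False := by
  have h4 := congrArg Fin.val h2
  rw [chainColor_val, chainColor_val] at h4
  have h5 := (finProdFinEquiv (τ.1, τ.2.1)).2
  have h6 := (finProdFinEquiv (τ'.1, τ'.2.1)).2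
  have h7 := τ.2.2.2
  have h8 := τ'.2.2.2
  rcases chainNode_cases (q := q) τ.1 τ.2.1 (r := τ.2.2) (by omega) with
    ⟨a, b⟩ | ⟨a, b⟩ | ⟨a, b⟩ <;>
  rcases chainNode_cases (q := q) τ'.1 τ'.2.1 (r := τ'.2.2 + 1) (by omega) with
    ⟨a', b'⟩ | ⟨a', b'⟩ | ⟨a', b'⟩ <;>
  rw [b, b'] at h1 <;>
  simp only [Prod.mk.injEq, Fin.ext_iff, Fin.val_zero] at h1
  · omega
  · split_ifs at h4 <;> omega
  · omega
  · omega
  · omega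
  · omega
  · omega
  · omega
  · have h9 : (τ.1, τ.2.1) = (τ'.1, τ'.2.1) := Prod.ext (Fin.ext h1.1) (Fin.ext h1.2.1)
    rw [h9] at h4
    split_ifs at h4 <;> omega

end

/-- The number of roots needed to embed a balanced subdivision of `K_h`. -/
def rootCount (h m : ℕ) : ℕ :=
  2 * h ^ 4 * (6 * m + 1) ^ (2 * h ^ 2) +
    2 * h ^ 4 * ((6 * m + 1) ^ (2 * h ^ 2) *
      (2 * h ^ 4 * (6 * m + 1) ^ (2 * h ^ 2)) ^ (2 * h ^ 4))

theorem PointSystem.exists_balTK {h q : ℕ} (hh : 1 ≤ h) (hq : q = 2 * (h * h)) {N : ℕ}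
    (S : PointSystem G N q) (hN : N = rootCount h S.m)
    (hΦ : N * q * (2 * S.m + 1) + (2 * S.m + 1) * (2 * h ^ 4 * (2 * S.m + 1)) ≤ S.Φ₁) :
    ∃ ℓ, BalTK G h ℓ := by
  have hq0 : NeZero q := ⟨by rw [hq]; positivity⟩
  obtain ⟨C⟩ := S.exists_coreSystem (le_trans (Nat.le_add_right _ _) hΦ)
  have hrob := C.exists_robust hΦ
  choose ℓ hℓ hℓR using hrob
  set R := 2 * h ^ 4 with hR
  set K := R * (6 * S.m + 1) ^ q with hK
  set K2 := R * ((6 * S.m + 1) ^ q * K ^ R) with hK2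
  have hNK : N = K + K2 := by
    have h2q : 2 * h ^ 2 = q := by rw [pow_two]; exact hq.symm
    rw [hN, rootCount, hK2, hK, hR, h2q]
  let left : Fin K → Fin N := fun a => ⟨a, by omega⟩
  let right : Fin K2 → Fin N := fun b => ⟨K + b, by omega⟩
  let z : Fin N → Fin q → ℕ := fun i a => (C.Q (i, a)).length
  have hz : ∀ i a, z i a ≤ 2 * S.m := fun i a => C.length_le (i, a)
  obtain ⟨γ, ι, κ, hι, hκ, hc⟩ := exists_monochromatic_biclique (A := Fin K) (B := Fin K2)
    (K := Fin q → Fin (6 * S.m + 1))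
    (fun x y a => ⟨z (left x) a + ℓ (left x) (right y) a + z (right y) a, by
      have := hz (left x) a
      have := hz (right y) a
      have := hℓ (left x) (right y) a
      omega⟩) R (by rw [hR]; have : 0 < h ^ 4 := by positivity
                    omega) (by simp [hK]) (by simp [hK2])
  have hc' : ∀ x y a, z (left (ι x)) a + ℓ (left (ι x)) (right (κ y)) a + z (right (κ y)) a =
      γ a := by
    intro x y a
    have := congrFun (hc x y) a
    exact congrArg Fin.val this
  have hcard : Fintype.card (Fin h × Fin h × Fin q) = R := by
    simp only [Fintype.card_prod, Fintype.card_fin, hR, hq]; ring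
  let e : Fin h × Fin h × Fin q ≃ Fin R := Fintype.equivFinOfCardEq hcard
  let root : Fin h × Fin h × Fin q → Fin N := fun x =>
    if Even (x.2.2 : ℕ) then left (ι (e x)) else right (κ (e x))
  have hLi : ∀ x y, left x = left y → x = y := by
    intro x y hxy
    have := congrArg Fin.val hxy
    exact Fin.ext this
  have hRi : ∀ x y, right x = right y → x = y := by
    intro x y hxy
    have := congrArg Fin.val hxy
    simp only [right] at this
    exact Fin.ext (by omega)
  have hLRne : ∀ x y, left x ≠ right y := by
    intro x y hxy
    have := congrArg Fin.val hxy
    simp only [right, left] at this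
    omega
  have hroot : Function.Injective root := by
    intro x y hxy
    simp only [root] at hxy
    split_ifs at hxy
    · exact e.injective (hι (hLi _ _ hxy))
    · exact absurd hxy (hLRne _ _)
    · exact absurd hxy.symm (hLRne _ _)
    · exact e.injective (hκ (hRi _ _ hxy))
  have hqe : Even q := by rw [hq]; exact even_two_mul _
  have hpar : ∀ τ : Fin h × Fin h × Fin q,
      (Even (τ.2.2 : ℕ) ∧ root (chainNode q τ.1 τ.2.1 τ.2.2) =
          left (ι (e (chainNode q τ.1 τ.2.1 τ.2.2))) ∧
        root (chainNode q τ.1 τ.2.1 (τ.2.2 + 1)) =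
          right (κ (e (chainNode q τ.1 τ.2.1 (τ.2.2 + 1))))) ∨
      (¬ Even (τ.2.2 : ℕ) ∧ root (chainNode q τ.1 τ.2.1 τ.2.2) =
          right (κ (e (chainNode q τ.1 τ.2.1 τ.2.2))) ∧
        root (chainNode q τ.1 τ.2.1 (τ.2.2 + 1)) =
          left (ι (e (chainNode q τ.1 τ.2.1 (τ.2.2 + 1))))) := by
    intro τ
    have h1 := even_chainNode hqe τ.1 τ.2.1 (r := τ.2.2) τ.2.2.2.le
    have h2 := even_chainNode hqe τ.1 τ.2.1 (r := τ.2.2 + 1) τ.2.2.2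
    rw [Nat.even_add_one] at h2
    by_cases h3 : Even (τ.2.2 : ℕ)
    · exact Or.inl ⟨h3, if_pos (h1.2 h3), if_neg (fun h4 => h2.1 h4 h3)⟩
    · exact Or.inr ⟨h3, if_neg (fun h4 => h3 (h1.1 h4)), if_pos (h2.2 h3)⟩
  let Lt : Fin h × Fin h × Fin q → Fin N := fun τ => root (chainNode q τ.1 τ.2.1 τ.2.2)
  let Rt : Fin h × Fin h × Fin q → Fin N := fun τ => root (chainNode q τ.1 τ.2.1 (τ.2.2 + 1))
  let ln : Fin h × Fin h × Fin q → ℕ := fun τ =>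
    if Even (τ.2.2 : ℕ) then ℓ (Lt τ) (Rt τ) (chainColor h hq τ)
    else ℓ (Rt τ) (Lt τ) (chainColor h hq τ)
  obtain ⟨M, hM1, hM2, hM3⟩ := C.exists_links Lt Rt (chainColor h hq) ln
    (by
      intro τ
      rcases hpar τ with ⟨-, h1, h2⟩ | ⟨-, h1, h2⟩
      · simp only [Lt, Rt, h1, h2]; exact hLRne _ _
      · simp only [Lt, Rt, h1, h2]; exact (hLRne _ _).symm)
    (by
      intro τ τ' hne heq
      simp only [Prod.mk.injEq] at heq
      exact hne (chain_left_injective hq (hroot heq.1) heq.2))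
    (by
      intro τ τ' hne heq
      simp only [Prod.mk.injEq] at heq
      exact hne (chain_right_injective hq (hroot heq.1) heq.2))
    (by
      intro τ τ' heq
      simp only [Prod.mk.injEq] at heq
      exact chain_left_ne_right hq τ τ' (hroot heq.1) heq.2)
    (by
      intro τ
      simp only [ln]
      split_ifs
      · exact hℓR _ _ _
      · exact (hℓR _ _ _).symm)
    (by rw [hcard])
    (by
      intro τ
      simp only [ln]
      split_ifs <;> exact hℓ _ _ _)
  refine ⟨_, balTK_of_links hq (fun i => S.pt (i, none)) ?_ root hroot (chainColor h hq)
    (fun i j r => rfl) (fun a => γ a) M (fun τ => ⟨(hM1 τ).1, ?_⟩) hM2 hM3⟩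
  · intro i j hij
    have := S.pt_injective hij
    simpa using this
  · rw [(hM1 τ).2]
    change z (Lt τ) _ + ln τ + z (Rt τ) _ = _
    rcases hpar τ with ⟨h0, h1, h2⟩ | ⟨h0, h1, h2⟩
    · simp only [ln, if_pos h0, Lt, Rt, h1, h2]
      exact hc' _ _ _
    · simp only [ln, if_neg h0, Lt, Rt, h1, h2]
      rw [← hc' (e (chainNode q τ.1 τ.2.1 (τ.2.2 + 1))) (e (chainNode q τ.1 τ.2.1 τ.2.2))]
      ring

end PatternExists

section Numeric

theorem exists_mul_pow_le_exp (c : ℝ) (k : ℕ) :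
    ∃ T : ℝ, 1 ≤ T ∧ ∀ t, T ≤ t → c * t ^ k ≤ Real.exp t := by
  refine ⟨max 1 (c * (k + 1).factorial), le_max_left _ _, fun t ht => ?_⟩
  have h1 : 1 ≤ t := (le_max_left _ _).trans ht
  have h2 : c * (k + 1).factorial ≤ t := (le_max_right _ _).trans ht
  refine le_trans ?_ (Real.pow_div_factorial_le_exp t (by linarith) (k + 1))
  rw [le_div_iff₀ (by positivity), pow_succ]
  have : 0 ≤ t ^ k := by positivity
  nlinarith

theorem exp_ell_sub_two {x : ℝ} (hx : 0 < x) : Real.exp (ell x - 2) = x := by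
  rw [ell, add_sub_cancel_left, Real.exp_log hx]

theorem exists_ell_bounds (q : ℕ) : ∃ x₀ : ℝ, 1 ≤ x₀ ∧ ∀ x, x₀ ≤ x →
    20 * ell x ^ 2 ≤ √x ∧ 20 * ell x ^ 2 * (q * (14 * ell x ^ 3 + 4)) ≤ x := by
  obtain ⟨T, hT1, hT⟩ := exists_mul_pow_le_exp (9 * (400 + 360 * q)) 5
  refine ⟨Real.exp T, by linarith [Real.add_one_le_exp T], fun x hx => ?_⟩
  have hx0 : 0 < x := (Real.exp_pos T).trans_le hx
  have hxT : T ≤ Real.log x := (Real.le_log_iff_exp_le hx0).2 hx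
  have ht : T ≤ ell x := by rw [ell]; linarith
  have key := hT _ ht
  have he := exp_ell_sub_two hx0
  rw [Real.exp_sub] at he
  have he2 : Real.exp 2 ≤ 9 := by
    have := Real.exp_one_lt_d9
    have h2 : Real.exp 2 = Real.exp 1 * Real.exp 1 := by rw [← Real.exp_add]; norm_num
    rw [h2]
    nlinarith [Real.exp_pos 1]
  have he3 : Real.exp (ell x) ≤ 9 * x := by
    rw [div_eq_iff (Real.exp_pos 2).ne'] at he
    rw [he]
    nlinarith
  set t := ell x
  have ht1 : 1 ≤ t := hT1.trans ht
  have hq : (0 : ℝ) ≤ q := Nat.cast_nonneg q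
  have h5 : (400 + 360 * (q : ℝ)) * t ^ 5 ≤ x := by nlinarith
  have h45 : t ^ 4 ≤ t ^ 5 := pow_le_pow_right₀ ht1 (by norm_num)
  have h35 : t ^ 2 ≤ t ^ 5 := pow_le_pow_right₀ ht1 (by norm_num)
  have h05 : 0 ≤ t ^ 5 := by positivity
  constructor
  · apply Real.le_sqrt_of_sq_le
    nlinarith [mul_nonneg hq h05]
  · have : 20 * t ^ 2 * (q * (14 * t ^ 3 + 4)) = q * (280 * t ^ 5 + 80 * t ^ 2) := by ring
    rw [this]
    nlinarith [mul_nonneg hq h05, mul_le_mul_of_nonneg_left h35 hq]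

/-- A radius beyond which balls have outgrown any obstacle of size `exp φ`. -/
noncomputable def radius (φ : ℝ) : ℕ := ⌈1 + 40 / 3 * (2 + 2 * φ) ^ 3⌉₊

theorem le_radius (φ : ℝ) : 1 + 40 / 3 * (2 + 2 * φ) ^ 3 ≤ radius φ := Nat.le_ceil _

theorem radius_le {φ c : ℝ} (h0 : 0 ≤ φ) (h : φ ≤ c) (hc : 1 ≤ c) :
    (radius φ : ℝ) ≤ 856 * c ^ 3 := by
  have h1 : (radius φ : ℝ) < 1 + 40 / 3 * (2 + 2 * φ) ^ 3 + 1 := Nat.ceil_lt_add_one (by positivity)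
  have h2 : (2 + 2 * φ) ^ 3 ≤ (4 * c) ^ 3 := pow_le_pow_left₀ (by positivity) (by linarith) 3
  have h3 : 1 ≤ c ^ 3 := one_le_pow₀ hc
  nlinarith

theorem sq_le_of_radius_le {Φ φ x : ℝ} {k : ℕ} (hφ : Real.log Φ ≤ φ)
    (hk : radius φ ≤ k) (hx : 1 ≤ x) (h : 3 * ((k : ℝ) - 1) / 40 ≤ ell x ^ 3) : Φ ^ 2 ≤ x := by
  by_contra hcon
  push Not at hcon
  have h1 : Real.log x < 2 * Real.log Φ := by
    have := Real.log_lt_log (by linarith) hcon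
    rwa [Real.log_pow, Nat.cast_two] at this
  have h2 : ell x ^ 3 < (2 + 2 * φ) ^ 3 := by
    apply pow_lt_pow_left₀ _ _ (by norm_num)
    · rw [ell]; linarith
    · rw [ell]; linarith [Real.log_nonneg hx]
  have h3 := le_radius φ
  have h4 : (radius φ : ℝ) ≤ k := by exact_mod_cast hk
  linarith

theorem exists_radius_bound (C : ℕ) : ∃ Y : ℝ, 1 ≤ Y ∧ ∀ y, Y ≤ y →
    C * y + 42 * C * y * radius (C * y + 21 * C * y * radius (C * y)) ≤ Real.exp y - 2 := by
  obtain ⟨T, hT1, hT⟩ :=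
    exists_mul_pow_le_exp ((3 + 42 * (856 * 17977 ^ 3)) * ((C : ℝ) + 1) ^ 13) 13
  refine ⟨T, hT1, fun y hy => ?_⟩
  have hy1 : 1 ≤ y := hT1.trans hy
  have hC0 : (0 : ℝ) ≤ C := Nat.cast_nonneg C
  have key := hT y hy
  rw [mul_assoc, ← mul_pow] at key
  set c := ((C : ℝ) + 1) * y with hc
  have hc1 : 1 ≤ c := by nlinarith
  have hCy : (C : ℝ) * y ≤ c := by nlinarith
  have hCy0 : 0 ≤ (C : ℝ) * y := by positivity
  have h1 := radius_le hCy0 hCy hc1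
  have h2 : C * y + 21 * C * y * radius (C * y) ≤ 17977 * c ^ 4 := by
    have h3 : (C : ℝ) * y * radius (C * y) ≤ c * (856 * c ^ 3) :=
      mul_le_mul hCy h1 (Nat.cast_nonneg _) (by linarith)
    have h4 : c ≤ c ^ 4 := le_self_pow₀ hc1 (by norm_num)
    nlinarith
  have h5 : (1 : ℝ) ≤ 17977 * c ^ 4 := by
    have : 1 ≤ c ^ 4 := one_le_pow₀ hc1
    linarith
  have h6 := radius_le (by positivity) h2 h5
  have h7 : (C : ℝ) * y * radius (C * y + 21 * C * y * radius (C * y)) ≤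
      c * (856 * (17977 * c ^ 4) ^ 3) := mul_le_mul hCy h6 (Nat.cast_nonneg _) (by linarith)
  have h8 : c ≤ c ^ 13 := le_self_pow₀ hc1 (by norm_num)
  have h9 : (1 : ℝ) ≤ c ^ 13 := one_le_pow₀ hc1
  nlinarith

theorem exists_rootCount_bound (h : ℕ) (hh : 2 ≤ h) : ∃ C : ℕ, 1 ≤ C ∧ ∃ L₀ : ℝ, 1 ≤ L₀ ∧
    ∀ L, L₀ ≤ L → ∀ m : ℕ, (m : ℝ) ≤ 15 * L ^ 3 →
    ((rootCount h m * (2 * (h * h)) * (2 * m + 1) + (2 * m + 1) * (2 * h ^ 4 * (2 * m + 1)) +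
      rootCount h m * (2 * (h * h) + 1) : ℕ) : ℝ) ≤ L ^ C := by
  set a := 2 * h ^ 4 with ha
  set q := 2 * (h * h) with hq
  set E := (q + 1) * (a + 1) + 1 with hE
  refine ⟨5 * (E + 4), by omega, max a 91, le_max_of_le_right (by norm_num), fun L hL m hm => ?_⟩
  have hLa : (a : ℝ) ≤ L := (le_max_left _ _).trans hL
  have hL1 : (91 : ℝ) ≤ L := (le_max_right _ _).trans hL
  have haq : q + 1 ≤ a := by rw [ha, hq]; nlinarith [Nat.mul_le_mul hh hh]
  set Z := a * (6 * m + 1) with hZ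
  have ha9 : 9 ≤ a := by
    have : 4 ≤ h * h := Nat.mul_le_mul hh hh
    omega
  have hZa : a ≤ Z := Nat.le_mul_of_pos_right _ (by omega)
  have hZm : 6 * m + 1 ≤ Z := Nat.le_mul_of_pos_left _ (by omega)
  have hZ1 : 1 ≤ Z := by omega
  have hN : rootCount h m ≤ Z ^ E := by
    have h1 : a * (6 * m + 1) ^ q ≤ Z ^ (q + 1) := by
      rw [pow_succ, mul_comm]
      exact Nat.mul_le_mul (Nat.pow_le_pow_left hZm q) hZa
    have h2 : a * ((6 * m + 1) ^ q * (a * (6 * m + 1) ^ q) ^ a) ≤ Z ^ ((q + 1) * (a + 1)) := by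
      rw [← mul_assoc]
      calc _ ≤ Z ^ (q + 1) * (Z ^ (q + 1)) ^ a := Nat.mul_le_mul h1 (Nat.pow_le_pow_left h1 a)
        _ = _ := by rw [← pow_mul, ← pow_add]; congr 1; ring
    have h3 : Z ^ (q + 1) ≤ Z ^ ((q + 1) * (a + 1)) :=
      Nat.pow_le_pow_right hZ1 (Nat.le_mul_of_pos_right _ (by omega))
    have h4 : rootCount h m = a * (6 * m + 1) ^ q +
        a * ((6 * m + 1) ^ q * (a * (6 * m + 1) ^ q) ^ a) := by
      rw [rootCount, ha, hq, pow_two]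
    rw [h4, hE, pow_succ]
    calc _ ≤ Z ^ ((q + 1) * (a + 1)) * 2 := by omega
      _ ≤ _ := Nat.mul_le_mul_left _ (by omega)
  have htot : rootCount h m * q * (2 * m + 1) + (2 * m + 1) * (a * (2 * m + 1)) +
      rootCount h m * (q + 1) ≤ Z ^ (E + 4) := by
    have h1 : rootCount h m * q * (2 * m + 1) ≤ Z ^ E * Z * Z :=
      Nat.mul_le_mul (Nat.mul_le_mul hN (by omega)) (by omega)
    have h2 : (2 * m + 1) * (a * (2 * m + 1)) ≤ Z * (Z * Z) :=
      Nat.mul_le_mul (by omega) (Nat.mul_le_mul hZa (by omega))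
    have h3 : rootCount h m * (q + 1) ≤ Z ^ E * Z := Nat.mul_le_mul hN (by omega)
    have h4 : Z * (Z * Z) ≤ Z ^ (E + 3) := by
      calc Z * (Z * Z) = Z ^ 3 := by ring
        _ ≤ _ := Nat.pow_le_pow_right hZ1 (by omega)
    have h5 : Z ^ E * Z * Z ≤ Z ^ (E + 3) := by
      calc Z ^ E * Z * Z = Z ^ (E + 2) := by ring
        _ ≤ _ := Nat.pow_le_pow_right hZ1 (by omega)
    have h6 : Z ^ E * Z ≤ Z ^ (E + 3) := by
      calc Z ^ E * Z = Z ^ (E + 1) := by ring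
        _ ≤ _ := Nat.pow_le_pow_right hZ1 (by omega)
    calc _ ≤ Z ^ (E + 3) * 3 := by omega
      _ ≤ Z ^ (E + 3) * Z := Nat.mul_le_mul_left _ (by omega)
      _ = Z ^ (E + 4) := by ring
  have hZL : (Z : ℝ) ≤ L ^ 5 := by
    have h1 : (Z : ℝ) = a * (6 * m + 1) := by rw [hZ]; push_cast; ring
    have h2 : (6 * (m : ℝ) + 1) ≤ L ^ 4 := by
      have : 1 ≤ L ^ 3 := one_le_pow₀ (by linarith)
      nlinarith
    rw [h1, pow_succ', ]
    exact mul_le_mul hLa h2 (by positivity) (by linarith)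
  calc _ ≤ ((Z ^ (E + 4) : ℕ) : ℝ) := by exact_mod_cast htot
    _ = (Z : ℝ) ^ (E + 4) := by push_cast; ring
    _ ≤ (L ^ 5) ^ (E + 4) := pow_le_pow_left₀ (by positivity) hZL _
    _ = _ := by rw [← pow_mul]

end Numeric

section ExpanderSubdivision
open scoped Classical
set_option linter.unusedSectionVars false
variable {V : Type} [Fintype V] {G : SimpleGraph V}

theorem exists_separated (Δ D : ℕ) (hΔ : ∀ v, (univ.filter fun y => G.Adj v y).card ≤ Δ)
    (M : ℕ) (hM : M * (Δ + 1) ^ (2 * D) ≤ Fintype.card V) :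
    ∃ p : Fin M → V, ∀ i j, i ≠ j → Disjoint (ball G ∅ (p i) D) (ball G ∅ (p j) D) := by
  induction M with
  | zero => exact ⟨Fin.elim0, fun i => i.elim0⟩
  | succ M ih =>
    obtain ⟨p, hp⟩ := ih (le_trans (Nat.mul_le_mul_right _ (Nat.le_succ M)) hM)
    have hlt : ((univ : Finset (Fin M)).biUnion fun i => ball G ∅ (p i) (2 * D)).card <
        (univ : Finset V).card := by
      calc _ ≤ ∑ i : Fin M, (ball G ∅ (p i) (2 * D)).card := card_biUnion_le
        _ ≤ ∑ i : Fin M, (Δ + 1) ^ (2 * D) := sum_le_sum fun i _ => card_ball_le Δ hΔ _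
        _ = M * (Δ + 1) ^ (2 * D) := by simp
        _ < (M + 1) * (Δ + 1) ^ (2 * D) := Nat.mul_lt_mul_of_pos_right (by omega) (by positivity)
        _ ≤ _ := by rw [card_univ]; exact hM
    obtain ⟨w, -, hw⟩ := exists_mem_notMem_of_card_lt_card hlt
    have hwp : ∀ i, Disjoint (ball G ∅ (p i) D) (ball G ∅ w D) := by
      intro i
      rw [disjoint_left]
      intro x hx hx'
      apply hw
      rw [mem_biUnion]
      refine ⟨i, mem_univ i, ?_⟩
      obtain ⟨a, ha, -⟩ := mem_ball_iff.1 hx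
      obtain ⟨b, hb, -⟩ := mem_ball_iff.1 hx'
      refine mem_ball_iff.2 ⟨a.append b.reverse, ?_, fun y _ => Or.inr (by simp)⟩
      rw [SimpleGraph.Walk.length_append, SimpleGraph.Walk.length_reverse]
      omega
    refine ⟨Fin.snoc p w, fun i j hij => ?_⟩
    rcases Fin.eq_castSucc_or_eq_last i with ⟨i, rfl⟩ | rfl <;>
    rcases Fin.eq_castSucc_or_eq_last j with ⟨j, rfl⟩ | rfl
    · simp only [Fin.snoc_castSucc]
      exact hp i j fun h => hij (by rw [h])
    · simp only [Fin.snoc_castSucc, Fin.snoc_last]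
      exact hwp i
    · simp only [Fin.snoc_castSucc, Fin.snoc_last]
      exact (hwp j).symm
    · exact absurd rfl hij

theorem half_lt_card_ball_of_obstacles (hG : SublinearExpander G) {δ : ℝ} {m q D₁ D₂ Φ₁ Φ₂ : ℕ}
    (hm : 1 ≤ m) (hδ : 2 ≤ δ) (hdeg : ∀ v, δ ≤ (univ.filter fun y => G.Adj v y).card)
    (hx : ∀ x, δ / 2 ≤ x → 20 * ell x ^ 2 ≤ √x ∧ 20 * ell x ^ 2 * (q * (14 * ell x ^ 3 + 4)) ≤ x)
    (h₁ : ∀ k : ℕ, D₁ ≤ k → 1 ≤ k → ∀ x, δ / 2 ≤ x → 3 * ((k : ℝ) - 1) / 40 ≤ ell x ^ 3 →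
      (Φ₁ : ℝ) ^ 2 ≤ x)
    (h₂ : ∀ k : ℕ, D₂ ≤ k → 1 ≤ k → ∀ x, δ / 2 ≤ x → 3 * ((k : ℝ) - 1) / 40 ≤ ell x ^ 3 →
      (Φ₂ : ℝ) ^ 2 ≤ x)
    (h0 : (0 < D₁ ∧ 2 * q ≤ δ / 2) ∨ (D₁ = 0 ∧ D₂ = 0 ∧ Φ₂ ≤ δ / 2))
    (hfin : ell (Fintype.card V) ^ 3 < 3 * ((m : ℝ) - 1) / 40) (w : V) (F : Finset V)
    (hF₁ : ∀ k < D₁, (F ∩ nbh G (ball G F w k)).card ≤ q * (k + 2))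
    (hF₂ : ∀ k < D₂, (F ∩ nbh G (ball G F w k)).card ≤ Φ₁) (hF : F.card ≤ Φ₂) :
    Fintype.card V < 2 * (ball G F w m).card := by
  have hsq : ∀ x : ℝ, ∀ Φ : ℕ, δ / 2 ≤ x → (Φ : ℝ) ^ 2 ≤ x → 20 * ell x ^ 2 * Φ ≤ x := by
    intro x Φ hxδ hΦ
    have hx0 : 0 ≤ x := by linarith
    calc 20 * ell x ^ 2 * Φ ≤ √x * √x :=
          mul_le_mul (hx x hxδ).1 (Real.le_sqrt_of_sq_le hΦ) (Nat.cast_nonneg _)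
            (Real.sqrt_nonneg x)
      _ = x := Real.mul_self_sqrt hx0
  refine half_lt_card_ball hG
    (fun k => if k < D₁ then ((q * (k + 2) : ℕ) : ℝ) else if k < D₂ then (Φ₁ : ℝ) else Φ₂) δ m hm hδ
    (hdeg w) ?_ ?_ ?_ hfin
  · intro k _
    split_ifs with ha hb
    · exact_mod_cast hF₁ k ha
    · exact_mod_cast hF₂ k hb
    · exact_mod_cast (card_le_card inter_subset_left).trans hF
  · rcases h0 with ⟨ha, hb⟩ | ⟨ha, hb, hc⟩
    · simp only [if_pos ha]
      push_cast
      linarith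
    · simp only [ha, hb, lt_irrefl, if_false]
      exact hc
  · intro k hk x hxδ hkx
    split_ifs with ha hb
    · refine le_trans ?_ (hx x hxδ).2
      apply mul_le_mul_of_nonneg_left _ (by positivity)
      push_cast
      apply mul_le_mul_of_nonneg_left _ (by positivity)
      have : (0 : ℝ) ≤ ell x ^ 3 := by
        have : (1 : ℝ) ≤ k := by exact_mod_cast hk
        linarith
      linarith
    · exact hsq x _ hxδ (h₁ k (by omega) hk x hxδ hkx)
    · exact hsq x _ hxδ (h₂ k (by omega) hk x hxδ hkx)

theorem exists_balTK_of_expander (h : ℕ) (hh : 2 ≤ h) : ∃ δ₀ : ℝ, 2 ≤ δ₀ ∧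
    ∀ (V : Type) [Fintype V] [Nonempty V] (G : SimpleGraph V) (δ : ℝ) (Δ : ℕ), δ₀ ≤ δ →
      SublinearExpander G →
      (∀ v, δ ≤ (univ.filter fun y => G.Adj v y).card) →
      (∀ v, (univ.filter fun y => G.Adj v y).card ≤ Δ) → (Δ : ℝ) + 1 ≤ (8 * δ) ^ 10 →
      ∃ ℓ, BalTK G h ℓ := by
  obtain ⟨x₀, hx₀1, hx₀⟩ := exists_ell_bounds (2 * (h * h))
  obtain ⟨C, hC, L₀, hL₀1, hL₀⟩ := exists_rootCount_bound h hh
  obtain ⟨Y, hY1, hY⟩ := exists_radius_bound C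
  refine ⟨max (2 * x₀) (max (4 * (2 * (h * h) : ℕ)) (max (Real.exp L₀)
    (max (Real.exp (Real.exp Y)) (Real.exp (16 ^ 10))))), le_max_of_le_left (by linarith), ?_⟩
  intro V _ _ G δ Δ hδ hG hdeg hΔ hΔδ
  simp only [max_le_iff] at hδ
  obtain ⟨hδx, hδq, hδL, hδY, hδ16⟩ := hδ
  have hδ2 : 2 ≤ δ := by linarith
  have hn : δ ≤ Fintype.card V := by
    obtain ⟨v⟩ := ‹Nonempty V›
    refine (hdeg v).trans ?_
    exact_mod_cast card_le_univ _
  have hn0 : (0 : ℝ) < Fintype.card V := by linarith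
  set L := ell (Fintype.card V) with hLdef
  have hLn : Real.exp (L - 2) = Fintype.card V := exp_ell_sub_two hn0
  have hLlow : ∀ t : ℝ, Real.exp t ≤ δ → t ≤ L := by
    intro t ht
    have : t ≤ Real.log (Fintype.card V) := (Real.le_log_iff_exp_le hn0).2 (ht.trans hn)
    rw [hLdef, ell]; linarith
  have hL0L := hLlow _ hδL
  have hYL := hLlow _ hδY
  have h16L := hLlow _ hδ16
  have hL1 : 1 ≤ L := hL₀1.trans hL0L
  obtain ⟨m, hm⟩ : ∃ m : ℕ, m = ⌈14 * L ^ 3⌉₊ + 1 := ⟨_, rfl⟩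
  have hL3 : 1 ≤ L ^ 3 := one_le_pow₀ hL1
  have hL3' : (16 : ℝ) ^ 10 ≤ L ^ 3 := h16L.trans (le_self_pow₀ hL1 (by norm_num))
  have hmfin : L ^ 3 < 3 * ((m : ℝ) - 1) / 40 := by
    have : 14 * L ^ 3 ≤ ⌈14 * L ^ 3⌉₊ := Nat.le_ceil _
    rw [hm]; push_cast; linarith
  have hm15 : (m : ℝ) ≤ 15 * L ^ 3 := by
    have : (⌈14 * L ^ 3⌉₊ : ℝ) < 14 * L ^ 3 + 1 := Nat.ceil_lt_add_one (by positivity)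
    rw [hm]; push_cast
    norm_num at hL3'
    linarith
  have hbd := hL₀ L hL0L m hm15
  set q := 2 * (h * h) with hq
  set N := rootCount h m with hN
  set Φ₁ := N * q * (2 * m + 1) + (2 * m + 1) * (2 * h ^ 4 * (2 * m + 1)) with hΦ₁
  have hcardP : Fintype.card (Fin N × Option (Fin q)) = N * (q + 1) := by simp
  have hLC : 0 ≤ L ^ C := by positivity
  have hxb : ∀ x, δ / 2 ≤ x → 20 * ell x ^ 2 ≤ √x ∧
      20 * ell x ^ 2 * (q * (14 * ell x ^ 3 + 4)) ≤ x := fun x hx => hx₀ x (by linarith)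
  have hfinish : ∀ D₁ D₂ Φ₂ : ℕ, D₁ ≤ D₂ →
      Φ₁ + N * (q + 1) * (Δ + 1) ^ D₁ ≤ Φ₂ → N * (q + 1) * (Δ + 1) ^ (2 * D₂) ≤ Fintype.card V →
      (∀ k : ℕ, D₁ ≤ k → 1 ≤ k → ∀ x, δ / 2 ≤ x → 3 * ((k : ℝ) - 1) / 40 ≤ ell x ^ 3 →
        (Φ₁ : ℝ) ^ 2 ≤ x) →
      (∀ k : ℕ, D₂ ≤ k → 1 ≤ k → ∀ x, δ / 2 ≤ x → 3 * ((k : ℝ) - 1) / 40 ≤ ell x ^ 3 →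
        (Φ₂ : ℝ) ^ 2 ≤ x) →
      ((0 < D₁ ∧ 2 * q ≤ δ / 2) ∨ (D₁ = 0 ∧ D₂ = 0 ∧ Φ₂ ≤ δ / 2)) → ∃ ℓ, BalTK G h ℓ := by
    intro D₁ D₂ Φ₂ hD hΦ hfar h1 h2 h0
    obtain ⟨p, hp⟩ := exists_separated Δ D₂ hΔ _ hfar
    let e := Fintype.equivFinOfCardEq hcardP
    let S : PointSystem G N q :=
      { pt := fun x => p (e x)
        D₁ := D₁
        D₂ := D₂
        m := m
        Φ₁ := Φ₁
        Φ₂ := Φ₂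
        hD := hD
        disj := fun x y hxy => hp _ _ fun h => hxy (e.injective h)
        hΦ := by
          refine le_trans (Nat.add_le_add_left ?_ _) hΦ
          calc _ ≤ ∑ _x : Fin N × Option (Fin q), (Δ + 1) ^ D₁ :=
                sum_le_sum fun x _ => card_ball_le Δ hΔ _
            _ = _ := by rw [sum_const, card_univ, hcardP, smul_eq_mul]
        grow := fun x F a b c => half_lt_card_ball_of_obstacles hG (by omega) hδ2 hdeg hxb h1 h2 h0
          hmfin _ F a b c }
    exact S.exists_balTK (by omega) hq rfl le_rfl
  by_cases hdense : (L ^ C) ^ 2 ≤ δ / 2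
  · have hLC1 : 1 ≤ L ^ C := one_le_pow₀ hL1
    have hLCδ : L ^ C ≤ δ / 2 := le_trans (by nlinarith) hdense
    have hΦ₂ : ((Φ₁ + N * (q + 1) : ℕ) : ℝ) ≤ L ^ C := by exact_mod_cast hbd
    have hΦ₁' : (Φ₁ : ℝ) ≤ L ^ C := le_trans (by exact_mod_cast Nat.le_add_right _ _) hΦ₂
    refine hfinish 0 0 (Φ₁ + N * (q + 1)) le_rfl (by simp) ?_ ?_ ?_
      (Or.inr ⟨rfl, rfl, hΦ₂.trans hLCδ⟩)
    · have : ((N * (q + 1) : ℕ) : ℝ) ≤ Fintype.card V :=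
        le_trans (by exact_mod_cast Nat.le_add_left _ _) (hΦ₂.trans (by linarith))
      simpa using (by exact_mod_cast this : N * (q + 1) ≤ Fintype.card V)
    · intro k _ _ x hx _
      exact ((pow_le_pow_left₀ (Nat.cast_nonneg _) hΦ₁' 2).trans hdense).trans hx
    · intro k _ _ x hx _
      exact ((pow_le_pow_left₀ (Nat.cast_nonneg _) hΦ₂ 2).trans hdense).trans hx
  · push Not at hdense
    set y := Real.log L with hy
    have hLpos : 0 < L := by linarith
    have hyL : Real.exp y = L := Real.exp_log hLpos
    have hYy : Y ≤ y := (Real.le_log_iff_exp_le hLpos).2 hYL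
    have hy0 : 0 ≤ y := by linarith
    have hC0 : (0 : ℝ) ≤ C := Nat.cast_nonneg C
    have hCy0 : 0 ≤ C * y := by positivity
    have hLCy : L ^ C = Real.exp (C * y) := by rw [← hyL, ← Real.exp_nat_mul]
    have hΔL : ((Δ + 1 : ℕ) : ℝ) ≤ Real.exp (21 * C * y) := by
      have h1 : (16 : ℝ) ^ 10 ≤ L ^ C := h16L.trans (le_self_pow₀ hL1 (by omega))
      have h2 : (8 * δ) ^ 10 ≤ (16 * (L ^ C) ^ 2) ^ 10 :=
        pow_le_pow_left₀ (by linarith) (by linarith) 10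
      have h3 : Real.exp (21 * C * y) = (L ^ C) ^ 21 := by
        rw [hLCy, ← Real.exp_nat_mul]; congr 1; push_cast; ring
      push_cast
      rw [h3]
      calc (Δ : ℝ) + 1 ≤ 16 ^ 10 * (L ^ C) ^ 20 := by
            refine hΔδ.trans (h2.trans (le_of_eq ?_)); ring
        _ ≤ L ^ C * (L ^ C) ^ 20 := mul_le_mul_of_nonneg_right h1 (by positivity)
        _ = _ := by ring
    have hΔk : ∀ k : ℕ, (((Δ + 1) ^ k : ℕ) : ℝ) ≤ Real.exp (21 * C * y * k) := by
      intro k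
      rw [mul_comm _ (k : ℝ), Real.exp_nat_mul, Nat.cast_pow]
      exact pow_le_pow_left₀ (Nat.cast_nonneg _) hΔL k
    set D₁ := radius (C * y) with hD₁
    set φ := C * y + 21 * C * y * D₁ with hφ
    set D₂ := radius φ with hD₂
    have hφC : C * y ≤ φ := by
      have : 0 ≤ 21 * C * y * D₁ := by positivity
      linarith
    have hφ0 : 0 ≤ φ := hCy0.trans hφC
    have hD12 : D₁ ≤ D₂ := Nat.ceil_mono (by
      have : (2 + 2 * (C * y)) ^ 3 ≤ (2 + 2 * φ) ^ 3 :=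
        pow_le_pow_left₀ (by positivity) (by linarith) 3
      linarith)
    have hlog : ∀ (Φ : ℕ) (t : ℝ), 0 ≤ t → (Φ : ℝ) ≤ Real.exp t → Real.log Φ ≤ t := by
      intro Φ t ht hΦ
      rcases Nat.eq_zero_or_pos Φ with rfl | hpos
      · simpa using ht
      · exact (Real.log_le_iff_le_exp (by exact_mod_cast hpos)).2 hΦ
    have hΦ₂ : ((Φ₁ + N * (q + 1) : ℕ) : ℝ) ≤ Real.exp (C * y) := by
      rw [← hLCy]; exact_mod_cast hbd
    have hΦ₁' : (Φ₁ : ℝ) ≤ Real.exp (C * y) :=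
      le_trans (by exact_mod_cast Nat.le_add_right _ _) hΦ₂
    have hPle : ((N * (q + 1) : ℕ) : ℝ) ≤ Real.exp (C * y) :=
      le_trans (by exact_mod_cast Nat.le_add_left _ _) hΦ₂
    refine hfinish D₁ D₂ (Φ₁ + N * (q + 1) * (Δ + 1) ^ D₁) hD12 le_rfl ?_ ?_ ?_ (Or.inl ⟨?_, ?_⟩)
    · have h1 : ((N * (q + 1) * (Δ + 1) ^ (2 * D₂) : ℕ) : ℝ) ≤ Fintype.card V := by
        rw [Nat.cast_mul, ← hLn]
        calc _ ≤ Real.exp (C * y) * Real.exp (21 * C * y * (2 * D₂ : ℕ)) :=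
              mul_le_mul hPle (hΔk _) (Nat.cast_nonneg _) (Real.exp_pos _).le
          _ = Real.exp (C * y + 42 * C * y * D₂) := by
              rw [← Real.exp_add]; congr 1; push_cast; ring
          _ ≤ _ := by
              apply Real.exp_le_exp.2
              have := hY y hYy
              rwa [hyL] at this
      exact_mod_cast h1
    · intro k hk _ x hx hkx
      exact sq_le_of_radius_le (hlog _ _ hCy0 hΦ₁') hk (by linarith) hkx
    · intro k hk _ x hx hkx
      refine sq_le_of_radius_le (hlog _ _ hφ0 ?_) hk (by linarith) hkx
      have h1 : Φ₁ + N * (q + 1) * (Δ + 1) ^ D₁ ≤ (Φ₁ + N * (q + 1)) * (Δ + 1) ^ D₁ := by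
        rw [add_mul]
        exact Nat.add_le_add_right (Nat.le_mul_of_pos_right _ (by positivity)) _
      calc _ ≤ (((Φ₁ + N * (q + 1)) * (Δ + 1) ^ D₁ : ℕ) : ℝ) := by exact_mod_cast h1
        _ ≤ Real.exp (C * y) * Real.exp (21 * C * y * D₁) := by
          rw [Nat.cast_mul]
          exact mul_le_mul hΦ₂ (hΔk _) (Nat.cast_nonneg _) (Real.exp_pos _).le
        _ = _ := by rw [← Real.exp_add]
    · have := le_radius (C * y)
      have h1 : (0 : ℝ) < radius (C * y) := lt_of_lt_of_le (by positivity) this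
      exact_mod_cast h1
    · linarith

end ExpanderSubdivision

section Dense
open scoped Classical
set_option linter.unusedSectionVars false
variable {V : Type} [Fintype V]

/-- Greedily match the vertices of `B` to pairs of common neighbours inside `H`. -/
theorem exists_subdivided_graph (G : SimpleGraph V) (H B : Finset V) (hHB : Disjoint H B) (h : ℕ)
    (hB : ∀ a ∈ B, h ≤ (H.filter fun x => G.Adj x a).card) :
    ∃ J : SimpleGraph {x // x ∈ H}, (∀ ℓ, BalTK J h ℓ → BalTK G h (2 * ℓ)) ∧
      ((∃ ℓ, BalTK J h ℓ) ∨ B.card ≤ adjPairs J univ) := by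
  let Valid : Finset (Sym2 {x // x ∈ H} × V) → Prop := fun E =>
    (∀ p ∈ E, ¬ p.1.IsDiag ∧ p.2 ∈ B ∧ ∀ x ∈ p.1, G.Adj x.1 p.2) ∧
    (∀ p ∈ E, ∀ p' ∈ E, p.1 = p'.1 → p = p') ∧ (∀ p ∈ E, ∀ p' ∈ E, p.2 = p'.2 → p = p')
  obtain ⟨E, hE, hmax⟩ := exists_max_image (univ.filter Valid) card ⟨∅, by simp [Valid]⟩
  obtain ⟨hE1, hE2, hE3⟩ := (mem_filter.1 hE).2
  let J : SimpleGraph {x // x ∈ H} := SimpleGraph.fromEdgeSet {e | ∃ a, (e, a) ∈ E}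
  have hJ : ∀ x y, J.Adj x y ↔ (∃ a, (s(x, y), a) ∈ E) ∧ x ≠ y := by
    intro x y
    simp [J]
  have hJE : ∀ e ∈ J.edgeSet, ∃ a, (e, a) ∈ E := by
    intro e he
    induction e with | h x y =>
    exact ((hJ x y).1 he).1
  refine ⟨J, ?_, ?_⟩
  · intro ℓ hℓ
    rcases isEmpty_or_nonempty V with hV | hV
    · obtain ⟨b, P, -⟩ := hℓ
      refine ⟨fun i => (hV.false (b i).1).elim, fun i => (hV.false (b i).1).elim,
        fun i => (hV.false (b i).1).elim, fun i => (hV.false (b i).1).elim,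
        fun i => (hV.false (b i).1).elim, fun i => (hV.false (b i).1).elim⟩
    let μ : Sym2 {x // x ∈ H} → V := fun e =>
      if he : ∃ a, (e, a) ∈ E then he.choose else Classical.arbitrary V
    have hμ : ∀ e ∈ J.edgeSet, (e, μ e) ∈ E := by
      intro e he
      have := hJE e he
      simp only [μ, dif_pos this]
      exact this.choose_spec
    refine BalTK.of_subdiv Subtype.val μ ?_ Subtype.val_injective ?_ ?_ hℓ
    · intro x y hxy
      exact (hE1 _ (hμ s(x, y) hxy)).2.2 x (Sym2.mem_mk_left x y)
    · intro e he e' he' heq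
      exact congrArg Prod.fst (hE3 _ (hμ e he) _ (hμ e' he') heq)
    · intro e he x hx
      exact disjoint_left.1 hHB x.2 (hx ▸ (hE1 _ (hμ e he)).2.1)
  · by_cases hused : ∀ a ∈ B, ∃ e, (e, a) ∈ E
    · right
      rcases B.eq_empty_or_nonempty with rfl | ⟨a₀, ha₀⟩
      · simp
      have hne : Nonempty (Sym2 {x // x ∈ H}) := ⟨(hused a₀ ha₀).choose⟩
      choose! ν hν using hused
      refine card_le_card_of_injOn (fun a => (ν a).out) ?_ ?_
      · intro a ha
        have h1 := hE1 _ (hν a ha)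
        have h2 : ν a = s((ν a).out.1, (ν a).out.2) := (Quot.out_eq (ν a)).symm
        simp only [coe_filter, mem_product, mem_univ, true_and, Set.mem_ofPred_eq, and_self]
        rw [hJ]
        refine ⟨⟨a, ?_⟩, ?_⟩
        · rw [← h2]; exact hν a ha
        · intro h3
          apply h1.1
          rw [h2, h3]
          exact Sym2.mk_isDiag_iff.2 rfl
      · intro a ha a' ha' heq
        have h1 : ν a = ν a' := by
          rw [← Quot.out_eq (ν a), ← Quot.out_eq (ν a')]
          exact congrArg _ heq
        have := hE2 _ (hν a ha) _ (hν a' ha') h1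
        exact congrArg Prod.snd this
    · left
      push Not at hused
      obtain ⟨a, ha, hfree⟩ := hused
      have hadj : ∀ x y : {x // x ∈ H}, x ≠ y → G.Adj x.1 a → G.Adj y.1 a → J.Adj x y := by
        intro x y hxy hx hy
        rw [hJ]
        refine ⟨?_, hxy⟩
        by_contra hcon
        push Not at hcon
        have hval : Valid (insert (s(x, y), a) E) := by
          refine ⟨?_, ?_, ?_⟩
          · intro p hp
            rcases mem_insert.1 hp with rfl | hp
            · refine ⟨by simpa using hxy, ha, ?_⟩
              intro z hz
              rcases Sym2.mem_iff.1 hz with rfl | rfl <;> assumption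
            · exact hE1 p hp
          · intro p hp p' hp' heq
            rcases mem_insert.1 hp with rfl | hp <;> rcases mem_insert.1 hp' with rfl | hp'
            · rfl
            · exact absurd (show (s(x, y), p'.2) ∈ E by simp only at heq; rw [heq]; exact hp')
                (hcon _)
            · exact absurd (show (s(x, y), p.2) ∈ E by simp only at heq; rw [← heq]; exact hp)
                (hcon _)
            · exact hE2 p hp p' hp' heq
          · intro p hp p' hp' heq
            rcases mem_insert.1 hp with rfl | hp <;> rcases mem_insert.1 hp' with rfl | hp'
            · rfl
            · exact absurd (show (p'.1, a) ∈ E by simp only at heq; rw [heq]; exact hp') (hfree _)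
            · exact absurd (show (p.1, a) ∈ E by simp only at heq; rw [← heq]; exact hp) (hfree _)
            · exact hE3 p hp p' hp' heq
        have := hmax _ (mem_filter.2 ⟨mem_univ _, hval⟩)
        rw [card_insert_of_notMem (hfree _)] at this
        omega
      have hcard : Fintype.card (Fin h) ≤ Fintype.card {x // x ∈ H.filter fun x => G.Adj x a} := by
        rw [Fintype.card_fin, Fintype.card_coe]
        exact hB a ha
      obtain ⟨b⟩ := Function.Embedding.nonempty_of_card_le hcard
      have hb := fun i => mem_filter.1 (b i).2
      have hinj : Function.Injective fun i => (⟨(b i).1, (hb i).1⟩ : {x // x ∈ H}) := by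
        intro i j hij
        exact b.injective (Subtype.ext (Subtype.mk.inj hij))
      exact ⟨1, BalTK.of_clique _ hinj fun i j hij =>
        hadj _ _ (fun h => hij.ne (hinj h)) (hb i).2 (hb j).2⟩

theorem adjPairs_comap (G : SimpleGraph V) (Y : Finset V) :
    adjPairs (G.comap (Subtype.val : {x // x ∈ Y} → V)) univ = adjPairs G Y := by
  unfold adjPairs
  refine card_bij (fun p _ => (p.1.1, p.2.1)) ?_ ?_ ?_
  · intro p hp
    simpa using hp
  · intro p _ p' _ heq
    simp only [Prod.mk.injEq] at heq
    exact Prod.ext (Subtype.ext heq.1) (Subtype.ext heq.2)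
  · rintro ⟨x, y⟩ hxy
    simp only [mem_filter, mem_product] at hxy
    exact ⟨(⟨x, hxy.1.1⟩, ⟨y, hxy.1.2⟩), by simpa using hxy.2, rfl⟩

theorem exists_balTK_of_comap {G : SimpleGraph V} {Y : Finset V} {h : ℕ}
    (H : ∃ ℓ, BalTK (G.comap (Subtype.val : {x // x ∈ Y} → V)) h ℓ) : ∃ ℓ, BalTK G h ℓ := by
  obtain ⟨ℓ, H⟩ := H
  exact ⟨ℓ, H.map ⟨Subtype.val, fun h => h⟩ Subtype.val_injective⟩

end Dense

section Thomassen
open scoped Classical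
set_option linter.unusedSectionVars false
variable {V : Type} [Fintype V]

/-- The number of adjacent pairs in `A × B`. -/
noncomputable def cross (G : SimpleGraph V) (A B : Finset V) : ℕ :=
  ∑ v ∈ A, (B.filter fun y => G.Adj v y).card

theorem cross_comm (G : SimpleGraph V) (A B : Finset V) : cross G A B = cross G B A := by
  unfold cross
  simp only [card_filter]
  rw [sum_comm]
  simp only [G.adj_comm]

theorem adjPairs_union (G : SimpleGraph V) {A B : Finset V} (h : Disjoint A B) :
    adjPairs G (A ∪ B) = adjPairs G A + adjPairs G B + 2 * cross G A B := by
  have h1 : ∀ v, ((A ∪ B).filter fun y => G.Adj v y).card =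
      (A.filter fun y => G.Adj v y).card + (B.filter fun y => G.Adj v y).card := by
    intro v
    rw [filter_union, card_union_of_disjoint (disjoint_filter_filter h)]
  have h2 := cross_comm G A B
  simp only [adjPairs_eq_sum, cross] at h2 ⊢
  rw [sum_union h]
  simp only [h1, sum_add_distrib]
  omega

theorem exists_balTK_of_bounded_degree (h : ℕ) (hh : 2 ≤ h) : ∃ f₀ : ℕ, ∀ f : ℕ, f₀ ≤ f →
    ∀ (V : Type) [Fintype V] (G : SimpleGraph V) (A : Finset V), A.Nonempty →
      f * A.card ≤ 2 * adjPairs G A →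
      (∀ a ∈ A, (univ.filter fun y => G.Adj a y).card < f ^ 10) → ∃ ℓ, BalTK G h ℓ := by
  obtain ⟨δ₀, hδ₀, hmain⟩ := exists_balTK_of_expander h hh
  refine ⟨⌈8 * δ₀⌉₊, fun f hf V _ G A hA hd hdeg => ?_⟩
  have hf' : 8 * δ₀ ≤ f := Nat.ceil_le.1 hf
  have hAne : Nonempty {x // x ∈ A} := ⟨⟨_, hA.choose_spec⟩⟩
  apply exists_balTK_of_comap (Y := A)
  set G₁ := G.comap (Subtype.val : {x // x ∈ A} → V) with hG₁
  obtain ⟨S, hS, hmin, hexp⟩ := exists_expander G₁ ((f : ℝ) / 2) (by linarith) (by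
    rw [hG₁, adjPairs_comap, Fintype.card_coe]
    have : ((f * A.card : ℕ) : ℝ) ≤ ((2 * adjPairs G A : ℕ) : ℝ) := by exact_mod_cast hd
    push_cast at this
    linarith)
  apply exists_balTK_of_comap (Y := S)
  have hSne : Nonempty {x // x ∈ S} := ⟨⟨_, hS.choose_spec⟩⟩
  have hf1 : 1 ≤ f ^ 10 := Nat.one_le_pow _ _ (by
    have : (0 : ℝ) < f := by linarith
    exact_mod_cast this)
  refine hmain _ _ ((f : ℝ) / 8) (f ^ 10 - 1) (by linarith) hexp (fun v => ?_) (fun v => ?_) ?_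
  · refine le_trans (by linarith : (f : ℝ) / 8 ≤ f / 2 / 4) ?_
    exact le_of_le_of_eq (hmin v) (by congr!)
  · have h1 := hdeg v.1.1 v.1.2
    have h2 : (univ.filter fun y : {x // x ∈ S} =>
        (G₁.comap (Subtype.val : {x // x ∈ S} → _)).Adj v y).card ≤
        (univ.filter fun y => G.Adj v.1.1 y).card := by
      refine card_le_card_of_injOn (fun y => y.1.1) ?_ ?_
      · intro y hy
        simp only [coe_filter, mem_univ, true_and, Set.mem_ofPred_eq] at hy ⊢
        exact hy
      · intro y _ y' _ hyy
        exact Subtype.ext (Subtype.ext hyy)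
    exact Nat.le_sub_one_of_lt (lt_of_le_of_lt (le_of_eq_of_le (by congr!) h2) h1)
  · rw [Nat.cast_sub hf1]
    push_cast
    ring_nf
    exact le_rfl

/-- Every graph of large enough average degree contains a balanced subdivision of `K_h`. -/
theorem exists_balTK_of_dense (h : ℕ) (hh : 2 ≤ h) : ∃ f : ℕ, 1 ≤ f ∧
    ∀ (n : ℕ) (V : Type) [Fintype V] [Nonempty V] (G : SimpleGraph V), Fintype.card V ≤ n →
      f * Fintype.card V ≤ adjPairs G univ → ∃ ℓ, BalTK G h ℓ := by
  obtain ⟨f₀, hf₀⟩ := exists_balTK_of_bounded_degree h hh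
  obtain ⟨f, hf⟩ : ∃ f, f = f₀ + 16 * h + 64 := ⟨_, rfl⟩
  refine ⟨f, by omega, fun n => ?_⟩
  induction n using Nat.strong_induction_on with | _ N ih =>
  intro V _ _ G hN hdense
  by_cases hsub : ∃ Y : Finset V, Y ≠ univ ∧ Y.Nonempty ∧ f * Y.card ≤ adjPairs G Y
  · obtain ⟨Y, hY, hYne, hYd⟩ := hsub
    have hlt : Y.card < Fintype.card V := by
      rw [← card_univ]; exact card_lt_card (ssubset_univ_iff.2 hY)
    apply exists_balTK_of_comap (Y := Y)
    have : Nonempty {x // x ∈ Y} := ⟨⟨_, hYne.choose_spec⟩⟩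
    exact ih Y.card (by omega) _ _ (by rw [Fintype.card_coe])
      (by rw [Fintype.card_coe, adjPairs_comap]; exact hYd)
  have hsparse : ∀ Y : Finset V, Y ≠ univ → adjPairs G Y ≤ f * Y.card := by
    intro Y hY
    rcases Y.eq_empty_or_nonempty with rfl | hYne
    · simp [adjPairs]
    · by_contra hcon
      exact hsub ⟨Y, hY, hYne, by omega⟩
  set n := Fintype.card V with hn
  have hn0 : 0 < n := Fintype.card_pos
  have had : adjPairs G univ ≤ 2 * f * n := by
    obtain ⟨v⟩ := ‹Nonempty V›
    have h1 := adjPairs_le_erase G (mem_univ v)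
    have h2 := hsparse (univ.erase v) (by
      intro h
      have := mem_univ v
      rw [← h] at this
      exact notMem_erase v univ this)
    have h3 : (univ.filter fun y => G.Adj v y).card ≤ n := card_le_univ _
    have h4 : (univ.erase v).card ≤ n := card_le_univ _
    have h5 : f * (univ.erase v).card ≤ f * n := Nat.mul_le_mul_left _ h4
    have h6 : 2 * n ≤ f * n := Nat.mul_le_mul_right _ (by omega)
    have h7 : 2 * f * n = f * n + f * n := by ring
    omega
  set H := univ.filter fun v : V => f ^ 10 ≤ (univ.filter fun y => G.Adj v y).card with hH
  set A := univ \ H with hA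
  have hHA : Disjoint H A := disjoint_sdiff
  have hHn : H.card * f ^ 9 ≤ 2 * n := by
    have h1 : H.card * f ^ 10 ≤ adjPairs G univ := by
      rw [adjPairs_eq_sum, ← smul_eq_mul, ← sum_const]
      refine le_trans (sum_le_sum fun v hv => ?_) (sum_le_sum_of_subset (subset_univ H))
      exact (mem_filter.1 hv).2
    have h2 : H.card * f ^ 9 * f ≤ 2 * n * f := by
      calc _ = H.card * f ^ 10 := by ring
        _ ≤ _ := h1.trans had
        _ = _ := by ring
    exact Nat.le_of_mul_le_mul_right h2 (by omega)
  have hHn' : 64 * (f * H.card) ≤ n := by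
    have h1 : 2 * 64 * f ≤ f ^ 9 := by
      calc 2 * 64 * f ≤ f ^ 8 * f := by
            apply Nat.mul_le_mul_right
            calc 2 * 64 ≤ 64 ^ 8 := by norm_num
              _ ≤ _ := Nat.pow_le_pow_left (by omega) 8
        _ = _ := by ring
    have h2 := Nat.mul_le_mul_left H.card h1
    have h3 : H.card * (2 * 64 * f) = 2 * (64 * (f * H.card)) := by ring
    omega
  have hH64 : 64 * H.card ≤ n := by
    have : H.card ≤ f * H.card := Nat.le_mul_of_pos_left _ (by omega)
    omega
  have hHuniv : H ≠ univ := by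
    intro h
    rw [h, card_univ] at hH64
    omega
  by_cases hAd : f * n ≤ 2 * adjPairs G A
  · refine hf₀ f (by omega) V G A ?_ ?_ ?_
    · rw [nonempty_iff_ne_empty]
      intro h
      rw [h] at hAd
      have : 0 < f * n := Nat.mul_pos (by omega) hn0
      simp [adjPairs] at hAd
      omega
    · exact le_trans (Nat.mul_le_mul_left _ (card_le_univ _)) hAd
    · intro a ha
      have : a ∉ H := (mem_sdiff.1 ha).2
      simpa [hH] using this
  · push Not at hAd
    have hUA : H ∪ A = univ := union_sdiff_of_subset (subset_univ H)
    have hcross : f * n ≤ 8 * cross G A H := by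
      have h1 := adjPairs_union G hHA
      rw [hUA, cross_comm] at h1
      have h2 := hsparse H hHuniv
      have h3 : n ≤ f * n := Nat.le_mul_of_pos_left _ (by omega)
      omega
    set B := A.filter fun a => h ≤ (H.filter fun x => G.Adj x a).card with hB
    have hBcross : cross G A H ≤ cross G B H + h * n := by
      unfold cross
      rw [← sum_filter_add_sum_filter_not A
        (fun a => h ≤ (H.filter fun x => G.Adj x a).card)]
      apply Nat.add_le_add_left
      calc _ ≤ ∑ a ∈ A.filter (fun a => ¬ h ≤ (H.filter fun x => G.Adj x a).card), h := by
            refine sum_le_sum fun a ha => ?_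
            have := (mem_filter.1 ha).2
            simp only [G.adj_comm a]
            omega
        _ = (A.filter (fun a => ¬ h ≤ (H.filter fun x => G.Adj x a).card)).card * h := by
            rw [sum_const, smul_eq_mul]
        _ ≤ h * n := by
            rw [mul_comm]; exact Nat.mul_le_mul_left _ (card_le_univ _)
    have hHB : Disjoint H B := disjoint_of_subset_right (filter_subset _ _) hHA
    have hBn : n ≤ 16 * B.card := by
      by_cases hY : H ∪ B = univ
      · have := card_union_of_disjoint hHB
        rw [hY, card_univ] at this
        omega
      · have h1 := hsparse _ hY
        rw [adjPairs_union G hHB, cross_comm, card_union_of_disjoint hHB] at h1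
        have h2 : 16 * (h * n) ≤ f * n := by
          rw [← mul_assoc]; exact Nat.mul_le_mul_right _ (by omega)
        have h3 : f * n ≤ f * (16 * B.card) := by
          have h4 : f * (H.card + B.card) = f * H.card + f * B.card := by ring
          have h5 : f * (16 * B.card) = 16 * (f * B.card) := by ring
          have h6 : 64 * (f * H.card) ≤ f * n := hHn'.trans (Nat.le_mul_of_pos_left _ (by omega))
          omega
        exact Nat.le_of_mul_le_mul_left h3 (by omega)
    obtain ⟨J, hJ1, hJ2⟩ := exists_subdivided_graph G H B hHB h fun a ha => (mem_filter.1 ha).2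
    suffices ∃ ℓ, BalTK J h ℓ by
      obtain ⟨ℓ, hℓ⟩ := this
      exact ⟨_, hJ1 ℓ hℓ⟩
    rcases hJ2 with hJ2 | hJ2
    · exact hJ2
    · have hBne : 0 < B.card := by omega
      obtain ⟨a, ha⟩ := card_pos.1 hBne
      have hHne : 0 < H.card :=
        lt_of_lt_of_le (by omega) ((mem_filter.1 ha).2.trans (card_le_card (filter_subset _ _)))
      have : Nonempty {x // x ∈ H} := ⟨⟨_, (card_pos.1 hHne).choose_spec⟩⟩
      refine ih H.card (by omega) _ J (by rw [Fintype.card_coe]) ?_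
      rw [Fintype.card_coe]
      omega

end Thomassen

section InducedSubdivision
variable {V W : Type}

/-- An induced copy in `G` of the graph obtained from `Γ` by subdividing every edge once: `φ` places
the vertices and `μ` the subdivision vertices. -/
structure IsInducedSubdiv (Γ : SimpleGraph W) (G : SimpleGraph V) (φ : W → V) (μ : Sym2 W → V) :
    Prop where
  inj : Function.Injective φ
  not_adj_branch : ∀ w w', ¬ G.Adj (φ w) (φ w')
  adj_iff : ∀ e ∈ Γ.edgeSet, ∀ w, G.Adj (μ e) (φ w) ↔ w ∈ e
  not_adj_subdiv : ∀ e ∈ Γ.edgeSet, ∀ e' ∈ Γ.edgeSet, ¬ G.Adj (μ e) (μ e')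

variable {Γ : SimpleGraph W} {G : SimpleGraph V} {φ : W → V} {μ : Sym2 W → V}

theorem IsInducedSubdiv.subdiv_inj (H : IsInducedSubdiv Γ G φ μ) {e e' : Sym2 W}
    (he : e ∈ Γ.edgeSet) (he' : e' ∈ Γ.edgeSet) (h : μ e = μ e') : e = e' := by
  ext w
  rw [← H.adj_iff e he, ← H.adj_iff e' he', h]

theorem IsInducedSubdiv.subdiv_ne (H : IsInducedSubdiv Γ G φ μ) {e : Sym2 W}
    (he : e ∈ Γ.edgeSet) (w : W) : μ e ≠ φ w := by
  intro h
  induction e with | _ x y =>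
  have := (H.adj_iff _ he x).2 (Sym2.mem_mk_left x y)
  rw [h] at this
  exact H.not_adj_branch _ _ this

/-- A family of vertex sequences realising a balanced subdivision of `K_h` in `Γ`. -/
structure PathFamily (Γ : SimpleGraph W) (h ℓ : ℕ) (b : Fin h → W)
    (q : {p : Fin h × Fin h // p.1 < p.2} → ℕ → W) : Prop where
  inj : Function.Injective b
  zero : ∀ e, q e 0 = b e.1.1
  last : ∀ e, q e ℓ = b e.1.2
  inj_path : ∀ e k k', k ≤ ℓ → k' ≤ ℓ → q e k = q e k' → k = k'
  adj : ∀ e k, k < ℓ → Γ.Adj (q e k) (q e (k + 1))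
  branch : ∀ e k u, k ≤ ℓ → q e k = b u → u = e.1.1 ∧ k = 0 ∨ u = e.1.2 ∧ k = ℓ
  cross : ∀ e e' k k', e ≠ e' → k ≤ ℓ → k' ≤ ℓ → q e k = q e' k' → ∃ u, q e k = b u

theorem BalTK.exists_pathFamily {h ℓ : ℕ} (H : BalTK Γ h ℓ) :
    ∃ b q, PathFamily Γ h ℓ b q := by
  obtain ⟨b, P, hb, h1, h2, h3⟩ := H
  refine ⟨b, fun e k => (P e.1.1 e.1.2 e.2).getVert k, hb, ?_, ?_, ?_, ?_, ?_, ?_⟩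
  · intro e
    simp
  · intro e
    have := (P e.1.1 e.1.2 e.2).getVert_length
    rwa [(h1 _ _ e.2).2] at this
  · intro e k k' hk hk' hkk
    have hl := (h1 _ _ e.2).2
    exact (h1 _ _ e.2).1.getVert_injOn (by simpa [hl] using hk) (by simpa [hl] using hk') hkk
  · intro e k hk
    exact (P e.1.1 e.1.2 e.2).adj_getVert_succ (by rw [(h1 _ _ e.2).2]; exact hk)
  · intro e k u hk hku
    have hl := (h1 _ _ e.2).2
    have hmem : b u ∈ (P e.1.1 e.1.2 e.2).support := by
      rw [← hku]
      exact SimpleGraph.Walk.getVert_mem_support _ _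
    rcases h2 _ _ e.2 u hmem with rfl | rfl
    · left
      refine ⟨rfl, (h1 _ _ e.2).1.getVert_injOn (by simpa [hl] using hk) (by simp) ?_⟩
      simpa using hku
    · right
      refine ⟨rfl, (h1 _ _ e.2).1.getVert_injOn (by simpa [hl] using hk) (by simp [hl]) ?_⟩
      rw [hku]
      have := (P e.1.1 e.1.2 e.2).getVert_length
      rw [hl] at this
      exact this.symm
  · intro e e' k k' hne _ _ heq
    refine h3 _ _ e.2 _ _ e'.2 (fun h => hne (Subtype.ext h)) _
      (SimpleGraph.Walk.getVert_mem_support _ _) ?_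
    have heq' : (P e.1.1 e.1.2 e.2).getVert k = (P e'.1.1 e'.1.2 e'.2).getVert k' := heq
    rw [heq']
    exact SimpleGraph.Walk.getVert_mem_support _ _

namespace PathFamily
variable {h ℓ : ℕ} {b : Fin h → W} {q : {p : Fin h × Fin h // p.1 < p.2} → ℕ → W}

theorem end_of_cross (H : PathFamily Γ h ℓ b q) {e e' : {p : Fin h × Fin h // p.1 < p.2}}
    {k k' : ℕ} (hne : e ≠ e') (hk : k ≤ ℓ) (hk' : k' ≤ ℓ) (heq : q e k = q e' k') :
    k = 0 ∨ k = ℓ := by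
  obtain ⟨u, hu⟩ := H.cross e e' k k' hne hk hk' heq
  rcases H.branch e k u hk hu with h | h
  exacts [Or.inl h.2, Or.inr h.2]

theorem edge_inj (H : PathFamily Γ h ℓ b q) {e e' : {p : Fin h × Fin h // p.1 < p.2}}
    {k k' : ℕ} (hk : k < ℓ) (hk' : k' < ℓ)
    (heq : s(q e k, q e (k + 1)) = s(q e' k', q e' (k' + 1))) : e = e' ∧ k = k' := by
  rw [Sym2.eq_iff] at heq
  by_cases hee : e = e'
  · subst hee
    refine ⟨rfl, ?_⟩
    rcases heq with ⟨h1, -⟩ | ⟨h1, h2⟩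
    · exact H.inj_path e k k' hk.le hk'.le h1
    · have := H.inj_path e k (k' + 1) hk.le hk' h1
      have := H.inj_path e (k + 1) k' hk hk'.le h2
      omega
  · exfalso
    have hends : ∃ u v, q e k = b u ∧ q e (k + 1) = b v := by
      rcases heq with ⟨h1, h2⟩ | ⟨h1, h2⟩
      · obtain ⟨u, hu⟩ := H.cross e e' _ _ hee hk.le hk'.le h1
        obtain ⟨v, hv⟩ := H.cross e e' _ _ hee hk hk' h2
        exact ⟨u, v, hu, hv⟩
      · obtain ⟨u, hu⟩ := H.cross e e' _ _ hee hk.le hk' h1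
        obtain ⟨v, hv⟩ := H.cross e e' _ _ hee hk hk'.le h2
        exact ⟨u, v, hu, hv⟩
    obtain ⟨u, v, hu, hv⟩ := hends
    have eu := H.branch e k u hk.le hu
    have ev := H.branch e (k + 1) v hk hv
    have huv : u = e.1.1 ∧ v = e.1.2 := by
      refine ⟨?_, ?_⟩
      · rcases eu with h | h
        · exact h.1
        · omega
      · rcases ev with h | h
        · omega
        · exact h.1
    rcases heq with ⟨h1, h2⟩ | ⟨h1, h2⟩
    · have eu' := H.branch e' k' u hk'.le (h1 ▸ hu)
      have ev' := H.branch e' (k' + 1) v hk' (h2 ▸ hv)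
      apply hee
      apply Subtype.ext
      apply Prod.ext
      · rw [← huv.1]
        rcases eu' with h | h
        · exact h.1
        · omega
      · rw [← huv.2]
        rcases ev' with h | h
        · omega
        · exact h.1
    · have eu' := H.branch e' (k' + 1) u hk' (h1 ▸ hu)
      have ev' := H.branch e' k' v hk'.le (h2 ▸ hv)
      have h3 : u = e'.1.2 := by
        rcases eu' with h | h
        · omega
        · exact h.1
      have h4 : v = e'.1.1 := by
        rcases ev' with h | h
        · exact h.1
        · omega
      have h5 := e.2
      have h6 := e'.2
      rw [← huv.1, ← huv.2] at h5
      rw [← h3, ← h4] at h6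
      exact absurd h5 (not_lt.2 h6.le)

/-- The embedding of the subdivided path family. -/
def place (b : Fin h → W) (q : {p : Fin h × Fin h // p.1 < p.2} → ℕ → W) (φ : W → V)
    (μ : Sym2 W → V) :
    Fin h ⊕ ({p : Fin h × Fin h // p.1 < p.2} × Fin (2 * ℓ - 1)) → V
  | Sum.inl u => φ (b u)
  | Sum.inr (e, i) => if (i : ℕ) % 2 = 0 then μ s(q e (i / 2), q e (i / 2 + 1))
      else φ (q e ((i + 1) / 2))

theorem place_injective (H : PathFamily Γ h ℓ b q) (S : IsInducedSubdiv Γ G φ μ) :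
    Function.Injective (place (ℓ := ℓ) b q φ μ) := by
  have hedge : ∀ e (i : Fin (2 * ℓ - 1)), (i : ℕ) % 2 = 0 →
      s(q e (i / 2), q e (i / 2 + 1)) ∈ Γ.edgeSet := fun e i hi =>
    H.adj e _ (by have := i.2; omega)
  have hbr : ∀ u e (i : Fin (2 * ℓ - 1)), b u ≠ q e ((i + 1) / 2) ∨ (i : ℕ) % 2 = 0 := by
    intro u e i
    by_contra! hcon
    have := i.2
    rcases H.branch e _ u (by omega) hcon.1.symm with h | h <;> omega
  rintro (u | ⟨e, i⟩) (v | ⟨e', j⟩) huv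
  · exact congrArg _ (H.inj (S.inj huv))
  · simp only [place] at huv
    split_ifs at huv with hj
    · exact absurd huv.symm (S.subdiv_ne (hedge e' j hj) _)
    · rcases hbr u e' j with h | h
      · exact absurd (S.inj huv) h
      · exact absurd h hj
  · simp only [place] at huv
    split_ifs at huv with hj
    · exact absurd huv (S.subdiv_ne (hedge e i hj) _)
    · rcases hbr v e i with h | h
      · exact absurd (S.inj huv).symm h
      · exact absurd h hj
  · have hi2 := i.2
    have hj2 := j.2
    simp only [place] at huv
    split_ifs at huv with hi hj hj
    · obtain ⟨rfl, hk⟩ := H.edge_inj (by omega) (by omega)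
        (S.subdiv_inj (hedge e i hi) (hedge e' j hj) huv)
      have : i = j := Fin.ext (by omega)
      rw [this]
    · exact absurd huv (S.subdiv_ne (hedge e i hi) _)
    · exact absurd huv.symm (S.subdiv_ne (hedge e' j hj) _)
    · have h1 := S.inj huv
      by_cases hee : e = e'
      · subst hee
        have := H.inj_path e _ _ (by omega) (by omega) h1
        have : i = j := Fin.ext (by omega)
        rw [this]
      · rcases H.end_of_cross hee (by omega) (by omega) h1 with h | h <;> omega

theorem adj_place_branch (H : PathFamily Γ h ℓ b q) (S : IsInducedSubdiv Γ G φ μ) (u : Fin h)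
    (e : {p : Fin h × Fin h // p.1 < p.2}) (i : Fin (2 * ℓ - 1)) :
    G.Adj (place (ℓ := ℓ) b q φ μ (Sum.inr (e, i))) (place (ℓ := ℓ) b q φ μ (Sum.inl u)) ↔
      (u = e.1.1 ∧ (i : ℕ) = 0) ∨ (u = e.1.2 ∧ (i : ℕ) = 2 * ℓ - 2) := by
  have hi2 := i.2
  simp only [place]
  split_ifs with hi
  · rw [S.adj_iff _ (H.adj e _ (by omega)), Sym2.mem_iff]
    constructor
    · rintro (h | h)
      · rcases H.branch e _ u (by omega) h.symm with h | h
        · exact Or.inl ⟨h.1, by omega⟩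
        · omega
      · rcases H.branch e _ u (by omega) h.symm with h | h
        · omega
        · exact Or.inr ⟨h.1, by omega⟩
    · rintro (⟨rfl, h⟩ | ⟨rfl, h⟩)
      · left
        rw [h]
        exact (H.zero e).symm
      · right
        rw [show (i : ℕ) / 2 + 1 = ℓ by omega]
        exact (H.last e).symm
  · constructor
    · intro hadj
      exact absurd hadj (S.not_adj_branch _ _)
    · rintro (⟨-, h⟩ | ⟨-, h⟩) <;> omega

theorem adj_place_inner (H : PathFamily Γ h ℓ b q) (S : IsInducedSubdiv Γ G φ μ)
    (e e' : {p : Fin h × Fin h // p.1 < p.2}) (i j : Fin (2 * ℓ - 1))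
    (hi : (i : ℕ) % 2 = 0) (hj : (j : ℕ) % 2 ≠ 0) :
    G.Adj (place (ℓ := ℓ) b q φ μ (Sum.inr (e, i))) (place (ℓ := ℓ) b q φ μ (Sum.inr (e', j))) ↔
      e = e' ∧ ((j : ℕ) = i + 1 ∨ (i : ℕ) = j + 1) := by
  have hi2 := i.2
  have hj2 := j.2
  simp only [place, if_pos hi, if_neg hj]
  rw [S.adj_iff _ (H.adj e _ (by omega)), Sym2.mem_iff]
  constructor
  · intro hq
    by_cases hee : e = e'
    · subst hee
      refine ⟨rfl, ?_⟩
      rcases hq with h | h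
      · have := H.inj_path e _ _ (by omega) (by omega) h
        omega
      · have := H.inj_path e _ _ (by omega) (by omega) h
        omega
    · exfalso
      rcases hq with h | h
      · rcases H.end_of_cross (Ne.symm hee) (by omega) (by omega) h with h | h <;> omega
      · rcases H.end_of_cross (Ne.symm hee) (by omega) (by omega) h with h | h <;> omega
  · rintro ⟨rfl, h | h⟩
    · right
      congr 1
      omega
    · left
      congr 1
      omega

end PathFamily

theorem IsInducedSubdiv.hasInducedBalancedSubdivision {h ℓ : ℕ} (hh : 2 ≤ h)
    (S : IsInducedSubdiv Γ G φ μ) (T : BalTK Γ h ℓ) : HasInducedBalancedSubdivision G h := by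
  obtain ⟨b, q, H⟩ := T.exists_pathFamily
  have hℓ : 1 ≤ ℓ := by
    by_contra hcon
    have hℓ0 : ℓ = 0 := by omega
    have h1 := H.zero ⟨(⟨0, by omega⟩, ⟨1, by omega⟩), by simp⟩
    have h2 := H.last ⟨(⟨0, by omega⟩, ⟨1, by omega⟩), by simp⟩
    rw [hℓ0, h1] at h2
    have := H.inj h2
    simp at this
  refine ⟨2 * ℓ, by omega, ⟨⟨PathFamily.place b q φ μ, H.place_injective S⟩, ?_⟩⟩
  have hsub : ∀ e (i : Fin (2 * ℓ - 1)), (i : ℕ) % 2 = 0 →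
      s(q e (i / 2), q e (i / 2 + 1)) ∈ Γ.edgeSet := fun e i hi =>
    H.adj e _ (by have := i.2; omega)
  intro x y
  change G.Adj (PathFamily.place b q φ μ x) (PathFamily.place b q φ μ y) ↔ _
  rcases x with u | ⟨e, i⟩ <;> rcases y with v | ⟨e', j⟩
  · simp only [balancedSubdivision, SimpleGraph.fromRel_adj, or_self, and_false, iff_false]
    exact S.not_adj_branch _ _
  · rw [SimpleGraph.adj_comm, H.adj_place_branch S]
    simp [balancedSubdivision, SimpleGraph.fromRel_adj]
  · rw [H.adj_place_branch S]
    simp [balancedSubdivision, SimpleGraph.fromRel_adj]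
  · simp only [balancedSubdivision, SimpleGraph.fromRel_adj]
    by_cases hi : (i : ℕ) % 2 = 0 <;> by_cases hj : (j : ℕ) % 2 = 0
    · constructor
      · intro hadj
        simp only [PathFamily.place, if_pos hi, if_pos hj] at hadj
        exact absurd hadj (S.not_adj_subdiv _ (hsub e i hi) _ (hsub e' j hj))
      · rintro ⟨-, h | h⟩ <;> omega
    · rw [H.adj_place_inner S e e' i j hi hj]
      constructor
      · rintro ⟨rfl, h⟩
        refine ⟨?_, h.imp (fun h => ⟨rfl, h⟩) (fun h => ⟨rfl, h⟩)⟩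
        intro hcon
        simp only [Sum.inr.injEq, Prod.mk.injEq, true_and] at hcon
        rw [hcon] at hi
        exact hj hi
      · rintro ⟨-, ⟨rfl, h⟩ | ⟨rfl, h⟩⟩
        exacts [⟨rfl, Or.inl h⟩, ⟨rfl, Or.inr h⟩]
    · rw [SimpleGraph.adj_comm, H.adj_place_inner S e' e j i hj hi]
      constructor
      · rintro ⟨rfl, h⟩
        refine ⟨?_, h.symm.imp (fun h => ⟨rfl, h⟩) (fun h => ⟨rfl, h⟩)⟩
        intro hcon
        simp only [Sum.inr.injEq, Prod.mk.injEq, true_and] at hcon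
        rw [hcon] at hi
        exact hi hj
      · rintro ⟨-, ⟨rfl, h⟩ | ⟨rfl, h⟩⟩
        exacts [⟨rfl, Or.inr h⟩, ⟨rfl, Or.inl h⟩]
    · constructor
      · intro hadj
        simp only [PathFamily.place, if_neg hi, if_neg hj] at hadj
        exact absurd hadj (S.not_adj_branch _ _)
      · rintro ⟨-, h | h⟩ <;> omega

end InducedSubdivision

section LowPairs
set_option linter.unusedSectionVars false
open scoped Classical
variable {V : Type} [Fintype V]

/-- No `s` vertices of `G` have `s` common neighbours. -/
def KssFree (G : SimpleGraph V) (s : ℕ) : Prop :=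
  ∀ A B : Finset V, A.card = s → s ≤ B.card → (∀ a ∈ A, ∀ b ∈ B, G.Adj a b) → False

theorem kssFree_of_not_hasKssSubgraph {G : SimpleGraph V} {s : ℕ} (h : ¬ HasKssSubgraph G s) :
    KssFree G s := by
  intro A B hA hB hAB
  apply h
  obtain ⟨B', hB', hcard⟩ := exists_subset_card_eq hB
  have eA : Fin s ≃ A := (finCongr hA.symm).trans A.equivFin.symm
  have eB : Fin s ≃ B' := (finCongr hcard.symm).trans B'.equivFin.symm
  have key : ∀ i j, G.Adj (eA i) (eB j) := fun i j => hAB _ (eA i).2 _ (hB' (eB j).2)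
  refine ⟨⟨Sum.elim (fun i => (eA i : V)) (fun j => (eB j : V)), ?_⟩, ?_⟩
  · rintro (i | i) (j | j) hij
    · simp at hij
    · exact key i j
    · exact (key j i).symm
    · simp at hij
  · rintro (i | i) (j | j) hij
    · exact congrArg _ (eA.injective (Subtype.ext hij))
    · exact absurd hij (key i j).ne
    · exact absurd hij (key j i).ne'
    · exact congrArg _ (eB.injective (Subtype.ext hij))

variable (G : SimpleGraph V)

/-- The vertices adjacent to almost all of `C`. -/
noncomputable def nearlyComplete (s : ℕ) (C : Finset V) : Finset V :=
  univ.filter fun x => 2 * s * (C.filter fun c => ¬ G.Adj x c).card < C.card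

variable {G}

theorem card_nearlyComplete_lt {s : ℕ} (hG : KssFree G s) (hs : 1 ≤ s) {C : Finset V}
    (hC : 2 * s ≤ C.card) : (nearlyComplete G s C).card < s := by
  by_contra! hcon
  obtain ⟨A, hA, hAc⟩ := exists_subset_card_eq hcon
  refine hG A (C.filter fun c => ∀ a ∈ A, G.Adj a c) hAc ?_ (fun a ha b hb =>
    (mem_filter.1 hb).2 a ha)
  have h1 : C.card ≤ (C.filter fun c => ∀ a ∈ A, G.Adj a c).card +
      ∑ a ∈ A, (C.filter fun c => ¬ G.Adj a c).card := by
    refine le_trans (card_le_card ?_) ((card_union_le _ _).trans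
      (Nat.add_le_add_left (card_biUnion_le (s := A)
        (t := fun a => C.filter fun c => ¬ G.Adj a c)) _))
    intro c hc
    simp only [mem_union, mem_filter, mem_biUnion, hc, true_and]
    by_cases h : ∀ a ∈ A, G.Adj a c
    · exact Or.inl h
    · push Not at h
      exact Or.inr h
  have h2 : 2 * s * ∑ a ∈ A, (C.filter fun c => ¬ G.Adj a c).card ≤ s * C.card := by
    rw [mul_sum, ← hAc, ← smul_eq_mul (a := A.card) (b := C.card)]
    refine sum_le_card_nsmul _ _ _ fun a ha => ?_
    have := (mem_filter.1 (hA ha)).2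
    rw [hAc]
    exact this.le
  have h3 : 2 * s * C.card ≤ 2 * s * (C.filter fun c => ∀ a ∈ A, G.Adj a c).card + s * C.card := by
    calc 2 * s * C.card ≤ 2 * s * _ := Nat.mul_le_mul_left _ h1
      _ ≤ _ := by rw [mul_add]; exact Nat.add_le_add_left h2 _
  have h4 : s * C.card ≤ s * (2 * (C.filter fun c => ∀ a ∈ A, G.Adj a c).card) := by
    nlinarith
  have := Nat.le_of_mul_le_mul_left h4 hs
  omega

theorem le_of_not_mem_nearlyComplete {s : ℕ} {C : Finset V} {x : V}
    (h : x ∉ nearlyComplete G s C) : C.card ≤ 2 * s * (C.filter fun c => ¬ G.Adj x c).card := by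
  simpa [nearlyComplete] using h

/-- A family of large sets has pairwise nonadjacent representatives. -/
theorem exists_nonadjacent_representatives [Nonempty V] {ι : Type} {s : ℕ} (hG : KssFree G s)
    (hs : 1 ≤ s) (E : Finset ι) : ∀ C : ι → Finset V, (∀ e ∈ E, (2 * s) ^ (E.card + 1) ≤ (C e).card) →
      ∃ c : ι → V, (∀ e ∈ E, c e ∈ C e) ∧
        ∀ e ∈ E, ∀ e' ∈ E, e ≠ e' → ¬ G.Adj (c e) (c e') := by
  induction E using Finset.induction_on with
  | empty =>
    intro C _
    exact ⟨fun _ => Classical.arbitrary V, by simp, by simp⟩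
  | insert e₀ E he₀ ih =>
    intro C hC
    rw [card_insert_of_notMem he₀] at hC
    have hbad : (E.biUnion fun e => nearlyComplete G s (C e)).card < (C e₀).card := by
      have h1 : (E.biUnion fun e => nearlyComplete G s (C e)).card ≤ E.card * s := by
        refine card_biUnion_le_card_mul _ _ _ fun e he => (card_nearlyComplete_lt hG hs ?_).le
        refine le_trans ?_ (hC e (mem_insert_of_mem he))
        exact Nat.le_self_pow (by omega) _
      have h2 := hC e₀ (mem_insert_self _ _)
      have h3 : E.card * s < (2 * s) ^ (E.card + 1 + 1) := by
        have h4 : E.card < 2 ^ E.card := Nat.lt_two_pow_self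
        have h5 : 2 ^ E.card ≤ (2 * s) ^ E.card := Nat.pow_le_pow_left (by omega) _
        have h6 : s ≤ 2 * s * (2 * s) := by nlinarith
        calc E.card * s < (2 * s) ^ E.card * s := Nat.mul_lt_mul_of_pos_right (by omega) hs
          _ ≤ (2 * s) ^ E.card * (2 * s * (2 * s)) := Nat.mul_le_mul_left _ h6
          _ = _ := by ring
      omega
    obtain ⟨c₀, hc₀, hc₀'⟩ := exists_mem_notMem_of_card_lt_card hbad
    simp only [mem_biUnion, not_exists, not_and] at hc₀'
    obtain ⟨c, hc, hcc⟩ := ih (fun e => (C e).filter fun v => ¬ G.Adj c₀ v) (by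
      intro e he
      have h1 := le_of_not_mem_nearlyComplete (hc₀' e he)
      have h2 := hC e (mem_insert_of_mem he)
      refine Nat.le_of_mul_le_mul_left (c := 2 * s) (le_trans ?_ h1) (by omega)
      rw [← pow_succ']
      exact h2)
    have hne : ∀ e ∈ E, e ≠ e₀ := fun e he h => he₀ (h ▸ he)
    refine ⟨Function.update c e₀ c₀, ?_, ?_⟩
    · intro e he
      rcases mem_insert.1 he with rfl | he
      · simpa using hc₀
      · rw [Function.update_of_ne (hne e he)]
        exact (mem_filter.1 (hc e he)).1
    · intro e he e' he' hee
      rcases mem_insert.1 he with rfl | he₁ <;> rcases mem_insert.1 he' with rfl | he₁'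
      · exact absurd rfl hee
      · rw [Function.update_self, Function.update_of_ne (hne e' he₁')]
        exact (mem_filter.1 (hc e' he₁')).2
      · rw [Function.update_self, Function.update_of_ne (hne e he₁), SimpleGraph.adj_comm]
        exact (mem_filter.1 (hc e he₁)).2
      · rw [Function.update_of_ne (hne e he₁), Function.update_of_ne (hne e' he₁')]
        exact hcc e he₁ e' he₁' hee

variable (G)

/-- The ordered `h`-tuples of distinct pairwise nonadjacent vertices of `X`. -/
noncomputable def indepTuples (h : ℕ) (X : Finset V) : Finset (Fin h → V) :=
  (Fintype.piFinset fun _ => X).filter fun x => ∀ i j, i ≠ j → x i ≠ x j ∧ ¬ G.Adj (x i) (x j)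

variable {G}

theorem pow_le_card_indepTuples {s : ℕ} (hG : KssFree G s) (hs : 1 ≤ s) {y : ℕ} (hy : 1 ≤ y)
    (h : ℕ) : ∀ X : Finset V, y * (4 * s) ^ h ≤ X.card → y ^ h ≤ (indepTuples G h X).card := by
  induction h with
  | zero =>
    intro X _
    rw [pow_zero, Nat.one_le_iff_ne_zero, ← Nat.pos_iff_ne_zero, card_pos]
    exact ⟨default, by simp [indepTuples]⟩
  | succ h ih =>
    intro X hX
    have hbig : 4 * s * y ≤ X.card := by
      refine le_trans ?_ hX
      have : 1 ≤ (4 * s) ^ h := Nat.one_le_pow _ _ (by omega)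
      rw [pow_succ]
      nlinarith [Nat.zero_le (s * y)]
    have hbig' : 4 * s ≤ X.card := by nlinarith
    have hgood : y ≤ (X \ nearlyComplete G s X).card := by
      have h1 := card_nearlyComplete_lt hG hs (C := X) (by omega)
      have h2 := le_card_sdiff (nearlyComplete G s X) X
      have h3 : s + y ≤ 4 * s * y := by nlinarith
      omega
    set R : V → Finset V := fun x => X.filter fun v => ¬ G.Adj x v ∧ v ≠ x with hR
    have hrest : ∀ x ∈ X \ nearlyComplete G s X, y ^ h ≤ (indepTuples G h (R x)).card := by
      intro x hx
      apply ih
      have h1 := le_of_not_mem_nearlyComplete (mem_sdiff.1 hx).2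
      have h2 : (X.filter fun c => ¬ G.Adj x c).card ≤ (R x).card + 1 := by
        rw [← card_singleton x]
        refine le_trans (card_le_card ?_) (card_union_le _ _)
        intro v hv
        by_cases hvx : v = x
        · simp [hvx]
        · simp only [mem_union, hR, mem_filter] at hv ⊢
          exact Or.inl ⟨hv.1, hv.2, hvx⟩
      refine Nat.le_of_mul_le_mul_left (c := 4 * s) ?_ (by omega)
      calc 4 * s * (y * (4 * s) ^ h) = y * (4 * s) ^ (h + 1) := by ring
        _ ≤ X.card := hX
        _ ≤ 4 * s * (R x).card := by nlinarith
    calc y ^ (h + 1) = y * y ^ h := pow_succ' _ _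
      _ ≤ (X \ nearlyComplete G s X).card * y ^ h := Nat.mul_le_mul_right _ hgood
      _ = ∑ x ∈ X \ nearlyComplete G s X, y ^ h := by rw [sum_const, smul_eq_mul]
      _ ≤ ∑ x ∈ X \ nearlyComplete G s X, (indepTuples G h (R x)).card := sum_le_sum hrest
      _ = ((X \ nearlyComplete G s X).sigma fun x => indepTuples G h (R x)).card :=
        (card_sigma _ _).symm
      _ ≤ (indepTuples G (h + 1) X).card := by
        refine card_le_card_of_injOn (fun p => Fin.cons p.1 p.2) ?_ ?_
        · rintro ⟨x, t⟩ hp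
          simp only [coe_sigma, Set.mem_sigma_iff, mem_coe] at hp
          obtain ⟨hx, ht⟩ := hp
          simp only [indepTuples, mem_filter, Fintype.mem_piFinset, hR, coe_filter,
            Set.mem_ofPred_eq] at ht ⊢
          refine ⟨?_, ?_⟩
          · intro i
            refine Fin.cases ?_ (fun i => ?_) i
            · exact (mem_sdiff.1 hx).1
            · exact (ht.1 i).1
          · intro i j
            refine Fin.cases ?_ (fun i => ?_) i <;> refine Fin.cases ?_ (fun j => ?_) j
            · intro hij
              exact absurd rfl hij
            · intro _
              exact ⟨(ht.1 j).2.2.symm, (ht.1 j).2.1⟩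
            · intro _
              exact ⟨(ht.1 i).2.2, fun hadj => (ht.1 i).2.1 hadj.symm⟩
            · intro hij
              exact ht.2 i j fun h => hij (congrArg _ h)
        · rintro ⟨x, t⟩ _ ⟨x', t'⟩ _ heq
          obtain ⟨h1, h2⟩ := Fin.cons_injective2 heq
          subst h1 h2
          rfl

end LowPairs

section LowPairCount
set_option linter.unusedSectionVars false
open scoped Classical
variable {V : Type} [Fintype V]

theorem card_tuples_update_le {h : ℕ} (X : Finset V) (P : (Fin h → V) → Prop) [DecidablePred P]
    (k : Fin h) (m : ℕ)
    (hm : ∀ x, (X.filter fun v => P (Function.update x k v)).card ≤ m) :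
    X.card * ((Fintype.piFinset fun _ : Fin h => X).filter P).card ≤ m * X.card ^ h := by
  calc X.card * ((Fintype.piFinset fun _ : Fin h => X).filter P).card
      = (((Fintype.piFinset fun _ : Fin h => X).filter P) ×ˢ X).card := by
        rw [card_product, mul_comm]
    _ ≤ ((Fintype.piFinset fun _ : Fin h => X).sigma
        fun x => X.filter fun v => P (Function.update x k v)).card := by
        refine card_le_card_of_injOn (fun p => ⟨Function.update p.1 k p.2, p.1 k⟩) ?_ ?_
        · rintro ⟨x, v⟩ hp
          simp only [mem_coe, mem_product, mem_filter, Fintype.mem_piFinset] at hp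
          simp only [coe_sigma, Set.mem_sigma_iff, mem_coe, mem_filter, Fintype.mem_piFinset,
            Function.update_idem, Function.update_eq_self]
          refine ⟨fun i => ?_, hp.1.1 k, hp.1.2⟩
          by_cases hi : i = k
          · subst hi
            simpa using hp.2
          · simpa [hi] using hp.1.1 i
        · rintro ⟨x, v⟩ _ ⟨x', v'⟩ _ heq
          simp only [Sigma.mk.injEq, heq_eq_eq] at heq
          have hv : v = v' := by simpa using congrFun heq.1 k
          have hx : x = x' := by
            funext i
            by_cases hi : i = k
            · subst hi
              exact heq.2
            · simpa [hi] using congrFun heq.1 i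
          rw [hv, hx]
    _ = ∑ x ∈ Fintype.piFinset fun _ : Fin h => X,
        (X.filter fun v => P (Function.update x k v)).card := card_sigma _ _
    _ ≤ (Fintype.piFinset fun _ : Fin h => X).card • m := sum_le_card_nsmul _ _ _ fun x _ => hm x
    _ = m * X.card ^ h := by
        rw [Fintype.card_piFinset_const, smul_eq_mul, mul_comm]

theorem card_tuples_pair_le {h : ℕ} (X : Finset V) (L : V → V → Prop) {a b : Fin h} (hab : a ≠ b) :
    X.card ^ 2 * ((Fintype.piFinset fun _ : Fin h => X).filter fun x => L (x a) (x b)).card ≤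
      ((X ×ˢ X).filter fun p => L p.1 p.2).card * X.card ^ h := by
  calc X.card ^ 2 * ((Fintype.piFinset fun _ : Fin h => X).filter fun x => L (x a) (x b)).card
      = (((Fintype.piFinset fun _ : Fin h => X).filter fun x => L (x a) (x b)) ×ˢ
          (X ×ˢ X)).card := by
        rw [card_product, card_product, mul_comm, sq]
    _ ≤ (((X ×ˢ X).filter fun p => L p.1 p.2) ×ˢ (Fintype.piFinset fun _ : Fin h => X)).card := by
        refine card_le_card_of_injOn (fun p => ((p.1 a, p.1 b),
          Function.update (Function.update p.1 a p.2.1) b p.2.2)) ?_ ?_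
        · rintro ⟨x, u, v⟩ hp
          simp only [mem_coe, mem_product, mem_filter, Fintype.mem_piFinset] at hp ⊢
          refine ⟨⟨⟨hp.1.1 a, hp.1.1 b⟩, hp.1.2⟩, fun i => ?_⟩
          by_cases hb : i = b
          · subst hb
            simpa using hp.2.2
          · by_cases ha : i = a
            · subst ha
              simpa [hb] using hp.2.1
            · simpa [hb, ha] using hp.1.1 i
        · rintro ⟨x, u, v⟩ _ ⟨x', u', v'⟩ _ heq
          simp only [Prod.mk.injEq] at heq
          have hv : v = v' := by simpa using congrFun heq.2 b
          have hu : u = u' := by simpa [hab] using congrFun heq.2 a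
          have hx : x = x' := by
            funext i
            by_cases hb : i = b
            · subst hb
              exact heq.1.2
            · by_cases ha : i = a
              · subst ha
                exact heq.1.1
              · simpa [hb, ha] using congrFun heq.2 i
          rw [hv, hx, hu]
    _ = _ := by rw [card_product, Fintype.card_piFinset_const]

variable (G : SimpleGraph V)

/-- The number of common neighbours. -/
noncomputable def codeg (x y : V) : ℕ := (univ.filter fun c => G.Adj x c ∧ G.Adj y c).card

/-- Distinct nonadjacent vertices with fewer than `T` common neighbours. -/
def IsLow (T : ℕ) (x y : V) : Prop := x ≠ y ∧ ¬ G.Adj x y ∧ codeg G x y < T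

/-- The number of ordered low pairs in `X`. -/
noncomputable def lowCount (T : ℕ) (X : Finset V) : ℕ :=
  ((X ×ˢ X).filter fun p => IsLow G T p.1 p.2).card

/-- Common neighbours of `x a` and `x b` that are nonadjacent to the other `x i` with `i < k`. -/
noncomputable def linkCandidates {h : ℕ} (x : Fin h → V) (a b : Fin h) (k : ℕ) : Finset V :=
  univ.filter fun c => G.Adj (x a) c ∧ G.Adj (x b) c ∧
    ∀ i : Fin h, (i : ℕ) < k → i ≠ a → i ≠ b → ¬ G.Adj (x i) c

variable {G}

theorem pow_le_card_linkCandidates {s h M : ℕ} (hs : 1 ≤ s) {x : Fin h → V} {a b : Fin h}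
    (hcodeg : (2 * s) ^ (h + M + 1) ≤ codeg G (x a) (x b))
    (hgood : ∀ k : Fin h, k ≠ a → k ≠ b → 2 * s ≤ (linkCandidates G x a b k).card →
      x k ∉ nearlyComplete G s (linkCandidates G x a b k)) :
    ∀ k ≤ h, (2 * s) ^ (h - k + M + 1) ≤ (linkCandidates G x a b k).card := by
  intro k
  induction k with
  | zero =>
    intro _
    simpa [linkCandidates, codeg] using hcodeg
  | succ k ih =>
    intro hk
    have h1 := ih (by omega)
    by_cases hkab : (⟨k, hk⟩ : Fin h) = a ∨ (⟨k, hk⟩ : Fin h) = b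
    · have : linkCandidates G x a b (k + 1) = linkCandidates G x a b k := by
        unfold linkCandidates
        congr 1
        ext c
        refine and_congr_right fun _ => and_congr_right fun _ => ⟨fun H i hi => H i (by omega), ?_⟩
        intro H i hi ha hb
        refine H i ?_ ha hb
        rcases Nat.lt_succ_iff_lt_or_eq.1 hi with h | h
        · exact h
        · exfalso
          have : i = ⟨k, hk⟩ := Fin.ext h
          rcases hkab with h | h
          · exact ha (this.trans h)
          · exact hb (this.trans h)
      rw [this]
      refine le_trans (Nat.pow_le_pow_right (by omega) (by omega)) h1
    · push Not at hkab
      have h2 : 2 * s ≤ (linkCandidates G x a b k).card :=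
        le_trans (Nat.le_self_pow (by omega) _) h1
      have h3 := le_of_not_mem_nearlyComplete (hgood ⟨k, hk⟩ hkab.1 hkab.2 h2)
      have : ((linkCandidates G x a b k).filter fun c => ¬ G.Adj (x ⟨k, hk⟩) c) ⊆
          linkCandidates G x a b (k + 1) := by
        intro c hc
        simp only [linkCandidates, mem_filter, mem_univ, true_and] at hc ⊢
        refine ⟨hc.1.1, hc.1.2.1, fun i hi ha hb => ?_⟩
        rcases Nat.lt_succ_iff_lt_or_eq.1 hi with h | h
        · exact hc.1.2.2 i h ha hb
        · have : i = ⟨k, hk⟩ := Fin.ext h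
          rw [this]
          exact hc.2
      refine Nat.le_of_mul_le_mul_left (c := 2 * s) ?_ (by omega)
      calc 2 * s * (2 * s) ^ (h - (k + 1) + M + 1) = (2 * s) ^ (h - k + M + 1) := by
            rw [← pow_succ']
            congr 1
            omega
        _ ≤ (linkCandidates G x a b k).card := h1
        _ ≤ _ := h3
        _ ≤ _ := Nat.mul_le_mul_left _ (card_le_card this)

theorem hasInduced_of_good_tuple {s h : ℕ} (hh : 2 ≤ h) (hG : KssFree G s) (hs : 1 ≤ s)
    {x : Fin h → V} (hx : ∀ i j, i ≠ j → x i ≠ x j ∧ ¬ G.Adj (x i) (x j))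
    (hcodeg : ∀ a b, a ≠ b → (2 * s) ^ (h + h ^ 2 + 1) ≤ codeg G (x a) (x b))
    (hgood : ∀ a b k : Fin h, k ≠ a → k ≠ b → 2 * s ≤ (linkCandidates G x a b k).card →
      x k ∉ nearlyComplete G s (linkCandidates G x a b k)) :
    HasInducedBalancedSubdivision G h := by
  have : Nonempty V := ⟨x ⟨0, by omega⟩⟩
  set E : Finset (Sym2 (Fin h)) := univ.filter fun e => e ∈ (⊤ : SimpleGraph (Fin h)).edgeSet
  have hE : E.card ≤ h ^ 2 := by
    refine (card_le_univ E).trans ?_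
    refine (Fintype.card_le_of_surjective (fun p : Fin h × Fin h => s(p.1, p.2)) ?_).trans ?_
    · intro e
      induction e with | _ a b =>
      exact ⟨(a, b), rfl⟩
    · simp [sq]
  obtain ⟨μ, hμ, hμμ⟩ := exists_nonadjacent_representatives hG hs E
    (fun e => univ.filter fun c => ∀ w, G.Adj c (x w) ↔ w ∈ e) (by
      intro e he
      induction e with | _ a b =>
      have hab : a ≠ b := by simpa [E] using he
      have h1 := pow_le_card_linkCandidates hs (hcodeg a b hab) (hgood a b) h le_rfl
      refine le_trans (Nat.pow_le_pow_right (by omega) (by omega)) (h1.trans (card_le_card ?_))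
      intro c hc
      simp only [linkCandidates, mem_filter, mem_univ, true_and] at hc ⊢
      intro w
      rw [Sym2.mem_iff]
      constructor
      · intro hadj
        by_contra! hcon
        exact hc.2.2 w w.2 hcon.1 hcon.2 hadj.symm
      · rintro (rfl | rfl)
        exacts [hc.1.symm, hc.2.1.symm])
  have hind : IsInducedSubdiv (⊤ : SimpleGraph (Fin h)) G x μ := by
    refine ⟨?_, ?_, ?_, ?_⟩
    · intro i j hij
      by_contra hne
      exact (hx i j hne).1 hij
    · intro i j hadj
      by_cases hij : i = j
      · subst hij
        exact hadj.ne rfl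
      · exact (hx i j hij).2 hadj
    · intro e he w
      have := hμ e (by simpa [E] using he)
      exact (mem_filter.1 this).2 w
    · intro e he e' he' hadj
      by_cases hee : e = e'
      · subst hee
        exact hadj.ne rfl
      · exact hμμ e (by simpa [E] using he) e' (by simpa [E] using he') hee hadj
  exact hind.hasInducedBalancedSubdivision hh
    (BalTK.of_clique id Function.injective_id fun i j hij => by simpa using hij.ne)

theorem sq_card_le_lowCount {s h : ℕ} (hh : 2 ≤ h) (hG : KssFree G s) (hs : 1 ≤ s)
    (hind : ¬ HasInducedBalancedSubdivision G h) {X : Finset V}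
    (hX : 2 * (2 * (4 * s) ^ h) ^ h * h ^ 3 * s ≤ X.card) (hX' : (4 * s) ^ h ≤ X.card) :
    X.card ^ 2 ≤ 2 * (2 * (4 * s) ^ h) ^ h * h ^ 2 *
      lowCount G ((2 * s) ^ (h + h ^ 2 + 1)) X := by
  set T := (2 * s) ^ (h + h ^ 2 + 1) with hT
  set M := (2 * (4 * s) ^ h) ^ h with hM
  set N := X.card with hN
  set Λ := lowCount G T X with hΛ
  have hpos : 1 ≤ (4 * s) ^ h := Nat.one_le_pow _ _ (by omega)
  set y := N / (4 * s) ^ h with hy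
  have hy1 : 1 ≤ y := (Nat.one_le_div_iff hpos).2 hX'
  have hNy : N ≤ 2 * (4 * s) ^ h * y := by
    have := Nat.lt_div_mul_add (a := N) hpos
    nlinarith
  have hNM : N ^ h ≤ M * y ^ h := by
    rw [hM, ← mul_pow]
    exact Nat.pow_le_pow_left hNy _
  have hcount := pow_le_card_indepTuples hG hs hy1 h X (Nat.div_mul_le_self _ _)
  set Bad : Fin h × Fin h × Fin h → Finset (Fin h → V) := fun t =>
    (Fintype.piFinset fun _ : Fin h => X).filter fun x => t.2.2 ≠ t.1 ∧ t.2.2 ≠ t.2.1 ∧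
      2 * s ≤ (linkCandidates G x t.1 t.2.1 t.2.2).card ∧
      x t.2.2 ∈ nearlyComplete G s (linkCandidates G x t.1 t.2.1 t.2.2) with hBad
  set Lw : Fin h × Fin h → Finset (Fin h → V) := fun t =>
    (Fintype.piFinset fun _ : Fin h => X).filter fun x => t.1 ≠ t.2 ∧
      IsLow G T (x t.1) (x t.2) with hLw
  have hcover : indepTuples G h X ⊆ univ.biUnion Bad ∪ univ.biUnion Lw := by
    intro x hx
    simp only [indepTuples, mem_filter] at hx
    by_contra hcon
    simp only [mem_union, mem_biUnion, mem_univ, true_and, not_or, not_exists, hBad, hLw,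
      mem_filter, hx.1, not_and] at hcon
    refine hind (hasInduced_of_good_tuple hh hG hs hx.2 ?_ ?_)
    · intro a b hab
      by_contra! hlt
      exact hcon.2 (a, b) hab ⟨(hx.2 a b hab).1, (hx.2 a b hab).2, hlt⟩
    · intro a b k hka hkb hc
      exact hcon.1 (a, b, k) hka hkb hc
  have hBadc : ∀ t, N * (Bad t).card ≤ s * N ^ h := by
    rintro ⟨a, b, k⟩
    refine card_tuples_update_le X (fun x => k ≠ a ∧ k ≠ b ∧
      2 * s ≤ (linkCandidates G x a b k).card ∧
      x k ∈ nearlyComplete G s (linkCandidates G x a b k)) k s fun x => ?_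
    by_cases hk : k ≠ a ∧ k ≠ b
    · have heq : ∀ v, linkCandidates G (Function.update x k v) a b k =
          linkCandidates G x a b k := by
        intro v
        unfold linkCandidates
        congr 1
        ext c
        rw [Function.update_of_ne hk.1.symm, Function.update_of_ne hk.2.symm]
        refine and_congr_right fun _ => and_congr_right fun _ => forall_congr' fun i =>
          forall_congr' fun hi => ?_
        rw [Function.update_of_ne (by rintro rfl; exact absurd hi (lt_irrefl _))]
      simp only [heq, Function.update_self]
      by_cases hc : 2 * s ≤ (linkCandidates G x a b k).card
      · refine le_trans (card_le_card ?_) (card_nearlyComplete_lt hG hs hc).le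
        intro v hv
        exact (mem_filter.1 hv).2.2.2.2
      · rw [filter_false_of_mem fun v _ hv => hc hv.2.2.1]
        simp
    · rw [filter_false_of_mem fun v _ hv => hk ⟨hv.1, hv.2.1⟩]
      simp
  have hLwc : ∀ t, N ^ 2 * (Lw t).card ≤ Λ * N ^ h := by
    rintro ⟨a, b⟩
    by_cases hab : a = b
    · have : Lw (a, b) = ∅ := filter_false_of_mem fun v _ hv => hv.1 hab
      rw [this]
      simp
    · have : Lw (a, b) = (Fintype.piFinset fun _ : Fin h => X).filter fun x =>
          IsLow G T (x a) (x b) := by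
        refine filter_congr fun x _ => ?_
        exact ⟨fun hv => hv.2, fun hv => ⟨hab, hv⟩⟩
      rw [this]
      exact card_tuples_pair_le X (IsLow G T) hab
  have hN1 : 1 ≤ N := hpos.trans hX'
  have htotal : N ^ 2 * y ^ h ≤ h ^ 3 * (s * N * N ^ h) + h ^ 2 * (Λ * N ^ h) := by
    calc N ^ 2 * y ^ h ≤ N ^ 2 * ((∑ t, (Bad t).card) + ∑ t, (Lw t).card) :=
          Nat.mul_le_mul_left _ (hcount.trans ((card_le_card hcover).trans
            ((card_union_le _ _).trans (Nat.add_le_add card_biUnion_le card_biUnion_le))))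
      _ = (∑ t, N * (N * (Bad t).card)) + ∑ t, N ^ 2 * (Lw t).card := by
          rw [mul_add, mul_sum, mul_sum]
          congr 1
          exact sum_congr rfl fun t _ => by ring
      _ ≤ (∑ _t : Fin h × Fin h × Fin h, N * (s * N ^ h)) +
          ∑ _t : Fin h × Fin h, Λ * N ^ h :=
          Nat.add_le_add (sum_le_sum fun t _ => Nat.mul_le_mul_left _ (hBadc t))
            (sum_le_sum fun t _ => hLwc t)
      _ = _ := by
          simp only [sum_const, card_univ, Fintype.card_prod, Fintype.card_fin, smul_eq_mul]
          ring
  have hmul : N ^ 2 * N ^ h ≤ (M * h ^ 3 * s * N + M * h ^ 2 * Λ) * N ^ h := by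
    calc N ^ 2 * N ^ h ≤ N ^ 2 * (M * y ^ h) := Nat.mul_le_mul_left _ hNM
      _ = M * (N ^ 2 * y ^ h) := by ring
      _ ≤ M * _ := Nat.mul_le_mul_left _ htotal
      _ = _ := by ring
  have hdiv := Nat.le_of_mul_le_mul_right hmul (Nat.pow_pos hN1)
  have : 2 * (M * h ^ 3 * s) * N ≤ N * N := Nat.mul_le_mul_right _ (by
    calc 2 * (M * h ^ 3 * s) = 2 * M * h ^ 3 * s := by ring
      _ ≤ N := hX)
  nlinarith

/-- Edge density of subsets when every large set has many low pairs. -/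
theorem sq_adjPairs_le {T K X₀ : ℕ}
    (hlow : ∀ X : Finset V, X₀ ≤ X.card → X.card ^ 2 ≤ K * lowCount G T X) (Y : Finset V) :
    adjPairs G Y ^ 2 ≤ (X₀ ^ 2 + K * T) * Y.card ^ 3 := by
  set N : V → Finset V := fun v => Y.filter fun y => G.Adj v y with hN
  have h1 : adjPairs G Y ^ 2 ≤ Y.card * ∑ v ∈ Y, (N v).card ^ 2 := by
    rw [adjPairs_eq_sum]
    exact sq_sum_le_card_mul_sum_sq
  have h2 : ∀ v ∈ Y, (N v).card ^ 2 ≤ X₀ ^ 2 + K * lowCount G T (N v) := by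
    intro v _
    by_cases h : X₀ ≤ (N v).card
    · exact (hlow _ h).trans (Nat.le_add_left _ _)
    · exact (Nat.pow_le_pow_left (by omega) 2).trans (Nat.le_add_right _ _)
  have h3 : ∑ v ∈ Y, lowCount G T (N v) ≤ T * Y.card ^ 2 := by
    have e1 : ∀ v, lowCount G T (N v) = ((Y ×ˢ Y).filter fun p => IsLow G T p.1 p.2 ∧
        G.Adj v p.1 ∧ G.Adj v p.2).card := by
      intro v
      unfold lowCount
      congr 1
      ext p
      simp only [hN, mem_filter, mem_product]
      tauto
    calc ∑ v ∈ Y, lowCount G T (N v)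
        = ∑ v ∈ Y, ((Y ×ˢ Y).filter fun p => IsLow G T p.1 p.2 ∧
          G.Adj v p.1 ∧ G.Adj v p.2).card := sum_congr rfl fun v _ => e1 v
      _ = ∑ p ∈ Y ×ˢ Y, (Y.filter fun v => IsLow G T p.1 p.2 ∧
          G.Adj v p.1 ∧ G.Adj v p.2).card := by
          simp only [card_filter]
          exact sum_comm
      _ ≤ (Y ×ˢ Y).card • T := by
          refine sum_le_card_nsmul _ _ _ fun p _ => ?_
          by_cases hp : IsLow G T p.1 p.2
          · refine le_trans (card_le_card ?_) hp.2.2.le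
            intro v hv
            have := (mem_filter.1 hv).2.2
            simp only [mem_filter, mem_univ, true_and]
            exact ⟨this.1.symm, this.2.symm⟩
          · rw [filter_false_of_mem fun v _ hv => hp hv.1]
            simp
      _ = T * Y.card ^ 2 := by rw [card_product, smul_eq_mul]; ring
  calc adjPairs G Y ^ 2 ≤ Y.card * ∑ v ∈ Y, (N v).card ^ 2 := h1
    _ ≤ Y.card * ∑ v ∈ Y, (X₀ ^ 2 + K * lowCount G T (N v)) :=
      Nat.mul_le_mul_left _ (sum_le_sum h2)
    _ = Y.card * (Y.card * X₀ ^ 2 + K * ∑ v ∈ Y, lowCount G T (N v)) := by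
      rw [sum_add_distrib, sum_const, smul_eq_mul, ← mul_sum]
    _ ≤ Y.card * (Y.card * X₀ ^ 2 + K * (T * Y.card ^ 2)) :=
      Nat.mul_le_mul_left _ (Nat.add_le_add_left (Nat.mul_le_mul_left _ h3) _)
    _ ≤ (X₀ ^ 2 + K * T) * Y.card ^ 3 := by
      have : Y.card ^ 2 ≤ Y.card ^ 3 := by
        rcases Nat.eq_zero_or_pos Y.card with h | h
        · simp [h]
        · exact Nat.pow_le_pow_right h (by omega)
      nlinarith [Nat.mul_le_mul_left (X₀ ^ 2) this]

end LowPairCount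

section DensestSubgraph
set_option linter.unusedSectionVars false
open scoped Classical
variable {V : Type} [Fintype V]

/-- A graph whose every subset spans at most twice its own average degree, with minimum degree
at least half the average. -/
structure IsBalancedDense (G : SimpleGraph V) (D : ℕ) : Prop where
  dense : D * Fintype.card V ≤ adjPairs G univ
  sparse : ∀ Z : Finset V, adjPairs G Z ≤ 2 * D * Z.card
  minDeg : ∀ v, D ≤ 2 * (univ.filter fun y => G.Adj v y).card

theorem exists_balancedDense [Nonempty V] (G : SimpleGraph V) {d : ℕ} (hd : 1 ≤ d)
    (hG : d * Fintype.card V ≤ adjPairs G univ) :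
    ∃ (Y : Finset V) (D : ℕ), Y.Nonempty ∧ d ≤ D ∧
      IsBalancedDense (G.comap (Subtype.val : {x // x ∈ Y} → V)) D := by
  obtain ⟨Y, hY, hmax⟩ := exists_max_image ((univ : Finset (Finset V)).filter fun Y => Y.Nonempty)
    (fun Y => (adjPairs G Y : ℝ) / Y.card) ⟨univ, by simp⟩
  have hYne : Y.Nonempty := (mem_filter.1 hY).2
  have hYpos : 0 < Y.card := card_pos.2 hYne
  have hratio : ∀ Z : Finset V, Z.Nonempty →
      adjPairs G Z * Y.card ≤ adjPairs G Y * Z.card := by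
    intro Z hZ
    have h1 := hmax Z (by simpa using hZ)
    have hZpos : 0 < Z.card := card_pos.2 hZ
    rw [div_le_div_iff₀ (by exact_mod_cast hZpos) (by exact_mod_cast hYpos)] at h1
    exact_mod_cast h1
  set D := adjPairs G Y / Y.card with hD
  have hdD : d ≤ D := by
    rw [hD, Nat.le_div_iff_mul_le hYpos]
    have h1 := hratio univ univ_nonempty
    rw [card_univ] at h1
    refine Nat.le_of_mul_le_mul_right (c := Fintype.card V) ?_ Fintype.card_pos
    calc d * Y.card * Fintype.card V = d * Fintype.card V * Y.card := by ring
      _ ≤ adjPairs G univ * Y.card := Nat.mul_le_mul_right _ hG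
      _ ≤ _ := h1
  have hDY : D * Y.card ≤ adjPairs G Y := Nat.div_mul_le_self _ _
  have hDY' : adjPairs G Y ≤ 2 * D * Y.card := by
    have := Nat.lt_div_mul_add (a := adjPairs G Y) hYpos
    nlinarith
  have hsparse : ∀ Z : Finset V, adjPairs G Z ≤ 2 * D * Z.card := by
    intro Z
    rcases Z.eq_empty_or_nonempty with rfl | hZ
    · simp [adjPairs]
    · refine Nat.le_of_mul_le_mul_right (c := Y.card) ?_ hYpos
      calc adjPairs G Z * Y.card ≤ adjPairs G Y * Z.card := hratio Z hZ
        _ ≤ 2 * D * Y.card * Z.card := Nat.mul_le_mul_right _ hDY'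
        _ = _ := by ring
  refine ⟨Y, D, hYne, hdD, ?_, ?_, ?_⟩
  · rw [adjPairs_comap, Fintype.card_coe]
    exact hDY
  · intro Z
    have h1 := hsparse (Z.map (Function.Embedding.subtype _))
    rw [card_map] at h1
    refine le_trans (le_of_eq ?_) h1
    unfold adjPairs
    rw [← card_map ((Function.Embedding.subtype fun x => x ∈ Y).prodMap
      (Function.Embedding.subtype fun x => x ∈ Y))]
    congr 1
    ext ⟨a, b⟩
    simp only [mem_map, mem_filter, mem_product, Function.Embedding.prodMap, Prod.exists,
      Function.Embedding.coeFn_mk, Prod.map, Prod.mk.injEq, Function.Embedding.subtype_apply,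
      SimpleGraph.comap_adj]
    constructor
    · rintro ⟨a', b', ⟨⟨h1, h2⟩, h3⟩, rfl, rfl⟩
      exact ⟨⟨⟨_, h1, rfl⟩, ⟨_, h2, rfl⟩⟩, h3⟩
    · rintro ⟨⟨⟨a', h1, rfl⟩, ⟨b', h2, rfl⟩⟩, h3⟩
      exact ⟨a', b', ⟨⟨h1, h2⟩, h3⟩, rfl, rfl⟩
  · intro v
    suffices hdeg : D ≤ 2 * (Y.filter fun y => G.Adj v y).card by
      refine hdeg.trans (le_of_eq (congrArg _ ?_))
      rw [← card_filter_subtype Y fun y => G.Adj v y]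
      congr!
    have h2 := adjPairs_le_erase G v.2
    have h3 : adjPairs G (Y.erase v) * Y.card ≤ adjPairs G Y * (Y.card - 1) := by
      rcases (Y.erase v).eq_empty_or_nonempty with h | h
      · rw [h]
        simp [adjPairs]
      · have := hratio _ h
        rwa [card_erase_of_mem v.2] at this
    by_contra! hlt
    have h4 : adjPairs G Y * Y.card < adjPairs G Y * Y.card := by
      have h5 : adjPairs G Y * (Y.card - 1) + adjPairs G Y = adjPairs G Y * Y.card := by
        rw [← Nat.mul_succ]
        congr 1
        omega
      have h6 : 2 * (Y.filter fun y => G.Adj v y).card * Y.card < D * Y.card :=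
        Nat.mul_lt_mul_of_pos_right hlt hYpos
      calc adjPairs G Y * Y.card
          ≤ (adjPairs G (Y.erase v) + 2 * (Y.filter fun y => G.Adj v y).card) * Y.card :=
            Nat.mul_le_mul_right _ h2
        _ = adjPairs G (Y.erase v) * Y.card +
            2 * (Y.filter fun y => G.Adj v y).card * Y.card := by ring
        _ < adjPairs G Y * (Y.card - 1) + adjPairs G Y := by omega
        _ = _ := h5
    exact lt_irrefl _ h4

/-- A graph all of whose subsets are sparse has an orientation of bounded out-degree. -/
theorem exists_orientation {G : SimpleGraph V} {k : ℕ}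
    (hG : ∀ Z : Finset V, adjPairs G Z ≤ k * Z.card) :
    ∃ out : V → Finset V, (∀ v, (out v).card ≤ k) ∧ (∀ v, ∀ u ∈ out v, G.Adj v u) ∧
      ∀ u v, G.Adj u v → v ∈ out u ∨ u ∈ out v := by
  suffices H : ∀ (m : ℕ) (Z : Finset V), Z.card = m →
      ∃ out : V → Finset V, (∀ v, (out v).card ≤ k) ∧ (∀ v, ∀ u ∈ out v, G.Adj v u) ∧
        ∀ u ∈ Z, ∀ v ∈ Z, G.Adj u v → v ∈ out u ∨ u ∈ out v by
    obtain ⟨out, h1, h2, h3⟩ := H _ univ rfl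
    exact ⟨out, h1, h2, fun u v => h3 u (mem_univ u) v (mem_univ v)⟩
  intro m
  induction m with
  | zero =>
    intro Z hZ
    rw [card_eq_zero] at hZ
    subst hZ
    exact ⟨fun _ => ∅, by simp, by simp, by simp⟩
  | succ m ih =>
    intro Z hZ
    have hZne : Z.Nonempty := card_pos.1 (by omega)
    obtain ⟨v, hv, hvk⟩ : ∃ v ∈ Z, (Z.filter fun y => G.Adj v y).card ≤ k := by
      by_contra! hcon
      have h1 := hG Z
      rw [adjPairs_eq_sum] at h1
      have h2 : ∑ v ∈ Z, k < ∑ v ∈ Z, (Z.filter fun y => G.Adj v y).card :=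
        sum_lt_sum_of_nonempty hZne hcon
      rw [sum_const, smul_eq_mul, mul_comm] at h2
      omega
    obtain ⟨out, h1, h2, h3⟩ := ih (Z.erase v) (by rw [card_erase_of_mem hv]; omega)
    refine ⟨Function.update out v (Z.filter fun y => G.Adj v y), ?_, ?_, ?_⟩
    · intro u
      by_cases hu : u = v
      · subst hu
        simpa using hvk
      · simpa [hu] using h1 u
    · intro u w
      by_cases hu : u = v
      · subst hu
        simp
      · simpa [hu] using h2 u w
    · intro u hu w hw hadj
      by_cases huv : u = v
      · subst huv
        left
        simp [hw, hadj]
      · by_cases hwv : w = v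
        · subst hwv
          right
          simp [hu, hadj.symm]
        · simpa [huv, hwv] using h3 u (mem_erase.2 ⟨huv, hu⟩) w (mem_erase.2 ⟨hwv, hw⟩) hadj

end DensestSubgraph

section Sampling
set_option linter.unusedSectionVars false
open scoped Classical
variable {V : Type} [Fintype V]

/-- Labellings for which `R` gets labels in `[1, r]` and `Z` gets label `0`. -/
noncomputable def cyl (Q r : ℕ) (R Z : Finset V) : Finset (V → Fin Q) :=
  univ.filter fun ω => (∀ v ∈ R, 1 ≤ (ω v : ℕ) ∧ (ω v : ℕ) ≤ r) ∧ ∀ v ∈ Z, (ω v : ℕ) = 0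

theorem mem_cyl {Q r : ℕ} {R Z : Finset V} {ω : V → Fin Q} : ω ∈ cyl Q r R Z ↔
    (∀ v ∈ R, 1 ≤ (ω v : ℕ) ∧ (ω v : ℕ) ≤ r) ∧ ∀ v ∈ Z, (ω v : ℕ) = 0 := by
  simp [cyl]

theorem card_cyl {Q r : ℕ} (hr : r < Q) {R Z : Finset V} (h : Disjoint R Z) :
    ((cyl Q r R Z).card : ℝ) =
      (Q : ℝ) ^ Fintype.card V * (((r : ℝ) / Q) ^ R.card * (1 / (Q : ℝ)) ^ Z.card) := by
  have hQ : (Q : ℝ) ≠ 0 := by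
    have : Q ≠ 0 := by omega
    exact_mod_cast this
  have hcyl : cyl Q r R Z = Fintype.piFinset fun v => univ.filter fun i : Fin Q =>
      (v ∈ R → 1 ≤ (i : ℕ) ∧ (i : ℕ) ≤ r) ∧ (v ∈ Z → (i : ℕ) = 0) := by
    ext ω
    simp only [mem_cyl, Fintype.mem_piFinset, mem_filter, mem_univ, true_and]
    exact forall_and.symm
  have hpt : ∀ v, (((univ.filter fun i : Fin Q =>
      (v ∈ R → 1 ≤ (i : ℕ) ∧ (i : ℕ) ≤ r) ∧ (v ∈ Z → (i : ℕ) = 0)).card : ℕ) : ℝ) =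
      Q * ((if v ∈ R then (r : ℝ) / Q else 1) * (if v ∈ Z then 1 / (Q : ℝ) else 1)) := by
    intro v
    by_cases hR : v ∈ R
    · have hZ : v ∉ Z := disjoint_left.1 h hR
      have : (univ.filter fun i : Fin Q => (v ∈ R → 1 ≤ (i : ℕ) ∧ (i : ℕ) ≤ r) ∧
          (v ∈ Z → (i : ℕ) = 0)).card = r := by
        rw [← card_map Fin.valEmbedding]
        have : (univ.filter fun i : Fin Q => (v ∈ R → 1 ≤ (i : ℕ) ∧ (i : ℕ) ≤ r) ∧
          (v ∈ Z → (i : ℕ) = 0)).map Fin.valEmbedding = Icc 1 r := by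
          ext j
          simp only [hR, hZ, mem_map, mem_filter, mem_univ, true_and, forall_const,
            IsEmpty.forall_iff, and_true, Fin.valEmbedding_apply, mem_Icc]
          constructor
          · rintro ⟨i, hi, rfl⟩
            exact hi
          · intro hj
            exact ⟨⟨j, by omega⟩, hj, rfl⟩
        rw [this, Nat.card_Icc]
        omega
      rw [this]
      simp only [hR, hZ, if_true, if_false]
      field_simp
    · by_cases hZ : v ∈ Z
      · have : (univ.filter fun i : Fin Q => (v ∈ R → 1 ≤ (i : ℕ) ∧ (i : ℕ) ≤ r) ∧
            (v ∈ Z → (i : ℕ) = 0)) = {⟨0, by omega⟩} := by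
          ext j
          simp [hR, hZ, Fin.ext_iff]
        rw [this]
        simp only [hR, hZ, if_true, if_false, card_singleton]
        field_simp
        simp
      · simp [hR, hZ]
  rw [hcyl, Fintype.card_piFinset]
  push_cast
  rw [prod_congr rfl fun v _ => hpt v, prod_mul_distrib, prod_mul_distrib, prod_const, card_univ,
    prod_ite_mem, prod_ite_mem, prod_const, prod_const, univ_inter, univ_inter]

theorem card_cyl_le {Q r : ℕ} (hr : r < Q) (R Z : Finset V) :
    ((cyl Q r R Z).card : ℝ) ≤
      (Q : ℝ) ^ Fintype.card V * (((r : ℝ) / Q) ^ R.card * (1 / (Q : ℝ)) ^ Z.card) := by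
  by_cases h : Disjoint R Z
  · exact (card_cyl hr h).le
  · rw [not_disjoint_iff] at h
    obtain ⟨v, hR, hZ⟩ := h
    have : cyl Q r R Z = ∅ := by
      refine filter_false_of_mem fun ω _ hω => ?_
      have h1 := hω.1 v hR
      have h2 := hω.2 v hZ
      omega
    rw [this, card_empty, Nat.cast_zero]
    positivity

variable (G : SimpleGraph V) (T D r : ℕ) (out : V → Finset V) {Q : ℕ}

/-- `x` and `y` form a low pair and are the only label-`0` vertices adjacent to `a`, or out-adjacent
to or equal to one of `x`, `y`. -/
def IsLink (ω : V → Fin Q) (a x y : V) : Prop :=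
  IsLow G T x y ∧ G.Adj a x ∧ G.Adj a y ∧ (ω x : ℕ) = 0 ∧ (ω y : ℕ) = 0 ∧
    ∀ z, (ω z : ℕ) = 0 → z ≠ x → z ≠ y → ¬ G.Adj a z ∧ z ∉ out x ∧ z ∉ out y

/-- The vertices of moderate degree with label in `[1, r]` linking two label-`0` vertices. -/
noncomputable def linkers (ω : V → Fin Q) : Finset V :=
  univ.filter fun a => (1 ≤ (ω a : ℕ) ∧ (ω a : ℕ) ≤ r) ∧
    (univ.filter fun y => G.Adj a y).card ≤ 4 * D ∧ ∃ x y, IsLink G T out ω a x y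

variable {G T D r out}

theorem le_card_isLink (hr : r < Q) (hQ : 16 * D ≤ Q) (hout : ∀ v, (out v).card ≤ 2 * D)
    {a x y : V} (ha : (univ.filter fun y => G.Adj a y).card ≤ 4 * D) (hxy : IsLow G T x y)
    (hax : G.Adj a x) (hay : G.Adj a y) :
    (Q : ℝ) ^ Fintype.card V * ((r : ℝ) / Q * (1 / (Q : ℝ)) ^ 2) / 2 ≤
      ((univ.filter fun ω : V → Fin Q => (1 ≤ (ω a : ℕ) ∧ (ω a : ℕ) ≤ r) ∧
        IsLink G T out ω a x y).card : ℝ) := by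
  set Z : Finset V := (((univ.filter fun y => G.Adj a y) ∪ (out x ∪ out y)).erase x).erase y
    with hZ
  have hQ0 : (0 : ℝ) < Q := by exact_mod_cast (by omega : 0 < Q)
  have hZc : Z.card ≤ 8 * D := by
    refine (card_le_card ((erase_subset _ _).trans (erase_subset _ _))).trans ?_
    refine (card_union_le _ _).trans ?_
    have h1 := card_union_le (out x) (out y)
    have h2 := hout x
    have h3 := hout y
    omega
  have hcover : cyl Q r {a} {x, y} ⊆ (univ.filter fun ω : V → Fin Q =>
      (1 ≤ (ω a : ℕ) ∧ (ω a : ℕ) ≤ r) ∧ IsLink G T out ω a x y) ∪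
      Z.biUnion fun z => cyl Q r {a} {x, y, z} := by
    intro ω hω
    simp only [mem_cyl, mem_singleton, forall_eq, mem_insert, forall_eq_or_imp] at hω
    by_cases hz : ∃ z ∈ Z, (ω z : ℕ) = 0
    · obtain ⟨z, hzZ, hz0⟩ := hz
      refine mem_union_right _ (mem_biUnion.2 ⟨z, hzZ, ?_⟩)
      simp only [mem_cyl, mem_singleton, forall_eq, mem_insert, forall_eq_or_imp]
      exact ⟨hω.1, hω.2.1, hω.2.2, hz0⟩
    · push Not at hz
      refine mem_union_left _ (mem_filter.2 ⟨mem_univ _, hω.1, hxy, hax, hay, hω.2.1, hω.2.2, ?_⟩)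
      intro z hz0 hzx hzy
      have hzZ : z ∉ Z := fun h => hz z h hz0
      simp only [hZ, mem_erase, mem_union, mem_filter, mem_univ, true_and] at hzZ
      tauto
  have h1 : ((cyl Q r {a} {x, y}).card : ℝ) ≤ ((univ.filter fun ω : V → Fin Q =>
      (1 ≤ (ω a : ℕ) ∧ (ω a : ℕ) ≤ r) ∧ IsLink G T out ω a x y).card : ℝ) +
      ∑ z ∈ Z, ((cyl Q r {a} {x, y, z}).card : ℝ) := by
    exact_mod_cast (card_le_card hcover).trans ((card_union_le _ _).trans
      (Nat.add_le_add_left card_biUnion_le _))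
  have h2 := card_cyl hr (R := {a}) (Z := {x, y}) (by
    simp [hax.ne, hay.ne])
  rw [card_singleton, card_pair hxy.1, pow_one] at h2
  have h3 : ∑ z ∈ Z, ((cyl Q r {a} {x, y, z}).card : ℝ) ≤
      (8 * D : ℕ) * ((Q : ℝ) ^ Fintype.card V * ((r : ℝ) / Q * (1 / (Q : ℝ)) ^ 3)) := by
    refine (sum_le_card_nsmul Z _ _ fun z hz => ?_).trans (b := Z.card • ((Q : ℝ) ^ Fintype.card V *
      ((r : ℝ) / Q * (1 / (Q : ℝ)) ^ 3))) ?_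
    · have hzx : x ≠ z := by
        simp only [hZ, mem_erase] at hz
        exact hz.2.1.symm
      have hzy : y ≠ z := by
        simp only [hZ, mem_erase] at hz
        exact hz.1.symm
      have h4 := card_cyl_le hr {a} {x, y, z}
      rw [card_singleton, pow_one, card_eq_three.2 ⟨x, y, z, hxy.1, hzx, hzy, rfl⟩] at h4
      exact h4
    · rw [nsmul_eq_mul]
      refine mul_le_mul_of_nonneg_right (by exact_mod_cast hZc) (by positivity)
  have h5 : ((8 * D : ℕ) : ℝ) * (1 / Q) ≤ 1 / 2 := by
    rw [mul_one_div, div_le_iff₀ hQ0]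
    have : ((16 * D : ℕ) : ℝ) ≤ Q := by exact_mod_cast hQ
    push_cast at this ⊢
    linarith
  have h6 : ((8 * D : ℕ) : ℝ) * ((Q : ℝ) ^ Fintype.card V * ((r : ℝ) / Q * (1 / (Q : ℝ)) ^ 3)) ≤
      (Q : ℝ) ^ Fintype.card V * ((r : ℝ) / Q * (1 / (Q : ℝ)) ^ 2) / 2 := by
    calc _ = ((8 * D : ℕ) : ℝ) * (1 / Q) *
          ((Q : ℝ) ^ Fintype.card V * ((r : ℝ) / Q * (1 / (Q : ℝ)) ^ 2)) := by ring
      _ ≤ 1 / 2 * ((Q : ℝ) ^ Fintype.card V * ((r : ℝ) / Q * (1 / (Q : ℝ)) ^ 2)) :=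
          mul_le_mul_of_nonneg_right h5 (by positivity)
      _ = _ := by ring
  rw [h2] at h1
  linarith

theorem isLink_pair_unique {ω : V → Fin Q} {a x y x' y' : V} (h : IsLink G T out ω a x y)
    (h' : IsLink G T out ω a x' y') : (x', y') = (x, y) ∨ (x', y') = (y, x) := by
  obtain ⟨-, -, -, -, -, hz⟩ := h
  obtain ⟨hlow', hx', hy', hx0', hy0', -⟩ := h'
  have h1 : x' = x ∨ x' = y := by
    by_contra! hcon
    exact (hz x' hx0' hcon.1 hcon.2).1 hx'
  have h2 : y' = x ∨ y' = y := by
    by_contra! hcon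
    exact (hz y' hy0' hcon.1 hcon.2).1 hy'
  have h3 := hlow'.1
  rcases h1 with rfl | rfl <;> rcases h2 with rfl | rfl <;> simp_all

theorem lowCount_mul_le_card_mem_linkers (hr : r < Q) (hQ : 16 * D ≤ Q)
    (hout : ∀ v, (out v).card ≤ 2 * D) {a : V}
    (ha : (univ.filter fun y => G.Adj a y).card ≤ 4 * D) :
    (lowCount G T (univ.filter fun y => G.Adj a y) : ℝ) *
      ((Q : ℝ) ^ Fintype.card V * ((r : ℝ) / Q * (1 / (Q : ℝ)) ^ 2) / 2) ≤
      2 * ((univ.filter fun ω : V → Fin Q => a ∈ linkers G T D r out ω).card : ℝ) := by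
  set L := ((univ.filter fun y => G.Adj a y) ×ˢ (univ.filter fun y => G.Adj a y)).filter
    fun p => IsLow G T p.1 p.2 with hL
  have h1 : (lowCount G T (univ.filter fun y => G.Adj a y) : ℝ) *
      ((Q : ℝ) ^ Fintype.card V * ((r : ℝ) / Q * (1 / (Q : ℝ)) ^ 2) / 2) ≤
      ∑ p ∈ L, ((univ.filter fun ω : V → Fin Q => (1 ≤ (ω a : ℕ) ∧ (ω a : ℕ) ≤ r) ∧
        IsLink G T out ω a p.1 p.2).card : ℝ) := by
    rw [lowCount, ← nsmul_eq_mul]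
    refine card_nsmul_le_sum _ _ _ fun p hp => ?_
    simp only [mem_filter, mem_product, mem_univ, true_and] at hp
    exact le_card_isLink hr hQ hout ha hp.2 hp.1.1 hp.1.2
  refine h1.trans ?_
  have h2 : ∑ p ∈ L, (univ.filter fun ω : V → Fin Q => (1 ≤ (ω a : ℕ) ∧ (ω a : ℕ) ≤ r) ∧
      IsLink G T out ω a p.1 p.2).card ≤
      2 * (univ.filter fun ω : V → Fin Q => a ∈ linkers G T D r out ω).card := by
    have hcomm : ∑ p ∈ L, (univ.filter fun ω : V → Fin Q => (1 ≤ (ω a : ℕ) ∧ (ω a : ℕ) ≤ r) ∧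
        IsLink G T out ω a p.1 p.2).card = ∑ ω : V → Fin Q, (L.filter fun p =>
          (1 ≤ (ω a : ℕ) ∧ (ω a : ℕ) ≤ r) ∧ IsLink G T out ω a p.1 p.2).card := by
      simp only [card_filter]
      exact sum_comm
    rw [hcomm, card_filter, mul_sum]
    refine sum_le_sum fun ω _ => ?_
    split_ifs with hω
    · obtain ⟨x, y, hxy⟩ := (mem_filter.1 hω).2.2.2
      refine (card_le_card (t := {(x, y), (y, x)}) ?_).trans card_le_two
      intro p hp
      have := isLink_pair_unique hxy (mem_filter.1 hp).2.2
      simpa using this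
    · rw [filter_false_of_mem]
      · simp
      · intro p _ hp
        exact hω (mem_filter.2 ⟨mem_univ _, hp.1, ha, p.1, p.2, hp.2⟩)
  exact_mod_cast h2

theorem card_mem_linkers_pair_le_sq (hr : r < Q) {a a' : V} (haa : a ≠ a') :
    ((univ.filter fun ω : V → Fin Q =>
      a ∈ linkers G T D r out ω ∧ a' ∈ linkers G T D r out ω).card : ℝ) ≤
      (Q : ℝ) ^ Fintype.card V * ((r : ℝ) / Q) ^ 2 := by
  have h1 := card_cyl_le hr {a, a'} (∅ : Finset V)
  rw [card_pair haa, card_empty, pow_zero, mul_one] at h1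
  refine le_trans ?_ h1
  exact_mod_cast card_le_card fun ω hω => by
    have h2 := (mem_filter.1 hω).2
    simp only [mem_cyl, mem_insert, mem_singleton, forall_eq_or_imp, forall_eq]
    exact ⟨⟨(mem_filter.1 h2.1).2.1, (mem_filter.1 h2.2).2.1⟩, by simp⟩

theorem card_mem_linkers_pair_le (hr : r < Q) {a a' : V} (haa : a ≠ a') :
    ((univ.filter fun ω : V → Fin Q =>
      a ∈ linkers G T D r out ω ∧ a' ∈ linkers G T D r out ω).card : ℝ) ≤
      (Q : ℝ) ^ Fintype.card V * ((r : ℝ) / Q) ^ 2 *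
        (codeg G a a' * (1 / Q) + (4 * D) ^ 4 * (1 / Q) ^ 4) := by
  by_cases hdeg : (univ.filter fun y => G.Adj a y).card ≤ 4 * D ∧
      (univ.filter fun y => G.Adj a' y).card ≤ 4 * D
  swap
  · rw [filter_false_of_mem, card_empty, Nat.cast_zero]
    · positivity
    · intro ω _ hω
      exact hdeg ⟨(mem_filter.1 hω.1).2.2.1, (mem_filter.1 hω.2).2.2.1⟩
  set C := univ.filter fun c => G.Adj a c ∧ G.Adj a' c with hC
  set F := (((univ.filter fun y => G.Adj a y) ×ˢ (univ.filter fun y => G.Adj a y)) ×ˢ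
    ((univ.filter fun y => G.Adj a' y) ×ˢ (univ.filter fun y => G.Adj a' y))).filter
    fun p => ({p.1.1, p.1.2, p.2.1, p.2.2} : Finset V).card = 4 with hF
  have hFc : F.card ≤ (4 * D) ^ 4 := by
    refine (card_filter_le _ _).trans ?_
    rw [card_product, card_product, card_product]
    calc _ ≤ (4 * D) * (4 * D) * ((4 * D) * (4 * D)) :=
          Nat.mul_le_mul (Nat.mul_le_mul hdeg.1 hdeg.1) (Nat.mul_le_mul hdeg.2 hdeg.2)
      _ = _ := by ring
  have hcover : (univ.filter fun ω : V → Fin Q =>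
      a ∈ linkers G T D r out ω ∧ a' ∈ linkers G T D r out ω) ⊆
      (C.biUnion fun z => cyl Q r {a, a'} {z}) ∪
      F.biUnion fun p => cyl Q r {a, a'} {p.1.1, p.1.2, p.2.1, p.2.2} := by
    intro ω hω
    obtain ⟨h1, h2⟩ := (mem_filter.1 hω).2
    simp only [linkers, mem_filter, mem_univ, true_and] at h1 h2
    obtain ⟨hr1, -, x, y, hl, hx, hy, hx0, hy0, -⟩ := h1
    obtain ⟨hr2, -, x', y', hl', hx', hy', hx0', hy0', -⟩ := h2
    by_cases hz : ∃ z ∈ C, (ω z : ℕ) = 0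
    · obtain ⟨z, hzC, hz0⟩ := hz
      refine mem_union_left _ (mem_biUnion.2 ⟨z, hzC, ?_⟩)
      simp only [mem_cyl, mem_insert, mem_singleton, forall_eq_or_imp, forall_eq]
      exact ⟨⟨hr1, hr2⟩, hz0⟩
    · push Not at hz
      refine mem_union_right _ (mem_biUnion.2 ⟨((x, y), (x', y')), ?_, ?_⟩)
      · simp only [hF, mem_filter, mem_product, mem_univ, true_and]
        have e1 : x ≠ x' := by
          rintro rfl
          exact hz x (by simp [hC, hx, hx']) hx0
        have e2 : x ≠ y' := by
          rintro rfl
          exact hz x (by simp [hC, hx, hy']) hx0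
        have e3 : y ≠ x' := by
          rintro rfl
          exact hz y (by simp [hC, hy, hx']) hy0
        have e4 : y ≠ y' := by
          rintro rfl
          exact hz y (by simp [hC, hy, hy']) hy0
        refine ⟨⟨⟨hx, hy⟩, hx', hy'⟩, ?_⟩
        rw [card_insert_of_notMem (by simp [e1, e2, hl.1]),
          card_insert_of_notMem (by simp [e3, e4]), card_pair hl'.1]
      · simp only [mem_cyl, mem_insert, mem_singleton, forall_eq_or_imp, forall_eq]
        exact ⟨⟨hr1, hr2⟩, hx0, hy0, hx0', hy0'⟩
  have h1 : ((univ.filter fun ω : V → Fin Q =>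
      a ∈ linkers G T D r out ω ∧ a' ∈ linkers G T D r out ω).card : ℝ) ≤
      ∑ z ∈ C, ((cyl Q r {a, a'} {z}).card : ℝ) +
      ∑ p ∈ F, ((cyl Q r {a, a'} {p.1.1, p.1.2, p.2.1, p.2.2}).card : ℝ) := by
    exact_mod_cast (card_le_card hcover).trans ((card_union_le _ _).trans
      (Nat.add_le_add card_biUnion_le card_biUnion_le))
  have h2 : ∑ z ∈ C, ((cyl Q r {a, a'} {z}).card : ℝ) ≤
      C.card • ((Q : ℝ) ^ Fintype.card V * (((r : ℝ) / Q) ^ 2 * (1 / Q))) := by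
    refine sum_le_card_nsmul _ _ _ fun z _ => ?_
    have := card_cyl_le hr {a, a'} {z}
    rwa [card_pair haa, card_singleton, pow_one] at this
  have h3 : ∑ p ∈ F, ((cyl Q r {a, a'} {p.1.1, p.1.2, p.2.1, p.2.2}).card : ℝ) ≤
      F.card • ((Q : ℝ) ^ Fintype.card V * (((r : ℝ) / Q) ^ 2 * (1 / Q) ^ 4)) := by
    refine sum_le_card_nsmul _ _ _ fun p hp => ?_
    have := card_cyl_le hr {a, a'} {p.1.1, p.1.2, p.2.1, p.2.2}
    rwa [card_pair haa, (mem_filter.1 hp).2] at this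
  rw [nsmul_eq_mul] at h2 h3
  have h4 : (F.card : ℝ) * ((Q : ℝ) ^ Fintype.card V * (((r : ℝ) / Q) ^ 2 * (1 / Q) ^ 4)) ≤
      (4 * D) ^ 4 * ((Q : ℝ) ^ Fintype.card V * (((r : ℝ) / Q) ^ 2 * (1 / Q) ^ 4)) :=
    mul_le_mul_of_nonneg_right (by exact_mod_cast hFc) (by positivity)
  calc _ ≤ _ := h1
    _ ≤ (C.card : ℝ) * ((Q : ℝ) ^ Fintype.card V * (((r : ℝ) / Q) ^ 2 * (1 / Q))) +
        (4 * D) ^ 4 * ((Q : ℝ) ^ Fintype.card V * (((r : ℝ) / Q) ^ 2 * (1 / Q) ^ 4)) :=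
        add_le_add h2 (h3.trans h4)
    _ = _ := by
        have : C.card = codeg G a a' := rfl
        rw [this]
        ring

end Sampling

section SamplingExpectation
set_option linter.unusedSectionVars false
open scoped Classical
variable {V : Type} [Fintype V] {G : SimpleGraph V}

theorem card_le_two_mul_card_moderate {D : ℕ} (hD : 1 ≤ D)
    (h : adjPairs G univ ≤ 2 * D * Fintype.card V) :
    Fintype.card V ≤
      2 * (univ.filter fun a => (univ.filter fun y => G.Adj a y).card ≤ 4 * D).card := by
  have h1 := card_filter_add_card_filter_not (s := (univ : Finset V))
    (fun a => (univ.filter fun y => G.Adj a y).card ≤ 4 * D)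
  rw [card_univ] at h1
  have h2 : (univ.filter fun a => ¬ (univ.filter fun y => G.Adj a y).card ≤ 4 * D).card * (4 * D) ≤
      2 * D * Fintype.card V := by
    refine le_trans ?_ h
    rw [adjPairs_eq_sum, ← smul_eq_mul]
    refine (card_nsmul_le_sum _ (fun a => (univ.filter fun y => G.Adj a y).card) _ ?_).trans
      (sum_le_sum_of_subset (filter_subset _ _))
    intro a ha
    exact (not_le.1 (mem_filter.1 ha).2).le
  have h3 : 2 * D * (2 * (univ.filter fun a =>
      ¬ (univ.filter fun y => G.Adj a y).card ≤ 4 * D).card) ≤ 2 * D * Fintype.card V := by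
    refine le_trans (le_of_eq ?_) h2
    ring
  have h4 := Nat.le_of_mul_le_mul_left h3 (by omega)
  omega

/-- The neighbours of `a` having unusually many common neighbours with `a`. -/
noncomputable def heavyNeighbours (G : SimpleGraph V) (D W : ℕ) (a : V) : Finset V :=
  univ.filter fun a' => G.Adj a a' ∧ D < codeg G a a' * W

theorem card_heavyNeighbours_le {S T D : ℕ} (hS : 2 ^ 20 ≤ S) (hT : T ≤ S) (hD : S ^ 100 ≤ D)
    (hlow : ∀ X : Finset V, S ≤ X.card → X.card ^ 2 ≤ S * lowCount G T X) {a : V}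
    (ha : (univ.filter fun y => G.Adj a y).card ≤ 4 * D) :
    (heavyNeighbours G D (S ^ 18) a).card * S ^ 26 ≤ D := by
  set N := univ.filter fun y => G.Adj a y with hN
  set H := heavyNeighbours G D (S ^ 18) a with hH
  have h1 : H.card * D ≤ S ^ 18 * adjPairs G N := by
    have h2 : ∑ a' ∈ H, codeg G a a' ≤ adjPairs G N := by
      rw [adjPairs_eq_sum]
      refine le_trans (sum_le_sum fun a' _ => le_of_eq ?_)
        (sum_le_sum_of_subset (s := H) (t := N) ?_)
      · unfold codeg
        congr 1
        ext c
        simp [hN]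
      · intro a' ha'
        have := (mem_filter.1 ha').2.1
        simpa [hN] using this
    calc H.card * D ≤ ∑ a' ∈ H, codeg G a a' * S ^ 18 := by
          rw [← smul_eq_mul]
          exact card_nsmul_le_sum _ _ _ fun a' ha' => (mem_filter.1 ha').2.2.le
      _ = S ^ 18 * ∑ a' ∈ H, codeg G a a' := by rw [← sum_mul, mul_comm]
      _ ≤ _ := Nat.mul_le_mul_left _ h2
  have h3 : adjPairs G N ^ 2 ≤ 2 * S ^ 2 * (4 * D) ^ 3 := by
    refine (sq_adjPairs_le hlow N).trans ?_
    refine Nat.mul_le_mul ?_ (Nat.pow_le_pow_left ha 3)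
    nlinarith
  have hDpos : 0 < D := lt_of_lt_of_le (by positivity) hD
  have h4 : (H.card * S ^ 26) ^ 2 * D ^ 2 ≤ D ^ 2 * D ^ 2 := by
    calc (H.card * S ^ 26) ^ 2 * D ^ 2 = (S ^ 26) ^ 2 * (H.card * D) ^ 2 := by ring
      _ ≤ (S ^ 26) ^ 2 * (S ^ 18 * adjPairs G N) ^ 2 :=
        Nat.mul_le_mul_left _ (Nat.pow_le_pow_left h1 2)
      _ = S ^ 88 * adjPairs G N ^ 2 := by ring
      _ ≤ S ^ 88 * (2 * S ^ 2 * (4 * D) ^ 3) := Nat.mul_le_mul_left _ h3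
      _ = 128 * S ^ 90 * D ^ 3 := by ring
      _ ≤ S * S ^ 90 * D ^ 3 := by gcongr; omega
      _ = S ^ 91 * D ^ 3 := by ring
      _ ≤ S ^ 100 * D ^ 3 := by gcongr <;> omega
      _ ≤ D * D ^ 3 := by gcongr
      _ = D ^ 2 * D ^ 2 := by ring
  have h5 := Nat.le_of_mul_le_mul_right h4 (by positivity)
  exact (Nat.pow_le_pow_iff_left (by norm_num)).1 h5

theorem sum_card_linkers {Q T D r : ℕ} {out : V → Finset V} :
    ∑ ω : V → Fin Q, (linkers G T D r out ω).card =
      ∑ a, (univ.filter fun ω : V → Fin Q => a ∈ linkers G T D r out ω).card := by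
  have h : ∀ ω : V → Fin Q, (linkers G T D r out ω).card =
      (univ.filter fun a => a ∈ linkers G T D r out ω).card := by
    intro ω
    rw [filter_univ_mem]
  rw [sum_congr rfl fun ω _ => h ω]
  simp only [card_filter]
  exact sum_comm

theorem sum_adjPairs_linkers {Q T D r : ℕ} {out : V → Finset V} :
    ∑ ω : V → Fin Q, adjPairs G (linkers G T D r out ω) =
      ∑ a, ∑ a' ∈ univ.filter fun a' => G.Adj a a', (univ.filter fun ω : V → Fin Q =>
        a ∈ linkers G T D r out ω ∧ a' ∈ linkers G T D r out ω).card := by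
  have h : ∀ ω : V → Fin Q, adjPairs G (linkers G T D r out ω) =
      ∑ a, ∑ a' ∈ univ.filter fun a' => G.Adj a a',
        if a ∈ linkers G T D r out ω ∧ a' ∈ linkers G T D r out ω then 1 else 0 := by
    intro ω
    have h1 : ((linkers G T D r out ω) ×ˢ (linkers G T D r out ω)).filter
        (fun p => G.Adj p.1 p.2) = ((univ : Finset V) ×ˢ (univ : Finset V)).filter
        fun p => G.Adj p.1 p.2 ∧
          (p.1 ∈ linkers G T D r out ω ∧ p.2 ∈ linkers G T D r out ω) := by
      ext p
      simp only [mem_filter, mem_product, mem_univ, true_and]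
      exact and_comm
    rw [adjPairs, h1, card_filter, sum_product]
    refine sum_congr rfl fun a _ => ?_
    rw [sum_filter]
    exact sum_congr rfl fun a' _ => by simp only [ite_and]
  rw [sum_congr rfl fun ω _ => h ω, sum_comm]
  refine sum_congr rfl fun a _ => ?_
  rw [sum_comm]
  exact sum_congr rfl fun a' _ => (card_filter _ _).symm

theorem sum_card_label_zero {Q : ℕ} (hQ : 0 < Q) :
    ((∑ ω : V → Fin Q, (univ.filter fun v => (ω v : ℕ) = 0).card : ℕ) : ℝ) =
      Fintype.card V * ((Q : ℝ) ^ Fintype.card V * (1 / Q)) := by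
  have h1 : ∑ ω : V → Fin Q, (univ.filter fun v => (ω v : ℕ) = 0).card =
      ∑ v : V, (cyl Q 0 ∅ {v}).card := by
    simp only [card_filter, cyl]
    rw [sum_comm]
    simp
  rw [h1, Nat.cast_sum, sum_congr rfl fun v _ => card_cyl hQ (disjoint_empty_left {v})]
  simp

theorem le_sum_card_linkers {S T D Q r : ℕ} {out : V → Finset V} (hr : r < Q) (hQ : 16 * D ≤ Q)
    (hS : 1 ≤ S) (hSD : 2 * S ≤ D)
    (hlow : ∀ X : Finset V, S ≤ X.card → X.card ^ 2 ≤ S * lowCount G T X)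
    (H : IsBalancedDense G D) (hout : ∀ v, (out v).card ≤ 2 * D) :
    (Fintype.card V : ℝ) * ((Q : ℝ) ^ Fintype.card V * (D ^ 2 * ((r : ℝ) / Q * (1 / Q) ^ 2))) ≤
      32 * S * ((∑ ω : V → Fin Q, (linkers G T D r out ω).card : ℕ) : ℝ) := by
  set M := univ.filter fun a => (univ.filter fun y => G.Adj a y).card ≤ 4 * D with hM
  set c := (Q : ℝ) ^ Fintype.card V * ((r : ℝ) / Q * (1 / (Q : ℝ)) ^ 2) with hc
  have hc0 : 0 ≤ c := by positivity
  have hMc : (Fintype.card V : ℝ) ≤ 2 * M.card := by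
    exact_mod_cast card_le_two_mul_card_moderate (by omega) (by simpa using H.sparse univ)
  have hpt : ∀ a ∈ M, (D : ℝ) ^ 2 * c ≤ 16 * S *
      ((univ.filter fun ω : V → Fin Q => a ∈ linkers G T D r out ω).card : ℝ) := by
    intro a ha
    have h1 := lowCount_mul_le_card_mem_linkers (T := T) hr hQ hout (mem_filter.1 ha).2
    have h2 : D ≤ 2 * (univ.filter fun y => G.Adj a y).card := by
      exact le_of_le_of_eq (H.minDeg a) (by congr!)
    have h3 := hlow (univ.filter fun y => G.Adj a y) (by omega)
    have h4 : (D : ℝ) ^ 2 ≤ 4 * (S * lowCount G T (univ.filter fun y => G.Adj a y)) := by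
      have : D ^ 2 ≤ 4 * (S * lowCount G T (univ.filter fun y => G.Adj a y)) := by
        have := Nat.pow_le_pow_left h2 2
        rw [mul_pow] at this
        omega
      exact_mod_cast this
    calc (D : ℝ) ^ 2 * c ≤ 4 * (S * lowCount G T (univ.filter fun y => G.Adj a y)) * c := by gcongr
      _ = 8 * S * (lowCount G T (univ.filter fun y => G.Adj a y) * (c / 2)) := by ring
      _ ≤ 8 * S * (2 * ((univ.filter fun ω : V → Fin Q =>
          a ∈ linkers G T D r out ω).card : ℝ)) := by gcongr
      _ = _ := by ring
  calc (Fintype.card V : ℝ) * ((Q : ℝ) ^ Fintype.card V * (D ^ 2 * ((r : ℝ) / Q * (1 / Q) ^ 2)))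
      = Fintype.card V * (D ^ 2 * c) := by rw [hc]; ring
    _ ≤ 2 * M.card * (D ^ 2 * c) := by gcongr
    _ = 2 * ∑ a ∈ M, (D : ℝ) ^ 2 * c := by rw [sum_const, nsmul_eq_mul]; ring
    _ ≤ 2 * ∑ a ∈ M, 16 * S *
        ((univ.filter fun ω : V → Fin Q => a ∈ linkers G T D r out ω).card : ℝ) := by
      exact mul_le_mul_of_nonneg_left (sum_le_sum hpt) (by norm_num)
    _ ≤ 2 * ∑ a, 16 * S *
        ((univ.filter fun ω : V → Fin Q => a ∈ linkers G T D r out ω).card : ℝ) := by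
      gcongr
      exact subset_univ _
    _ = _ := by
      rw [sum_card_linkers, ← mul_sum]
      push_cast
      ring

theorem sum_adjPairs_linkers_le {S T D r : ℕ} {out : V → Finset V} (hS : 2 ^ 20 ≤ S) (hT : T ≤ S)
    (hD : S ^ 100 ≤ D) (hr : r < D * S ^ 6)
    (hlow : ∀ X : Finset V, S ≤ X.card → X.card ^ 2 ≤ S * lowCount G T X)
    (H : IsBalancedDense G D) :
    ((∑ ω : V → Fin (D * S ^ 6), adjPairs G (linkers G T D r out ω) : ℕ) : ℝ) ≤
      (((D * S ^ 6 : ℕ) : ℝ) ^ Fintype.card V * ((r : ℝ) / (D * S ^ 6 : ℕ)) ^ 2) *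
        (Fintype.card V * (514 * D / S ^ 24 + D / S ^ 26)) := by
  set Q := D * S ^ 6 with hQ
  set c := (Q : ℝ) ^ Fintype.card V * ((r : ℝ) / Q) ^ 2 with hc
  have hc0 : 0 ≤ c := by positivity
  have hS0 : (0 : ℝ) < S := by
    have : 0 < S := by omega
    exact_mod_cast this
  have hD0 : (0 : ℝ) < D := by
    have : 0 < D := lt_of_lt_of_le (by positivity) hD
    exact_mod_cast this
  have hpt : ∀ a, ((∑ a' ∈ univ.filter fun a' => G.Adj a a', (univ.filter fun ω : V → Fin Q =>
      a ∈ linkers G T D r out ω ∧ a' ∈ linkers G T D r out ω).card : ℕ) : ℝ) ≤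
      c * (257 / S ^ 24) * (univ.filter fun a' => G.Adj a a').card + c * (D / S ^ 26) := by
    intro a
    by_cases ha : (univ.filter fun y => G.Adj a y).card ≤ 4 * D
    swap
    · rw [sum_eq_zero]
      · simp only [Nat.cast_zero]
        positivity
      · intro a' _
        rw [card_eq_zero]
        refine filter_false_of_mem fun ω _ hω => ?_
        exact ha (mem_filter.1 hω.1).2.2.1
    have hheavy : ((heavyNeighbours G D (S ^ 18) a).card : ℝ) ≤ D / S ^ 26 := by
      rw [le_div_iff₀ (by positivity)]
      exact_mod_cast card_heavyNeighbours_le hS hT hD hlow ha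
    have hterm : ∀ a' ∈ univ.filter (fun a' => G.Adj a a'), ((univ.filter fun ω : V → Fin Q =>
        a ∈ linkers G T D r out ω ∧ a' ∈ linkers G T D r out ω).card : ℝ) ≤
        c * (257 / S ^ 24) + if a' ∈ heavyNeighbours G D (S ^ 18) a then c else 0 := by
      intro a' ha'
      have hadj := (mem_filter.1 ha').2
      by_cases hh : a' ∈ heavyNeighbours G D (S ^ 18) a
      · rw [if_pos hh]
        refine (card_mem_linkers_pair_le_sq hr hadj.ne).trans ?_
        have : 0 ≤ c * (257 / (S : ℝ) ^ 24) := by positivity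
        linarith
      · rw [if_neg hh, add_zero]
        refine (card_mem_linkers_pair_le hr hadj.ne).trans ?_
        refine mul_le_mul_of_nonneg_left ?_ hc0
        have h1 : (codeg G a a' : ℝ) * S ^ 18 ≤ D := by
          have : codeg G a a' * S ^ 18 ≤ D := by
            by_contra hcon
            exact hh (mem_filter.2 ⟨mem_univ _, hadj, not_le.1 hcon⟩)
          exact_mod_cast this
        have h2 : (codeg G a a' : ℝ) ≤ D / S ^ 18 := by
          rwa [le_div_iff₀ (by positivity)]
        calc (codeg G a a' : ℝ) * (1 / Q) + (4 * D) ^ 4 * (1 / Q) ^ 4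
            ≤ (D : ℝ) / S ^ 18 * (1 / Q) + (4 * D) ^ 4 * (1 / Q) ^ 4 := by gcongr
          _ = 257 / (S : ℝ) ^ 24 := by
            rw [hQ]
            push_cast
            field_simp
            ring
    rw [Nat.cast_sum]
    refine (sum_le_sum hterm).trans ?_
    rw [sum_add_distrib, sum_const, nsmul_eq_mul, ← sum_filter, sum_const, nsmul_eq_mul]
    have h3 : ((univ.filter fun a' => G.Adj a a').filter
        fun a' => a' ∈ heavyNeighbours G D (S ^ 18) a).card ≤
        (heavyNeighbours G D (S ^ 18) a).card :=
      card_le_card fun a' ha' => (mem_filter.1 ha').2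
    have h4 : (((univ.filter fun a' => G.Adj a a').filter
        fun a' => a' ∈ heavyNeighbours G D (S ^ 18) a).card : ℝ) ≤ D / S ^ 26 :=
      le_trans (by exact_mod_cast h3) hheavy
    have h5 := mul_le_mul_of_nonneg_right h4 hc0
    linarith
  have hdeg : ((∑ a, (univ.filter fun a' => G.Adj a a').card : ℕ) : ℝ) ≤
      2 * D * Fintype.card V := by
    have := H.sparse univ
    rw [adjPairs_eq_sum, card_univ] at this
    exact_mod_cast this
  rw [sum_adjPairs_linkers, Nat.cast_sum]
  refine (sum_le_sum fun a _ => hpt a).trans ?_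
  rw [sum_add_distrib, ← mul_sum, sum_const, card_univ, nsmul_eq_mul, ← Nat.cast_sum]
  have h6 := mul_le_mul_of_nonneg_left hdeg (by positivity : 0 ≤ c * (257 / (S : ℝ) ^ 24))
  refine (add_le_add_left h6 _).trans (le_of_eq ?_)
  ring

/-- Some labelling makes the linkers outnumber both the adjacent linkers and a large multiple of
the vertices labelled zero. -/
theorem exists_labelling [Nonempty V] {S T D f : ℕ} {out : V → Finset V} (hS : 2 ^ 20 ≤ S)
    (hT : T ≤ S) (hf : f ≤ S) (hD : S ^ 100 ≤ D)
    (hlow : ∀ X : Finset V, S ≤ X.card → X.card ^ 2 ≤ S * lowCount G T X)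
    (H : IsBalancedDense G D) (hout : ∀ v, (out v).card ≤ 2 * D) :
    ∃ (Q r : ℕ) (ω : V → Fin Q), f * T * (univ.filter fun v => (ω v : ℕ) = 0).card +
      adjPairs G (linkers G T D r out ω) < (linkers G T D r out ω).card := by
  refine ⟨D * S ^ 6, S ^ 16, ?_⟩
  have hSpos : 0 < S := by omega
  have hD16 : S ^ 16 ≤ D := (Nat.pow_le_pow_right hSpos (by norm_num)).trans hD
  have hDpos : 0 < D := lt_of_lt_of_le (by positivity) hD
  have hS6 : 16 ≤ S ^ 6 := by
    calc 16 ≤ S := by omega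
      _ ≤ S ^ 6 := Nat.le_self_pow (by norm_num) _
  have hr : S ^ 16 < D * S ^ 6 := by nlinarith
  have hQ16 : 16 * D ≤ D * S ^ 6 := by nlinarith
  have hSD : 2 * S ≤ D := by
    calc 2 * S ≤ S * S := Nat.mul_le_mul_right _ (by omega)
      _ = S ^ 2 := by ring
      _ ≤ S ^ 100 := Nat.pow_le_pow_right hSpos (by norm_num)
      _ ≤ D := hD
  have h1 := le_sum_card_linkers (T := T) hr hQ16 hSpos hSD hlow H hout
  have h2 := sum_adjPairs_linkers_le (out := out) hS hT hD hr hlow H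
  have h3 := sum_card_label_zero (V := V) (show 0 < D * S ^ 6 by positivity)
  by_contra! hcon
  have h4 := sum_le_sum fun (ω : V → Fin (D * S ^ 6)) (_ : ω ∈ univ) => hcon ω
  rw [sum_add_distrib, ← mul_sum] at h4
  have h5 : ((∑ ω : V → Fin (D * S ^ 6), (linkers G T D (S ^ 16) out ω).card : ℕ) : ℝ) ≤
      f * T * ((∑ ω : V → Fin (D * S ^ 6), (univ.filter fun v => (ω v : ℕ) = 0).card : ℕ) : ℝ) +
      ((∑ ω : V → Fin (D * S ^ 6), adjPairs G (linkers G T D (S ^ 16) out ω) : ℕ) : ℝ) := by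
    exact_mod_cast h4
  rw [h3] at h5
  have hSr : (2 : ℝ) ^ 20 ≤ S := by exact_mod_cast hS
  have hS0 : (0 : ℝ) < S := by exact_mod_cast hSpos
  have hD0 : (0 : ℝ) < D := by exact_mod_cast hDpos
  set c := (Fintype.card V : ℝ) * (((D * S ^ 6 : ℕ) : ℝ) ^ Fintype.card V * (1 / (D * S ^ 6 : ℕ)))
    with hc
  have hc0 : 0 < c := by
    have : (0 : ℝ) < Fintype.card V := by exact_mod_cast Fintype.card_pos
    positivity
  have h6 : (Fintype.card V : ℝ) * (((D * S ^ 6 : ℕ) : ℝ) ^ Fintype.card V *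
      (D ^ 2 * (((S ^ 16 : ℕ) : ℝ) / (D * S ^ 6 : ℕ) * (1 / (D * S ^ 6 : ℕ)) ^ 2))) =
      c * S ^ 4 := by
    rw [hc]
    generalize ((D * S ^ 6 : ℕ) : ℝ) ^ Fintype.card V = N
    push_cast
    field_simp
  have h7 : (((D * S ^ 6 : ℕ) : ℝ) ^ Fintype.card V * (((S ^ 16 : ℕ) : ℝ) / (D * S ^ 6 : ℕ)) ^ 2) *
        (Fintype.card V * (514 * D / S ^ 24 + D / S ^ 26)) = c * (514 * S ^ 2 + 1) := by
    rw [hc]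
    generalize ((D * S ^ 6 : ℕ) : ℝ) ^ Fintype.card V = N
    push_cast
    field_simp
  rw [h6] at h1
  rw [h7] at h2
  have hfT : (f : ℝ) * T ≤ S ^ 2 := by
    rw [sq]
    exact_mod_cast Nat.mul_le_mul hf hT
  have h8 : c * (S : ℝ) ^ 4 ≤ 32 * S * (c * S ^ 2 + c * (514 * S ^ 2 + 1)) := by
    refine h1.trans (mul_le_mul_of_nonneg_left (h5.trans (add_le_add ?_ h2)) (by positivity))
    rw [mul_comm c]
    exact mul_le_mul_of_nonneg_right hfT hc0.le
  have h9 : c * S * (S : ℝ) ^ 3 ≤ c * S * (32 * (515 * S ^ 2 + 1)) := by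
    refine le_trans (le_of_eq (by ring)) (h8.trans (le_of_eq (by ring)))
  have h10 := le_of_mul_le_mul_left h9 (by positivity)
  nlinarith [mul_le_mul_of_nonneg_right hSr (sq_nonneg (S : ℝ)), sq_nonneg (S : ℝ)]

end SamplingExpectation

section LinkGraph
set_option linter.unusedSectionVars false
open scoped Classical
variable {V : Type} [Fintype V]

/-- The vertices labelled zero without out-neighbours labelled zero. -/
noncomputable def sinkZeros {Q : ℕ} (out : V → Finset V) (ω : V → Fin Q) : Finset V :=
  univ.filter fun x => (ω x : ℕ) = 0 ∧ ∀ z ∈ out x, (ω z : ℕ) ≠ 0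

/-- Two vertices of `B` are adjacent in the link graph if some vertex of `I` has exactly these two
neighbours in `B`. -/
def linkGraph (G : SimpleGraph V) (I B : Finset V) : SimpleGraph {x // x ∈ B} where
  Adj x y := x ≠ y ∧ ∃ a ∈ I, ∀ w ∈ B, G.Adj a w ↔ w = x ∨ w = y
  symm := ⟨fun _ _ ⟨hne, a, ha, h⟩ => ⟨hne.symm, a, ha, fun w hw => (h w hw).trans or_comm⟩⟩
  loopless := ⟨fun _ h => h.1 rfl⟩

theorem exists_isInducedSubdiv_linkGraph [Nonempty V] {G : SimpleGraph V} {I B : Finset V}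
    (hI : ∀ a ∈ I, ∀ a' ∈ I, ¬ G.Adj a a') (hB : ∀ x ∈ B, ∀ y ∈ B, ¬ G.Adj x y) :
    ∃ μ, IsInducedSubdiv (linkGraph G I B) G (Subtype.val : {x // x ∈ B} → V) μ := by
  have key : ∀ e : Sym2 {x // x ∈ B}, ∃ a, e ∈ (linkGraph G I B).edgeSet →
      a ∈ I ∧ ∀ w : {x // x ∈ B}, G.Adj a w ↔ w ∈ e := by
    intro e
    by_cases he : e ∈ (linkGraph G I B).edgeSet
    · induction e with | _ x y =>
      obtain ⟨-, a, ha, h⟩ := (SimpleGraph.mem_edgeSet _).1 he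
      refine ⟨a, fun _ => ⟨ha, fun w => ?_⟩⟩
      rw [h w w.2, Sym2.mem_iff, Subtype.ext_iff, Subtype.ext_iff]
    · exact ⟨Classical.arbitrary V, fun h => absurd h he⟩
  choose μ hμ using key
  exact ⟨μ, Subtype.val_injective, fun w w' => hB _ w.2 _ w'.2, fun e he => (hμ e he).2,
    fun e he e' he' => hI _ (hμ e he).1 _ (hμ e' he').1⟩

theorem IsLink.mem_sinkZeros {G : SimpleGraph V} {T Q : ℕ} {out : V → Finset V} {ω : V → Fin Q}
    {a x y : V} (hadj : ∀ v, ∀ u ∈ out v, G.Adj v u) (h : IsLink G T out ω a x y) :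
    x ∈ sinkZeros out ω ∧ y ∈ sinkZeros out ω := by
  obtain ⟨⟨hne, hnadj, -⟩, -, -, hx0, hy0, hz⟩ := h
  refine ⟨mem_filter.2 ⟨mem_univ _, hx0, fun z hzx hz0 => ?_⟩,
    mem_filter.2 ⟨mem_univ _, hy0, fun z hzy hz0 => ?_⟩⟩
  · have hzadj := hadj _ _ hzx
    exact (hz z hz0 hzadj.ne' fun h => hnadj (h ▸ hzadj)).2.1 hzx
  · have hzadj := hadj _ _ hzy
    exact (hz z hz0 (fun h => hnadj (h ▸ hzadj.symm)) hzadj.ne').2.2 hzy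

/-- Linkers outnumbering their adjacent pairs and the zero labels give a dense induced
1-subdivision. -/
theorem exists_dense_isInducedSubdiv [Nonempty V] {G : SimpleGraph V} {T D r f Q : ℕ}
    {out : V → Finset V} {ω : V → Fin Q} (hadj : ∀ v, ∀ u ∈ out v, G.Adj v u)
    (hor : ∀ u v, G.Adj u v → v ∈ out u ∨ u ∈ out v)
    (h : f * T * (univ.filter fun v => (ω v : ℕ) = 0).card +
      adjPairs G (linkers G T D r out ω) < (linkers G T D r out ω).card) :
    ∃ (B : Finset V) (Γ : SimpleGraph {x // x ∈ B}) (μ : Sym2 {x // x ∈ B} → V), B.Nonempty ∧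
      f * B.card ≤ adjPairs Γ univ ∧ IsInducedSubdiv Γ G Subtype.val μ := by
  set L := linkers G T D r out ω with hL
  set B := sinkZeros out ω with hB
  set I := L.filter fun a => ∀ a' ∈ L, ¬ G.Adj a a' with hI
  have hLI : L.card ≤ I.card + adjPairs G L := by
    rw [← card_filter_add_card_filter_not (s := L) fun a => ∀ a' ∈ L, ¬ G.Adj a a']
    refine Nat.add_le_add_left ?_ _
    rw [adjPairs_eq_sum, card_eq_sum_ones]
    refine (sum_le_sum fun a ha => ?_).trans (sum_le_sum_of_subset (filter_subset _ L))
    have h1 := (mem_filter.1 ha).2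
    push Not at h1
    obtain ⟨a', ha', haa'⟩ := h1
    exact card_pos.2 ⟨a', mem_filter.2 ⟨ha', haa'⟩⟩
  have hBind : ∀ x ∈ B, ∀ y ∈ B, ¬ G.Adj x y := by
    intro x hx y hy hxy
    have hx' := (mem_filter.1 hx).2
    have hy' := (mem_filter.1 hy).2
    rcases hor x y hxy with hout | hout
    · exact hx'.2 _ hout hy'.1
    · exact hy'.2 _ hout hx'.1
  have hIind : ∀ a ∈ I, ∀ a' ∈ I, ¬ G.Adj a a' := fun a ha a' ha' =>
    (mem_filter.1 ha).2 _ (mem_filter.1 ha').1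
  have hIlink : ∀ a ∈ I, ∃ p : {x // x ∈ B} × {x // x ∈ B}, IsLink G T out ω a p.1 p.2 := by
    intro a ha
    obtain ⟨x, y, hxy⟩ := (mem_filter.1 (mem_filter.1 ha).1).2.2.2
    exact ⟨(⟨x, (hxy.mem_sinkZeros hadj).1⟩, ⟨y, (hxy.mem_sinkZeros hadj).2⟩), hxy⟩
  have hIne : I.Nonempty := by
    rw [← card_pos]
    omega
  obtain ⟨a₀, ha₀⟩ := hIne
  have hBne : B.Nonempty := by
    obtain ⟨p, -⟩ := hIlink a₀ ha₀
    exact ⟨p.1, p.1.2⟩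
  obtain ⟨μ, hμ⟩ := exists_isInducedSubdiv_linkGraph hIind hBind
  refine ⟨B, linkGraph G I B, μ, hBne, ?_, hμ⟩
  have hcount : I.card ≤ T * adjPairs (linkGraph G I B) univ := by
    have : Nonempty {x // x ∈ B} := ⟨⟨_, hBne.choose_spec⟩⟩
    choose! p hp using hIlink
    refine card_le_mul_card_image_of_maps_to (f := p) (fun a ha => ?_) T fun q _ => ?_
    · obtain ⟨hlow, hax, hay, -, -, hz⟩ := hp a ha
      refine mem_filter.2 ⟨by simp, fun heq => hlow.1 (congrArg Subtype.val heq), a, ha, ?_⟩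
      intro w hw
      refine ⟨fun haw => ?_, ?_⟩
      · by_contra! hcon
        exact (hz w (mem_filter.1 hw).2.1 hcon.1 hcon.2).1 haw
      · rintro (rfl | rfl)
        · exact hax
        · exact hay
    · rcases (I.filter fun a => p a = q).eq_empty_or_nonempty with hempty | ⟨a, ha⟩
      · rw [hempty]
        simp
      · obtain ⟨haI, rfl⟩ := mem_filter.1 ha
        refine le_trans (card_le_card fun c hc => ?_) (hp a haI).1.2.2.le
        obtain ⟨hcI, hcq⟩ := mem_filter.1 hc
        obtain ⟨-, hcx, hcy, -⟩ := hp c hcI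
        rw [hcq] at hcx hcy
        exact mem_filter.2 ⟨mem_univ _, hcx.symm, hcy.symm⟩
  have hBc : B.card ≤ (univ.filter fun v => (ω v : ℕ) = 0).card :=
    card_le_card fun x hx => mem_filter.2 ⟨mem_univ _, (mem_filter.1 hx).2.1⟩
  have hlt : T * (f * B.card) < T * adjPairs (linkGraph G I B) univ := by
    calc T * (f * B.card) = f * T * B.card := by ring
      _ ≤ f * T * (univ.filter fun v => (ω v : ℕ) = 0).card := Nat.mul_le_mul_left _ hBc
      _ < I.card := by omega
      _ ≤ _ := hcount
  exact (lt_of_mul_lt_mul_left hlt (Nat.zero_le _)).le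

/-- A balanced dense graph with many low pairs in all large sets contains an induced balanced
subdivision. -/
theorem IsBalancedDense.hasInducedBalancedSubdivision [Nonempty V] {G : SimpleGraph V}
    {S T D f h : ℕ} (hh : 2 ≤ h) (hS : 2 ^ 20 ≤ S) (hT : T ≤ S) (hf : f ≤ S) (hD : S ^ 100 ≤ D)
    (hlow : ∀ X : Finset V, S ≤ X.card → X.card ^ 2 ≤ S * lowCount G T X)
    (H : IsBalancedDense G D)
    (hTK : ∀ (n : ℕ) (W : Type) [Fintype W] [Nonempty W] (Γ : SimpleGraph W),
      Fintype.card W ≤ n → f * Fintype.card W ≤ adjPairs Γ univ → ∃ ℓ, BalTK Γ h ℓ) :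
    HasInducedBalancedSubdivision G h := by
  obtain ⟨out, hout, hadj, hor⟩ := exists_orientation H.sparse
  obtain ⟨Q, r, ω, hω⟩ := exists_labelling hS hT hf hD hlow H hout
  obtain ⟨B, Γ, μ, hB, hdense, hsub⟩ := exists_dense_isInducedSubdiv hadj hor hω
  have : Nonempty {x // x ∈ B} := ⟨⟨_, hB.choose_spec⟩⟩
  obtain ⟨ℓ, hℓ⟩ := hTK _ {x // x ∈ B} Γ le_rfl (by rwa [Fintype.card_coe])
  exact hsub.hasInducedBalancedSubdivision hh hℓ

end LinkGraph

section Transfer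

theorem HasKssSubgraph.of_comap {V W : Type} {G : SimpleGraph V} {φ : W ↪ V} {s : ℕ}
    (h : HasKssSubgraph (G.comap φ) s) : HasKssSubgraph G s := by
  obtain ⟨g, hg⟩ := h
  exact ⟨(SimpleGraph.Embedding.comap φ G).toHom.comp g, φ.injective.comp hg⟩

theorem HasInducedBalancedSubdivision.of_comap {V W : Type} {G : SimpleGraph V} {φ : W ↪ V} {h : ℕ}
    (H : HasInducedBalancedSubdivision (G.comap φ) h) : HasInducedBalancedSubdivision G h := by
  obtain ⟨ℓ, hℓ, ⟨g⟩⟩ := H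
  exact ⟨ℓ, hℓ, ⟨(SimpleGraph.Embedding.comap φ G).comp g⟩⟩

open scoped Classical in
theorem adjPairs_univ_eq_two_mul_ncard_edgeSet {V : Type} [Fintype V] (G : SimpleGraph V) :
    adjPairs G univ = 2 * G.edgeSet.ncard := by
  rw [adjPairs_eq_sum, Set.ncard_eq_toFinset_card', ← SimpleGraph.edgeFinset,
    ← SimpleGraph.sum_degrees_eq_twice_card_edges]
  refine sum_congr rfl fun v _ => ?_
  rw [← SimpleGraph.card_neighborFinset_eq_degree, SimpleGraph.neighborFinset_eq_filter]

theorem parameter_bounds {h s : ℕ} (hh : 2 ≤ h) (hs : 4 ≤ s) (hhs : h ≤ s) :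
    (2 * s) ^ (h + h ^ 2 + 1) ≤ s ^ (5 * h ^ 2) ∧
    2 * (2 * (4 * s) ^ h) ^ h * h ^ 3 * s ≤ s ^ (5 * h ^ 2) ∧
    (4 * s) ^ h ≤ s ^ (5 * h ^ 2) ∧
    2 * (2 * (4 * s) ^ h) ^ h * h ^ 2 ≤ s ^ (5 * h ^ 2) := by
  have h4s : 4 * s ≤ s ^ 2 := by nlinarith
  have h2s : 2 * s ≤ s ^ 2 := by nlinarith
  have hpow : ∀ {m : ℕ}, m ≤ 5 * h ^ 2 → s ^ m ≤ s ^ (5 * h ^ 2) := fun hm =>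
    Nat.pow_le_pow_right (by omega) hm
  have hM : 2 * (2 * (4 * s) ^ h) ^ h ≤ s * (s * (s ^ 2) ^ h) ^ h := by
    gcongr <;> omega
  refine ⟨?_, ?_, ?_, ?_⟩
  · calc (2 * s) ^ (h + h ^ 2 + 1) ≤ (s ^ 2) ^ (h + h ^ 2 + 1) := Nat.pow_le_pow_left h2s _
      _ = s ^ (2 * (h + h ^ 2 + 1)) := (pow_mul _ _ _).symm
      _ ≤ _ := hpow (by nlinarith)
  · calc 2 * (2 * (4 * s) ^ h) ^ h * h ^ 3 * s ≤ s * (s * (s ^ 2) ^ h) ^ h * s ^ 3 * s := by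
          gcongr
      _ = s ^ (5 + h + 2 * h ^ 2) := by
          rw [mul_pow, ← pow_mul, ← pow_mul]
          ring
      _ ≤ _ := hpow (by nlinarith)
  · calc (4 * s) ^ h ≤ (s ^ 2) ^ h := Nat.pow_le_pow_left h4s _
      _ = s ^ (2 * h) := (pow_mul _ _ _).symm
      _ ≤ _ := hpow (by nlinarith)
  · calc 2 * (2 * (4 * s) ^ h) ^ h * h ^ 2 ≤ s * (s * (s ^ 2) ^ h) ^ h * s ^ 2 := by
          gcongr
      _ = s ^ (3 + h + 2 * h ^ 2) := by
          rw [mul_pow, ← pow_mul, ← pow_mul]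
          ring
      _ ≤ _ := hpow (by nlinarith)

end Transfer

/-- For every `h ≥ 2` and all sufficiently large `s`, every graph with
average degree at least `s ^ (500 h²)` contains `K_{s,s}` as a subgraph or an induced
proper balanced subdivision of `K_h`. -/
theorem stmt0 :
    ∀ h : ℕ, 2 ≤ h → ∃ s₀ : ℕ, ∀ s : ℕ, s₀ ≤ s →
      ∀ (V : Type) [Fintype V] (G : SimpleGraph V),
        avgDeg G ≥ (s : ℝ) ^ (500 * h ^ 2) →
        HasKssSubgraph G s ∨ HasInducedBalancedSubdivision G h := by
  classical
  intro h hh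
  obtain ⟨f, -, hTK⟩ := exists_balTK_of_dense h hh
  refine ⟨f + h + 2 ^ 20, fun s hs V _ G hG => ?_⟩
  by_contra! hcon
  obtain ⟨hKss, hind⟩ := hcon
  obtain ⟨hT, hX, hX', hK⟩ := parameter_bounds hh (show 4 ≤ s by omega) (by omega)
  set S := s ^ (5 * h ^ 2) with hS
  have hsS : s ≤ S := Nat.le_self_pow (by positivity) s
  have hS100 : S ^ 100 = s ^ (500 * h ^ 2) := by
    rw [hS, ← pow_mul]
    ring_nf
  have hspos : (0 : ℝ) < s := by
    have : 0 < s := by omega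
    exact_mod_cast this
  have hV : Nonempty V := by
    by_contra hempty
    rw [not_nonempty_iff] at hempty
    have : (0 : ℝ) < (s : ℝ) ^ (500 * h ^ 2) := by positivity
    simp only [avgDeg, Fintype.card_eq_zero, Nat.cast_zero, div_zero] at hG
    linarith
  have hdense : S ^ 100 * Fintype.card V ≤ adjPairs G univ := by
    have hcard : (0 : ℝ) < Fintype.card V := by exact_mod_cast Fintype.card_pos
    rw [ge_iff_le, avgDeg, le_div_iff₀ hcard] at hG
    rw [adjPairs_univ_eq_two_mul_ncard_edgeSet, hS100]
    exact_mod_cast hG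
  obtain ⟨Y, D, hY, hD, H⟩ := exists_balancedDense G
    (Nat.one_le_pow _ _ (by omega : 0 < S)) hdense
  have : Nonempty {x // x ∈ Y} := ⟨⟨_, hY.choose_spec⟩⟩
  have hKss' : ¬ HasKssSubgraph (G.comap (Subtype.val : {x // x ∈ Y} → V)) s := fun h' =>
    hKss (HasKssSubgraph.of_comap (φ := Function.Embedding.subtype _) h')
  have hind' : ¬ HasInducedBalancedSubdivision (G.comap (Subtype.val : {x // x ∈ Y} → V)) h :=
    fun h' => hind (HasInducedBalancedSubdivision.of_comap (φ := Function.Embedding.subtype _) h')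
  refine hind' (H.hasInducedBalancedSubdivision hh (by omega) hT (by omega) hD ?_ hTK)
  intro X hSX
  exact (sq_card_le_lowCount hh (kssFree_of_not_hasKssSubgraph hKss') (by omega) hind'
    (hX.trans hSX) (hX'.trans hSX)).trans (Nat.mul_le_mul_right _ hK)
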